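/- Fix α ∈ (1/2, ln 3/ln 2 − 1) and let ζ = 1 − 2(2^α − 1) > 0. There exist θ₀ = θ₀(α) > 0, β₀ = β₀(α) > 0 (and a sufficiently large value of J(1), depending on α) such that for every 0 < θ ≤ θ₀, every β ≥ β₀, and every finite set Λ ⊂ ℤ with 0 ∈ Λ, the annealed magnetization at the origin under the + boundary condition Gibbs measure satisfies E_h[ Σ_{σ} σ₀ μ⁺_Λ(σ) ] ≥ 1 − 2 e^{−b̄/100}, where b̄ = min(βζ/4, ζ²/(2¹⁰θ²)). -/

import Mathlib

open scoped BigOperators Classical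

noncomputable section

/-- The spin value associated to a Boolean: `true ↦ +1`, `false ↦ -1`. -/
def spin (b : Bool) : ℝ := if b then 1 else -1

/-- The pair coupling: `J(1) = J₁` (a large constant) and `J(n) = n^{-(2-α)}` for `n ≥ 2`. -/
def Jcoup (J₁ α : ℝ) (n : ℕ) : ℝ := if n = 1 then J₁ else (n : ℝ) ^ (α - 2)

/-- The Hamiltonian in the finite volume `Λ ⊂ ℤ` with homogeneous boundary condition `τ`,
random field `h` and field strength `θ`:
`H^τ(σ) = (1/2) Σ_{i≠j∈Λ} J(|i-j|)(1-σᵢσⱼ) + Σ_{i∈Λ} Σ_{j∉Λ} J(|i-j|)(1-τσᵢ) - θ Σ_{i∈Λ} hᵢσᵢ`. -/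
def Ham (J₁ α θ τ : ℝ) (Λ : Finset ℤ) (h : ℤ → ℝ) (σ : Λ → Bool) : ℝ :=
  (1 / 2) * ∑ i : Λ, ∑ j : Λ, (if i = j then 0 else
      Jcoup J₁ α ((i : ℤ) - (j : ℤ)).natAbs * (1 - spin (σ i) * spin (σ j)))
  + ∑ i : Λ, (∑' j : ℤ, if j ∈ Λ then 0 else Jcoup J₁ α ((i : ℤ) - j).natAbs)
      * (1 - τ * spin (σ i))
  - θ * ∑ i : Λ, h (i : ℤ) * spin (σ i)

/-- The finite volume Gibbs probability of an event `E` at inverse temperature `β`,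
with boundary condition `τ`. -/
def gibbs (J₁ α θ τ β : ℝ) (Λ : Finset ℤ) (h : ℤ → ℝ) (E : (Λ → Bool) → Prop) : ℝ :=
  (∑ σ : Λ → Bool, if E σ then Real.exp (-β * Ham J₁ α θ τ Λ h σ) else 0) /
    ∑ σ : Λ → Bool, Real.exp (-β * Ham J₁ α θ τ Λ h σ)

/-- Expectation over the i.i.d. symmetric `±1` random field (only its restriction to `Λ`
matters, so it is an average over the `2^|Λ|` field configurations in `Λ`). -/
def fieldE (Λ : Finset ℤ) (f : (ℤ → ℝ) → ℝ) : ℝ :=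
  (1 / 2 ^ Λ.card) *
    ∑ η : Λ → Bool, f (fun i => if hi : i ∈ Λ then spin (η ⟨i, hi⟩) else 1)

/-- The finite volume Gibbs expectation of an observable `f` at inverse temperature `β`,
with boundary condition `τ`. -/
def gibbsAvg (J₁ α θ τ β : ℝ) (Λ : Finset ℤ) (h : ℤ → ℝ) (f : (Λ → Bool) → ℝ) : ℝ :=
  (∑ σ : Λ → Bool, f σ * Real.exp (-β * Ham J₁ α θ τ Λ h σ)) /
    ∑ σ : Λ → Bool, Real.exp (-β * Ham J₁ α θ τ Λ h σ)


/-- Abstract facts about the coupling that are used in the argument. -/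
structure JF (α J₁ : ℝ) (J : ℤ → ℝ) : Prop where
  ha : 1 / 2 < α
  ha1 : α < 1
  hJ1 : 1 ≤ J₁
  zero : J 0 = 0
  symm : ∀ n, J (-n) = J n
  nonneg : ∀ n, 0 ≤ J n
  summ : Summable J
  comp : ∀ n m : ℤ, 2 ≤ n.natAbs → m ≠ 0 → m.natAbs ≤ 2 * n.natAbs → J n ≤ 4 * J m
  lower : ∀ n : ℤ, n ≠ 0 → (|n| : ℝ) ^ (α - 2) ≤ J n
  tail : ∀ x : ℝ, 2 ≤ x → ∑' j : ℤ, (if x ≤ |(j : ℝ)| then J j else 0) ≤ 4 / (1 - α) * x ^ (α - 1)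
  one : J₁ ≤ J 1

lemma bern_tel (α : ℝ) (ha : 1 / 2 < α) (ha1 : α < 1) (n : ℕ) :
    (1 - α) * ((n : ℝ) + 2) ^ (α - 2) ≤ ((n : ℝ) + 1) ^ (α - 1) - ((n : ℝ) + 2) ^ (α - 1) := by
  have hn : (0 : ℝ) ≤ n := Nat.cast_nonneg n
  set y : ℝ := (n : ℝ) + 2 with hy
  have hy0 : 0 < y := by linarith
  have e1 : (n : ℝ) + 1 = y * (1 + (-(1 / y))) := by field_simp; rw [hy]; ring
  have hs : -1 ≤ -(1 / y) := by
    have : 1 / y ≤ 1 := by rw [div_le_one hy0]; linarith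
    linarith
  have hlt : 0 < 1 + (-(1 / y)) := by
    have : 1 / y < 1 := by rw [div_lt_one hy0]; linarith
    linarith
  have hb := rpow_one_add_le_one_add_mul_self hs (p := 1 - α) (by linarith) (by linarith)
  -- (1 - 1/y)^(1-α) ≤ 1 - (1-α)/y
  set z := (1 + (-(1 / y))) ^ (1 - α) with hz
  have hz0 : 0 < z := Real.rpow_pos_of_pos hlt _
  have e2 : (1 + (-(1 / y))) ^ (α - 1) = z⁻¹ := by
    rw [hz, ← Real.rpow_neg hlt.le]; congr 1; ring
  have h3 : 1 + (1 - α) / y ≤ z⁻¹ := by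
    have h4 : 1 + (1 - α) / y ≤ (1 - (1 - α) / y)⁻¹ := by
      have hpos : 0 < 1 - (1 - α) / y := by
        have : (1 - α) / y < 1 := by rw [div_lt_one hy0]; linarith
        linarith
      rw [le_inv_comm₀ (by positivity) hpos]
      rw [← one_div, le_div_iff₀ (by have : 0 ≤ (1 - α) / y := div_nonneg (by linarith) hy0.le
                                     linarith)]
      nlinarith [sq_nonneg ((1 - α) / y)]
    refine h4.trans ?_
    apply inv_anti₀ hz0
    refine hb.trans (le_of_eq ?_)
    ring
  rw [e1, Real.mul_rpow hy0.le hlt.le, e2]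
  have e5 : y ^ (α - 2) = y ^ (α - 1) / y := by
    rw [show α - 2 = (α - 1) - 1 by ring, Real.rpow_sub_one hy0.ne']
  rw [e5]
  have hyp : 0 < y ^ (α - 1) := Real.rpow_pos_of_pos hy0 _
  have := mul_le_mul_of_nonneg_left h3 hyp.le
  have e6 : (1 - α) * (y ^ (α - 1) / y) = y ^ (α - 1) * ((1 - α) / y) := by ring
  rw [e6]; linarith

/-- the coupling on `ℤ` -/
def JJ (J₁ α : ℝ) (n : ℤ) : ℝ := Jcoup J₁ α n.natAbs

lemma JJ_nat_tail_partial (α : ℝ) (ha : 1 / 2 < α) (ha1 : α < 1) (N k : ℕ) :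
    ∑ i ∈ Finset.range k, ((N : ℝ) + i + 2) ^ (α - 2) ≤ 1 / (1 - α) * ((N : ℝ) + 1) ^ (α - 1) := by
  have h : ∀ k : ℕ, (1 - α) * ∑ i ∈ Finset.range k, ((N : ℝ) + i + 2) ^ (α - 2) ≤
      ((N : ℝ) + 1) ^ (α - 1) - ((N : ℝ) + k + 1) ^ (α - 1) := by
    intro k
    induction k with
    | zero => simp
    | succ k ih =>
      rw [Finset.sum_range_succ, mul_add]
      have := bern_tel α ha ha1 (N + k)
      push_cast at this ⊢
      have e : (N : ℝ) + k + 2 = N + (k + 1) + 1 := by ring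
      rw [e] at this ⊢
      linarith
  have h1 := h k
  have : 0 ≤ ((N : ℝ) + k + 1) ^ (α - 1) := by positivity
  rw [one_div, ← div_eq_inv_mul, le_div_iff₀ (by linarith)]
  nlinarith

lemma JF_JJ (α J₁ : ℝ) (ha : 1 / 2 < α) (ha1 : α < 1) (hJ : 1 ≤ J₁) : JF α J₁ (JJ J₁ α) := by
  have h2 : ∀ n : ℤ, 2 ≤ n.natAbs → JJ J₁ α n = (|n| : ℝ) ^ (α - 2) := by
    intro n hn
    have : n.natAbs ≠ 1 := by omega
    rw [JJ, Jcoup, if_neg this]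
    congr 1
    rw [Nat.cast_natAbs]; simp
  have hlow : ∀ n : ℤ, n ≠ 0 → (|n| : ℝ) ^ (α - 2) ≤ JJ J₁ α n := by
    intro n hn
    by_cases h1 : 2 ≤ n.natAbs
    · rw [h2 n h1]
    · have h3 : n.natAbs = 1 := by omega
      have h4 : |n| = 1 := by rw [Int.abs_eq_natAbs]; omega
      rw [JJ, Jcoup, if_pos h3]
      have : (|n| : ℝ) = 1 := by exact_mod_cast h4
      rw [this]; simpa using hJ
  have hnn : ∀ n, 0 ≤ JJ J₁ α n := by
    intro n
    rw [JJ, Jcoup]; split_ifs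
    · linarith
    · positivity
  have hsm : Summable (JJ J₁ α) := by
    have hs : Summable (fun n : ℕ => Jcoup J₁ α n) := by
      have h0 : Summable (fun n : ℕ => (n : ℝ) ^ (α - 2)) := by
        rw [Real.summable_nat_rpow]; linarith
      apply (summable_nat_add_iff 2).1
      have h1 := (summable_nat_add_iff 2).2 h0
      refine h1.congr ?_
      intro n
      rw [Jcoup, if_neg (by omega)]
    apply Summable.of_nat_of_neg
    · simpa [JJ] using hs
    · simpa [JJ] using hs
  refine ⟨ha, ha1, hJ, ?_, ?_, hnn, hsm, ?_, hlow, ?_, ?_⟩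
  · simp [JJ, Jcoup]; exact Real.zero_rpow (by linarith)
  · intro n; simp [JJ]
  · intro n m hn hm hmn
    rw [h2 n hn]
    have h3 := hlow m hm
    have hm0 : 0 < (|m| : ℝ) := by positivity
    have hn0 : 0 < (|n| : ℝ) := by
      have : n ≠ 0 := by omega
      positivity
    have hmn' : |(m : ℝ)| ≤ 2 * |(n : ℝ)| := by
      have e1 : |m| ≤ 2 * |n| := by rw [Int.abs_eq_natAbs, Int.abs_eq_natAbs]; omega
      exact_mod_cast e1
    have h4 : (2 * |(n : ℝ)|) ^ (α - 2) ≤ (|m| : ℝ) ^ (α - 2) :=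
      Real.rpow_le_rpow_of_nonpos hm0 hmn' (by linarith)
    rw [Real.mul_rpow (by norm_num) hn0.le] at h4
    have h5 : (1 / 4 : ℝ) ≤ 2 ^ (α - 2) := by
      have : (2 : ℝ) ^ (-2 : ℝ) ≤ 2 ^ (α - 2) :=
        Real.rpow_le_rpow_of_exponent_le (by norm_num) (by linarith)
      refine le_trans (le_of_eq ?_) this
      rw [Real.rpow_neg (by norm_num)]; norm_num
    have h6 : 0 ≤ (|n| : ℝ) ^ (α - 2) := by positivity
    nlinarith
  · intro x hx
    set K : ℝ := 2 / (1 - α) * (x / 2) ^ (α - 1) with hK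
    obtain ⟨N, hN⟩ : ∃ N : ℕ, ⌈x⌉₊ = N + 2 := by
      have : 2 ≤ ⌈x⌉₊ := by
        have := Nat.ceil_mono hx
        simpa using this
      exact ⟨⌈x⌉₊ - 2, by omega⟩
    have hf : ∀ n : ℕ, ∀ s : Finset ℕ, ∑ i ∈ s, (if x ≤ (i : ℝ) then Jcoup J₁ α i else 0) ≤
        1 / (1 - α) * ((N : ℝ) + 1) ^ (α - 1) := by
      intro _ s
      obtain ⟨k, hk⟩ : ∃ k : ℕ, s ⊆ Finset.range (k + (N + 2)) := by
        obtain ⟨k, hk⟩ := s.exists_nat_subset_range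
        exact ⟨k, hk.trans (by intro a; simp; omega)⟩
      calc _ ≤ ∑ i ∈ Finset.range (k + (N + 2)), (if x ≤ (i : ℝ) then Jcoup J₁ α i else 0) := by
            apply Finset.sum_le_sum_of_subset_of_nonneg hk
            intro i _ _
            split_ifs
            · have := hnn (i : ℤ); simpa [JJ] using this
            · exact le_rfl
        _ ≤ ∑ i ∈ Finset.range k, ((N : ℝ) + i + 2) ^ (α - 2) := by
            rw [add_comm k, Finset.sum_range_add]
            have z : ∑ i ∈ Finset.range (N + 2), (if x ≤ (i : ℝ) then Jcoup J₁ α i else 0) = 0 := by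
              apply Finset.sum_eq_zero
              intro i hi
              rw [if_neg]
              intro hxi
              have := Nat.ceil_le.2 hxi
              rw [Finset.mem_range] at hi
              omega
            rw [z, zero_add]
            apply Finset.sum_le_sum
            intro i _
            have hi1 : N + 2 + i ≠ 1 := by omega
            split_ifs
            · rw [Jcoup, if_neg hi1]; push_cast
              apply le_of_eq; congr 1; ring
            · positivity
        _ ≤ _ := JJ_nat_tail_partial α ha ha1 N k
    have hN1 : x / 2 ≤ (N : ℝ) + 1 := by
      have : x ≤ (N : ℝ) + 2 := by
        have := Nat.le_ceil x
        rw [hN] at this; push_cast at this; exact this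
      linarith
    have hpow : ((N : ℝ) + 1) ^ (α - 1) ≤ (x / 2) ^ (α - 1) :=
      Real.rpow_le_rpow_of_nonpos (by linarith) hN1 (by linarith)
    have hpow2 : (x / 2) ^ (α - 1) ≤ 2 * x ^ (α - 1) := by
      rw [Real.div_rpow (by linarith) (by norm_num), div_eq_mul_inv,
        ← Real.rpow_neg (by norm_num), mul_comm]
      apply mul_le_mul_of_nonneg_right _ (by positivity)
      calc (2 : ℝ) ^ (-(α - 1)) ≤ 2 ^ (1 : ℝ) :=
            Real.rpow_le_rpow_of_exponent_le (by norm_num) (by linarith)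
        _ = 2 := by norm_num
    have hsn : Summable (fun n : ℕ => if x ≤ (n : ℝ) then Jcoup J₁ α n else 0) := by
      apply summable_of_sum_le (c := 1 / (1 - α) * ((N : ℝ) + 1) ^ (α - 1))
      · intro i
        show 0 ≤ (if x ≤ (i : ℝ) then Jcoup J₁ α i else 0)
        split_ifs
        · have := hnn (i : ℤ); simpa [JJ] using this
        · exact le_rfl
      · exact hf 0
    have htn := Real.tsum_le_of_sum_le (f := fun n : ℕ => if x ≤ (n : ℝ) then Jcoup J₁ α n else 0)
      (by intro i
          show 0 ≤ (if x ≤ (i : ℝ) then Jcoup J₁ α i else 0)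
          split_ifs
          · have := hnn (i : ℤ); simpa [JJ] using this
          · exact le_rfl) (hf 0)
    have hz : ∑' j : ℤ, (if x ≤ |(j : ℝ)| then JJ J₁ α j else 0) =
        (∑' n : ℕ, if x ≤ (n : ℝ) then Jcoup J₁ α n else 0) +
        (∑' n : ℕ, if x ≤ (n : ℝ) then Jcoup J₁ α n else 0) := by
      rw [Summable.tsum_of_nat_of_neg (f := fun j : ℤ => (if x ≤ |(j : ℝ)| then JJ J₁ α j else 0))]
      · have : ¬ x ≤ 0 := by linarith
        simp [JJ, this]
      · simpa [JJ] using hsn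
      · simpa [JJ] using hsn
    rw [hz]
    have h1a : 0 < 1 / (1 - α) := by apply one_div_pos.2; linarith
    have : 4 / (1 - α) * x ^ (α - 1) = 2 * (1 / (1 - α) * (2 * x ^ (α - 1))) := by ring
    rw [this]
    have := mul_le_mul_of_nonneg_left (hpow.trans hpow2) h1a.le
    linarith
  · simp [JJ, Jcoup]

/-- separation indicator -/
def sp (A : Finset ℤ) (i j : ℤ) : ℝ := if (i ∈ A ↔ j ∈ A) then 0 else 1

/-- membership indicator -/
def ind (A : Finset ℤ) (i : ℤ) : ℝ := if i ∈ A then 1 else 0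

/-- energy of a finite set -/
def ener (J : ℤ → ℝ) (A : Finset ℤ) : ℝ :=
  (1 / 2) * ∑' p : ℤ × ℤ, J (p.1 - p.2) * sp A p.1 p.2

/-- local separation energy -/
def sepf (J : ℤ → ℝ) (A : Finset ℤ) (x : ℤ) : ℝ := ∑' j : ℤ, J (x - j) * sp A x j

lemma sp_nonneg (A : Finset ℤ) (i j : ℤ) : 0 ≤ sp A i j := by
  rw [sp]; split_ifs <;> norm_num
lemma sp_le_one (A : Finset ℤ) (i j : ℤ) : sp A i j ≤ 1 := by
  rw [sp]; split_ifs <;> norm_num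
lemma sp_comm (A : Finset ℤ) (i j : ℤ) : sp A i j = sp A j i := by
  simp only [sp, iff_comm]
lemma ind_nonneg (A : Finset ℤ) (i : ℤ) : 0 ≤ ind A i := by
  rw [ind]; split_ifs <;> norm_num
lemma ind_le_one (A : Finset ℤ) (i : ℤ) : ind A i ≤ 1 := by
  rw [ind]; split_ifs <;> norm_num
lemma sp_eq_ind (A : Finset ℤ) (i j : ℤ) :
    sp A i j = ind A i * (1 - ind A j) + ind A j * (1 - ind A i) := by
  simp only [sp, ind]; by_cases h : i ∈ A <;> by_cases h' : j ∈ A <;> simp [h, h']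
lemma sp_le_ind (A : Finset ℤ) (i j : ℤ) : sp A i j ≤ ind A i + ind A j := by
  simp only [sp, ind]; by_cases h : i ∈ A <;> by_cases h' : j ∈ A <;> simp [h, h']
lemma sp_symmDiff (A R : Finset ℤ) (i j : ℤ) :
    sp (symmDiff A R) i j = sp A i j + sp R i j - 2 * (sp A i j * sp R i j) := by
  simp only [sp, Finset.mem_symmDiff]
  by_cases h : i ∈ A <;> by_cases h' : j ∈ A <;> by_cases k : i ∈ R <;> by_cases k' : j ∈ R <;>
    simp [h, h', k, k'] <;> norm_num
lemma sp_submod (A B : Finset ℤ) (i j : ℤ) :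
    sp (A ∩ B) i j + sp (A ∪ B) i j ≤ sp A i j + sp B i j := by
  simp only [sp, Finset.mem_inter, Finset.mem_union]
  by_cases h : i ∈ A <;> by_cases h' : j ∈ A <;> by_cases k : i ∈ B <;> by_cases k' : j ∈ B <;>
    simp [h, h', k, k']


lemma summ_row {α J₁ : ℝ} {J : ℤ → ℝ} (hJ : JF α J₁ J) (x : ℤ) : Summable (fun j => J (x - j)) := by
  have := (Equiv.subLeft x).summable_iff.2 hJ.summ
  exact this

lemma summ_ind1 {α J₁ : ℝ} {J : ℤ → ℝ} (hJ : JF α J₁ J) (A : Finset ℤ) : Summable (fun p : ℤ × ℤ => J (p.1 - p.2) * ind A p.1) := by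
  rw [summable_prod_of_nonneg]
  · refine ⟨fun x => ((summ_row hJ x).mul_right (ind A x)), ?_⟩
    apply summable_of_ne_finset_zero (s := A)
    intro b hb
    simp [ind, hb]
  · intro p; exact mul_nonneg (hJ.nonneg _) (ind_nonneg _ _)

lemma J_comm {α J₁ : ℝ} {J : ℤ → ℝ} (hJ : JF α J₁ J) (i j : ℤ) : J (i - j) = J (j - i) := by
  rw [← hJ.symm, neg_sub]

lemma summ_ind2 {α J₁ : ℝ} {J : ℤ → ℝ} (hJ : JF α J₁ J) (A : Finset ℤ) : Summable (fun p : ℤ × ℤ => J (p.1 - p.2) * ind A p.2) := by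
  have := (Equiv.prodComm ℤ ℤ).summable_iff.2 (summ_ind1 hJ A)
  refine this.congr ?_
  intro p
  simp only [Function.comp, Equiv.prodComm_apply, Prod.fst_swap, Prod.snd_swap]
  rw [J_comm hJ]

lemma summ_of_le {α J₁ : ℝ} {J : ℤ → ℝ} (hJ : JF α J₁ J) (A : Finset ℤ) (g : ℤ × ℤ → ℝ) (h0 : ∀ p, 0 ≤ g p)
    (h1 : ∀ p, g p ≤ ind A p.1 + ind A p.2) :
    Summable (fun p : ℤ × ℤ => J (p.1 - p.2) * g p) := by
  refine Summable.of_nonneg_of_le (fun p => mul_nonneg (hJ.nonneg _) (h0 p)) ?_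
    ((summ_ind1 hJ A).add (summ_ind2 hJ A))
  intro p
  rw [← mul_add]
  exact mul_le_mul_of_nonneg_left (h1 p) (hJ.nonneg _)

lemma summ_sp {α J₁ : ℝ} {J : ℤ → ℝ} (hJ : JF α J₁ J) (A : Finset ℤ) : Summable (fun p : ℤ × ℤ => J (p.1 - p.2) * sp A p.1 p.2) :=
  summ_of_le hJ A _ (fun _ => sp_nonneg _ _ _) (fun _ => sp_le_ind _ _ _)

lemma summ_sp_mul {α J₁ : ℝ} {J : ℤ → ℝ} (hJ : JF α J₁ J) (A : Finset ℤ) (g : ℤ → ℤ → ℝ) (h0 : ∀ i j, 0 ≤ g i j) (h1 : ∀ i j, g i j ≤ 1) :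
    Summable (fun p : ℤ × ℤ => J (p.1 - p.2) * (sp A p.1 p.2 * g p.1 p.2)) :=
  summ_of_le hJ A _ (fun _ => mul_nonneg (sp_nonneg _ _ _) (h0 _ _))
    (fun _ => (mul_le_of_le_one_right (sp_nonneg _ _ _) (h1 _ _)).trans (sp_le_ind _ _ _))

lemma summ_row_mul {α J₁ : ℝ} {J : ℤ → ℝ} (hJ : JF α J₁ J) (x : ℤ) (g : ℤ → ℝ) (h0 : ∀ j, 0 ≤ g j) (h1 : ∀ j, g j ≤ 1) :
    Summable (fun j => J (x - j) * g j) :=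
  Summable.of_nonneg_of_le (fun j => mul_nonneg (hJ.nonneg _) (h0 j))
    (fun j => mul_le_of_le_one_right (hJ.nonneg _) (h1 j)) (summ_row hJ x)

lemma ener_nonneg {α J₁ : ℝ} {J : ℤ → ℝ} (hJ : JF α J₁ J) (A : Finset ℤ) : 0 ≤ ener J A := by
  rw [ener]
  have : 0 ≤ ∑' p : ℤ × ℤ, J (p.1 - p.2) * sp A p.1 p.2 :=
    tsum_nonneg (fun p => mul_nonneg (hJ.nonneg _) (sp_nonneg _ _ _))
  linarith

lemma ener_symmDiff {α J₁ : ℝ} {J : ℤ → ℝ} (hJ : JF α J₁ J) (A R : Finset ℤ) :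
    ener J (symmDiff A R) = ener J A + ener J R -
      2 * ((1 / 2) * ∑' p : ℤ × ℤ, J (p.1 - p.2) * (sp A p.1 p.2 * sp R p.1 p.2)) := by
  have h1 := summ_sp hJ A
  have h2 := summ_sp hJ R
  have h3 := summ_sp_mul hJ A (sp R) (sp_nonneg R) (sp_le_one R)
  have e : (fun p : ℤ × ℤ => J (p.1 - p.2) * sp (symmDiff A R) p.1 p.2) =
    fun p => (J (p.1 - p.2) * sp A p.1 p.2 + J (p.1 - p.2) * sp R p.1 p.2) -
      2 * (J (p.1 - p.2) * (sp A p.1 p.2 * sp R p.1 p.2)) := by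
    ext p; rw [sp_symmDiff]; ring
  rw [ener, e, (h1.add h2).tsum_sub (h3.mul_left 2), h1.tsum_add h2, tsum_mul_left, ener, ener]
  ring

lemma ener_submod {α J₁ : ℝ} {J : ℤ → ℝ} (hJ : JF α J₁ J) (A B : Finset ℤ) :
    ener J (A ∩ B) + ener J (A ∪ B) ≤ ener J A + ener J B := by
  have h1 := summ_sp hJ A
  have h2 := summ_sp hJ B
  have h3 := summ_sp hJ (A ∩ B)
  have h4 := summ_sp hJ (A ∪ B)
  simp only [ener]
  rw [← mul_add, ← mul_add, ← h1.tsum_add h2, ← h3.tsum_add h4]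
  apply mul_le_mul_of_nonneg_left _ (by norm_num)
  apply (h3.add h4).tsum_le_tsum _ (h1.add h2)
  intro p
  rw [← mul_add, ← mul_add]
  exact mul_le_mul_of_nonneg_left (sp_submod _ _ _ _) (hJ.nonneg _)

lemma ener_ge_finset {α J₁ : ℝ} {J : ℤ → ℝ} (hJ : JF α J₁ J) (A : Finset ℤ) (Q : Finset (ℤ × ℤ)) :
    ∑ p ∈ Q, J (p.1 - p.2) * sp A p.1 p.2 ≤ 2 * ener J A := by
  have := (summ_sp hJ A).sum_le_tsum Q
    (fun p _ => mul_nonneg (hJ.nonneg _) (sp_nonneg _ _ _))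
  rw [ener]; linarith

lemma sum_sepf_le {α J₁ : ℝ} {J : ℤ → ℝ} (hJ : JF α J₁ J) (A Y : Finset ℤ) : ∑ y ∈ Y, sepf J A y ≤ 2 * ener J A := by
  have h := summ_sp hJ A
  have h1 : 2 * ener J A = ∑' y, sepf J A y := by
    rw [ener, h.tsum_prod]; simp only [sepf]; ring
  rw [h1]
  have h2 : Summable (fun y => sepf J A y) := h.prod
  apply h2.sum_le_tsum
  intro y _
  exact tsum_nonneg (fun p => mul_nonneg (hJ.nonneg _) (sp_nonneg _ _ _))

lemma half_sum_eq {α J₁ : ℝ} {J : ℤ → ℝ} (hJ : JF α J₁ J) (A : Finset ℤ) (g : ℤ → ℤ → ℝ) (h0 : ∀ i j, 0 ≤ g i j) (h1 : ∀ i j, g i j ≤ 1)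
    (hs : ∀ i j, g i j = g j i) :
    (1 / 2) * ∑' p : ℤ × ℤ, J (p.1 - p.2) * (sp A p.1 p.2 * g p.1 p.2) =
      ∑ i ∈ A, ∑' j, J (i - j) * (sp A i j * g i j) := by
  set F : ℤ × ℤ → ℝ := fun p => J (p.1 - p.2) * (ind A p.1 * (1 - ind A p.2) * g p.1 p.2) with hF
  have sF : Summable F := by
    apply summ_of_le hJ A
    · intro p
      exact mul_nonneg (mul_nonneg (ind_nonneg _ _) (by linarith [ind_le_one A p.2])) (h0 _ _)
    · intro p
      have a1 := ind_nonneg A p.1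
      have a2 := ind_nonneg A p.2
      have a3 := ind_le_one A p.2
      have b1 : ind A p.1 * (1 - ind A p.2) ≤ ind A p.1 := mul_le_of_le_one_right a1 (by linarith)
      have b2 : ind A p.1 * (1 - ind A p.2) * g p.1 p.2 ≤ ind A p.1 * (1 - ind A p.2) :=
        mul_le_of_le_one_right (mul_nonneg a1 (by linarith)) (h1 _ _)
      linarith
  have sF' : Summable (F ∘ Equiv.prodComm ℤ ℤ) := (Equiv.prodComm ℤ ℤ).summable_iff.2 sF
  have e : (fun p : ℤ × ℤ => J (p.1 - p.2) * (sp A p.1 p.2 * g p.1 p.2)) =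
      fun p => F p + (F ∘ Equiv.prodComm ℤ ℤ) p := by
    ext p
    simp only [hF, Function.comp, Equiv.prodComm_apply, Prod.fst_swap, Prod.snd_swap]
    rw [sp_eq_ind, J_comm hJ p.2 p.1, hs p.2 p.1]; ring
  have e2 : ∑' p, (F ∘ Equiv.prodComm ℤ ℤ) p = ∑' p, F p := (Equiv.prodComm ℤ ℤ).tsum_eq F
  rw [e, sF.tsum_add sF', e2, sF.tsum_prod]
  rw [tsum_eq_sum (s := A)]
  · rw [← two_mul, ← mul_assoc]; norm_num
    apply Finset.sum_congr rfl
    intro i hi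
    congr 1; ext j
    simp only [hF]
    congr 2
    rw [sp_eq_ind]; simp [ind, hi]
  · intro b hb
    simp [hF, ind, hb]

lemma ener_eq {α J₁ : ℝ} {J : ℤ → ℝ} (hJ : JF α J₁ J) (A : Finset ℤ) : ener J A = ∑ i ∈ A, sepf J A i := by
  have := half_sum_eq hJ A (fun _ _ => 1) (by simp) (by simp) (by simp)
  simpa [ener, sepf] using this

lemma ener_empty {α J₁ : ℝ} {J : ℤ → ℝ} (hJ : JF α J₁ J) : ener J ∅ = 0 := by rw [ener_eq hJ]; simp

lemma ener_ge_card {α J₁ : ℝ} {J : ℤ → ℝ} (hJ : JF α J₁ J) (A : Finset ℤ) (hA : A.Nonempty) :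
    (2 : ℝ) ^ (α - 2) * (A.card : ℝ) ^ α ≤ ener J A := by
  have hn : 0 < A.card := hA.card_pos
  have hn' : (0 : ℝ) < A.card := by exact_mod_cast hn
  have key : ∀ i ∈ A, (A.card : ℝ) * (2 * A.card : ℝ) ^ (α - 2) ≤ sepf J A i := by
    intro i hi
    set Q := (Finset.Ioc i (i + 2 * A.card)) \ A with hQ
    have hc : A.card ≤ Q.card := by
      have := Finset.le_card_sdiff A (Finset.Ioc i (i + 2 * A.card))
      rw [Int.card_Ioc, ← hQ] at this
      omega
    calc (A.card : ℝ) * (2 * A.card : ℝ) ^ (α - 2) ≤ Q.card * (2 * A.card : ℝ) ^ (α - 2) := by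
          apply mul_le_mul_of_nonneg_right _ (by positivity); exact_mod_cast hc
      _ = ∑ j ∈ Q, (2 * A.card : ℝ) ^ (α - 2) := by simp
      _ ≤ ∑ j ∈ Q, J (i - j) * sp A i j := by
          apply Finset.sum_le_sum
          intro j hj
          simp only [hQ, Finset.mem_sdiff, Finset.mem_Ioc] at hj
          have : sp A i j = 1 := by simp [sp, hi, hj.2]
          rw [this, mul_one]
          refine le_trans ?_ (hJ.lower (i - j) (by omega))
          apply Real.rpow_le_rpow_of_nonpos
          · have : ((i - j : ℤ) : ℝ) ≠ 0 := by
              have : i - j ≠ 0 := by omega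
              exact_mod_cast this
            positivity
          · have : |i - j| ≤ 2 * (A.card : ℤ) := by rw [abs_le]; constructor <;> omega
            exact_mod_cast this
          · linarith [hJ.ha1]
      _ ≤ sepf J A i := by
          apply (summ_row_mul hJ i (sp A i) (sp_nonneg A i) (sp_le_one A i)).sum_le_tsum
          intro j _
          exact mul_nonneg (hJ.nonneg _) (sp_nonneg _ _ _)
  rw [ener_eq hJ]
  calc _ = ∑ i ∈ A, (A.card : ℝ) * (2 * A.card : ℝ) ^ (α - 2) := by
        rw [Finset.sum_const, nsmul_eq_mul, Real.mul_rpow (by norm_num) hn'.le]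
        have : (A.card : ℝ) ^ α = A.card * (A.card * (A.card : ℝ) ^ (α - 2)) := by
          rw [← mul_assoc, ← sq, ← Real.rpow_natCast, ← Real.rpow_add hn']
          congr 1; push_cast; ring
        rw [this]; ring
    _ ≤ _ := Finset.sum_le_sum key

/-- walls of a finite set -/
def walls (A : Finset ℤ) : Finset ℤ :=
  (A ∪ A.image (· + 1)).filter (fun w => ¬ (w ∈ A ↔ w - 1 ∈ A))

lemma mem_walls {A : Finset ℤ} {w : ℤ} : w ∈ walls A ↔ ¬ (w ∈ A ↔ w - 1 ∈ A) := by
  simp only [walls, Finset.mem_filter, Finset.mem_union, Finset.mem_image]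
  constructor
  · exact fun h => h.2
  · intro h
    refine ⟨?_, h⟩
    by_cases hw : w ∈ A
    · exact Or.inl hw
    · right; refine ⟨w - 1, by tauto, by ring⟩

lemma exists_wall {A : Finset ℤ} {x y : ℤ} (hxy : x ≤ y) (h : ¬ (x ∈ A ↔ y ∈ A)) :
    ∃ w ∈ walls A, x < w ∧ w ≤ y := by
  by_contra hc
  push Not at hc
  have : ∀ n : ℕ, x + n ≤ y → (x ∈ A ↔ x + n ∈ A) := by
    intro n
    induction n with
    | zero => simp
    | succ n ih =>
      intro hn
      push_cast at hn ⊢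
      rw [ih (by omega)]
      by_contra h1
      have hw : x + (n + 1) ∈ walls A := by
        rw [mem_walls, show x + ((n : ℤ) + 1) - 1 = x + n by ring]; tauto
      have := hc _ hw (by omega)
      omega
  have h2 := this (y - x).toNat (by omega)
  rw [show x + ((y - x).toNat : ℤ) = y by omega] at h2
  exact h h2

lemma walls_symmDiff_sub (A B : Finset ℤ) : walls (symmDiff A B) ⊆ walls A ∪ walls B := by
  intro w
  simp only [Finset.mem_union, mem_walls, Finset.mem_symmDiff]
  tauto

lemma walls_sub_of_disj (A B : Finset ℤ) (h : Disjoint (walls A) (walls B)) :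
    walls A ⊆ walls (symmDiff A B) := by
  intro w hw
  have h2 := Finset.disjoint_left.1 h hw
  simp only [mem_walls, Finset.mem_symmDiff] at *
  tauto

/-- the left wall of a point of `B` -/
lemma exists_wall_left {B : Finset ℤ} {x : ℤ} (hx : x ∈ B) :
    ∃ a ∈ walls B, a ≤ x ∧ x - a < B.card := by
  have h : ∃ y ∈ Finset.Icc (x - B.card) x, y ∉ B := by
    by_contra hc
    push Not at hc
    have : Finset.Icc (x - B.card) x ⊆ B := hc
    have := Finset.card_le_card this
    rw [Int.card_Icc] at this
    omega
  have hne : ((Finset.Icc (x - B.card) x).filter (· ∉ B)).Nonempty := by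
    obtain ⟨y, hy, hy2⟩ := h
    exact ⟨y, by simp only [Finset.mem_filter]; exact ⟨hy, hy2⟩⟩
  have hm := Finset.max'_mem _ hne
  set y := Finset.max' _ hne with hydef
  simp only [Finset.mem_filter, Finset.mem_Icc] at hm
  have hyx : y ≠ x := by rintro h; rw [h] at hm; exact hm.2 hx
  have h1 : y + 1 ∈ B := by
    by_contra hc
    have := Finset.le_max' _ (y + 1) (by
      simp only [Finset.mem_filter, Finset.mem_Icc]; exact ⟨by omega, hc⟩ :
        y + 1 ∈ ((Finset.Icc (x - B.card) x).filter (· ∉ B)))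
    omega
  refine ⟨y + 1, ?_, by omega, by omega⟩
  rw [mem_walls]; simp [h1, hm.2]

lemma walls_nonempty {B : Finset ℤ} (h : B.Nonempty) : (walls B).Nonempty := by
  obtain ⟨x, hx⟩ := h
  obtain ⟨a, ha, _⟩ := exists_wall_left hx
  exact ⟨a, ha⟩

lemma ener_ge_walls {α J₁ : ℝ} {J : ℤ → ℝ} (hJ : JF α J₁ J) (A : Finset ℤ) :
    J₁ * (walls A).card ≤ ener J A := by
  set Q1 : Finset (ℤ × ℤ) := (walls A).image (fun w => (w, w - 1)) with hQ1
  set Q2 : Finset (ℤ × ℤ) := (walls A).image (fun w => (w - 1, w)) with hQ2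
  have hd : Disjoint Q1 Q2 := by
    rw [Finset.disjoint_left]
    rintro ⟨a, b⟩ h1 h2
    simp only [hQ1, hQ2, Finset.mem_image, Prod.mk.injEq] at h1 h2
    obtain ⟨w, _, h3, h4⟩ := h1
    obtain ⟨w', _, h5, h6⟩ := h2
    omega
  have := ener_ge_finset hJ A (Q1 ∪ Q2)
  rw [Finset.sum_union hd, hQ1, hQ2, Finset.sum_image, Finset.sum_image] at this
  · have e1 : ∀ w ∈ walls A, J₁ ≤ J (w - (w - 1)) * sp A w (w - 1) := by
      intro w hw
      rw [mem_walls] at hw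
      rw [sp, if_neg hw, mul_one, show w - (w - 1) = 1 by ring]; exact hJ.one
    have e2 : ∀ w ∈ walls A, J₁ ≤ J (w - 1 - w) * sp A (w - 1) w := by
      intro w hw
      rw [sp_comm, J_comm hJ]; exact e1 w hw
    have f1 := Finset.sum_le_sum e1
    have f2 := Finset.sum_le_sum e2
    simp only [Finset.sum_const, nsmul_eq_mul] at f1 f2
    linarith
  · intro a _ b _ h; simp at h; omega
  · intro a _ b _ h; simp at h; omega

lemma ener_ge_J1 {α J₁ : ℝ} {J : ℤ → ℝ} (hJ : JF α J₁ J) (A : Finset ℤ) (hA : A.Nonempty) :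
    J₁ ≤ ener J A := by
  have h := ener_ge_walls hJ A
  have h1 : 1 ≤ (walls A).card := (walls_nonempty hA).card_pos
  have h2 : (1 : ℝ) ≤ (walls A).card := by exact_mod_cast h1
  have := hJ.hJ1
  nlinarith

lemma sepf_nonneg {α J₁ : ℝ} {J : ℤ → ℝ} (hJ : JF α J₁ J) (A : Finset ℤ) (x : ℤ) :
    0 ≤ sepf J A x :=
  tsum_nonneg (fun _ => mul_nonneg (hJ.nonneg _) (sp_nonneg _ _ _))

lemma sepf_compare {α J₁ : ℝ} {J : ℤ → ℝ} (hJ : JF α J₁ J) (A : Finset ℤ) (d : ℝ) (hd : 256 ≤ d)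
    (a x y : ℤ) (hax : a ≤ x) (hxa : ((x - a : ℤ) : ℝ) ≤ d / 8) (hxy : x ≤ y)
    (hyx : ((y - x : ℤ) : ℝ) ≤ d / 4) (hw : ∀ w ∈ walls A, d ≤ |((w - a : ℤ) : ℝ)|) :
    sepf J A x ≤ 4 * sepf J A y := by
  push_cast at hxa hyx hw
  have haxr : (a : ℝ) ≤ x := by exact_mod_cast hax
  have hxyr : (x : ℝ) ≤ y := by exact_mod_cast hxy
  have hst : x ∈ A ↔ y ∈ A := by
    by_contra hc
    obtain ⟨w, hw1, hw2, hw3⟩ := exists_wall hxy hc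
    have h1 := hw w hw1
    have h2 : (x : ℝ) < w := by exact_mod_cast hw2
    have h3 : (w : ℝ) ≤ y := by exact_mod_cast hw3
    rw [abs_of_nonneg (by linarith)] at h1
    linarith
  rw [sepf, sepf, ← tsum_mul_left]
  apply (summ_row_mul hJ x (sp A x) (sp_nonneg A x) (sp_le_one A x)).tsum_le_tsum _
    ((summ_row_mul hJ y (sp A y) (sp_nonneg A y) (sp_le_one A y)).mul_left 4)
  intro j
  have hs : sp A x j = sp A y j := by simp only [sp, hst]
  rw [hs, ← mul_assoc]
  by_cases hj : (y ∈ A ↔ j ∈ A)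
  · simp [sp, hj]
  · apply mul_le_mul_of_nonneg_right _ (sp_nonneg _ _ _)
    have hxj : ¬ (x ∈ A ↔ j ∈ A) := by tauto
    have hfar : 7 / 8 * d ≤ |((x - j : ℤ) : ℝ)| := by
      push_cast
      rcases le_total x j with h | h
      · obtain ⟨w, hw1, hw2, hw3⟩ := exists_wall h hxj
        have h1 := hw w hw1
        have h2 : (x : ℝ) < w := by exact_mod_cast hw2
        have h3 : (w : ℝ) ≤ j := by exact_mod_cast hw3
        rw [abs_of_nonneg (by linarith)] at h1
        rw [abs_of_nonpos (by linarith)]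
        linarith
      · obtain ⟨w, hw1, hw2, hw3⟩ := exists_wall h (fun hh => hxj hh.symm)
        have h1 := hw w hw1
        have h2 : (j : ℝ) < w := by exact_mod_cast hw2
        have h3 : (w : ℝ) ≤ x := by exact_mod_cast hw3
        rw [abs_of_nonneg (by linarith)]
        rcases abs_cases ((w : ℝ) - a) with ⟨h4, _⟩ | ⟨h4, _⟩ <;> rw [h4] at h1 <;> linarith
    have hnat : ∀ n : ℤ, ((n.natAbs : ℕ) : ℝ) = |(n : ℝ)| := by
      intro n; rw [Nat.cast_natAbs]; simp
    apply hJ.comp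
    · have : (2 : ℝ) ≤ ((x - j).natAbs : ℝ) := by rw [hnat]; linarith
      exact_mod_cast this
    · intro h0
      have : y = j := by omega
      rw [this] at hj; exact hj Iff.rfl
    · have : (((y - j).natAbs : ℕ) : ℝ) ≤ 2 * ((x - j).natAbs : ℕ) := by
        rw [hnat, hnat]
        have e : ((y - j : ℤ) : ℝ) = ((y : ℝ) - x) + ((x - j : ℤ) : ℝ) := by push_cast; ring
        rw [e]
        refine (abs_add_le _ _).trans ?_
        rw [abs_of_nonneg (by linarith)]
        linarith
      exact_mod_cast this

lemma scale_bound {α J₁ : ℝ} {J : ℤ → ℝ} (hJ : JF α J₁ J) (A : Finset ℤ) (d c : ℝ) (hd : 256 ≤ d)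
    (hc0 : 0 ≤ c) (hc : c ≤ d / 8) (S : Finset (Finset ℤ)) (hcard : ∀ B ∈ S, (B.card : ℝ) ≤ c)
    (hA : ∀ B ∈ S, ∀ w ∈ walls A, ∀ w' ∈ walls B, d ≤ |((w - w' : ℤ) : ℝ)|)
    (hB : ∀ B ∈ S, ∀ B' ∈ S, B ≠ B' → ∀ w ∈ walls B, ∀ w' ∈ walls B', d ≤ |((w - w' : ℤ) : ℝ)|) :
    ∑ B ∈ S, ∑ x ∈ B, sepf J A x ≤ 64 * c / d * ener J A := by
  obtain ⟨D, hD⟩ : ∃ D : ℕ, D = ⌊d / 4⌋₊ := ⟨_, rfl⟩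
  have hD1 : (D : ℝ) ≤ d / 4 := by rw [hD]; exact Nat.floor_le (by linarith)
  have hD2 : d / 8 ≤ D := by
    have := Nat.lt_floor_add_one (d / 4)
    rw [← hD] at this; linarith
  set U : Finset ℤ → Finset ℤ := fun B => B.biUnion (fun x => Finset.Ico x (x + D)) with hU
  have hUm : ∀ B ∈ S, ∀ y ∈ U B, ∃ a ∈ walls B, (a : ℝ) ≤ y ∧ (y : ℝ) - a ≤ 3 / 8 * d := by
    intro B hB y hy
    simp only [hU, Finset.mem_biUnion, Finset.mem_Ico] at hy
    obtain ⟨x, hx, hy1, hy2⟩ := hy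
    obtain ⟨a, ha, ha1, ha2⟩ := exists_wall_left hx
    have h1 : (a : ℝ) ≤ x := by exact_mod_cast ha1
    have h2 : (x : ℝ) - a < B.card := by exact_mod_cast ha2
    have h3 : (x : ℝ) ≤ y := by exact_mod_cast hy1
    have h4 : (y : ℝ) < x + D := by exact_mod_cast hy2
    have := hcard B hB
    exact ⟨a, ha, by linarith, by linarith⟩
  have hdisj : (S : Set (Finset ℤ)).PairwiseDisjoint U := by
    intro B hB1 B' hB2 hne
    rw [Function.onFun, Finset.disjoint_left]
    intro y hy hy'
    obtain ⟨a, ha, h1, h2⟩ := hUm B hB1 y hy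
    obtain ⟨a', ha', h1', h2'⟩ := hUm B' hB2 y hy'
    have := hB B hB1 B' hB2 hne a ha a' ha'
    push_cast at this
    rcases abs_cases ((a : ℝ) - a') with ⟨h4, _⟩ | ⟨h4, _⟩ <;> rw [h4] at this <;> linarith
  have hBs : ∀ B ∈ S, (D : ℝ) * ∑ x ∈ B, sepf J A x ≤ 4 * c * ∑ y ∈ U B, sepf J A y := by
    intro B hB
    have hx : ∀ x ∈ B, (D : ℝ) * sepf J A x ≤ 4 * ∑ y ∈ U B, sepf J A y := by
      intro x hx
      obtain ⟨a, ha, ha1, ha2⟩ := exists_wall_left hx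
      have h2 : (x : ℝ) - a < B.card := by exact_mod_cast ha2
      have hcB := hcard B hB
      have hy : ∀ y ∈ Finset.Ico x (x + D), sepf J A x ≤ 4 * sepf J A y := by
        intro y hy
        rw [Finset.mem_Ico] at hy
        have h4 : (y : ℝ) < x + D := by exact_mod_cast hy.2
        apply sepf_compare hJ A d hd a x y ha1 (by push_cast; linarith) hy.1
          (by push_cast; linarith)
        intro w hw
        exact hA B hB w hw a ha
      have := Finset.sum_le_sum hy
      rw [Finset.sum_const, Int.card_Ico, nsmul_eq_mul, ← Finset.mul_sum] at this
      have e : ((x + (D : ℤ) - x).toNat : ℝ) = D := by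
        have : (x + (D : ℤ) - x).toNat = D := by omega
        rw [this]
      rw [e] at this
      refine this.trans ?_
      apply mul_le_mul_of_nonneg_left _ (by norm_num)
      apply Finset.sum_le_sum_of_subset_of_nonneg
      · intro y hy; simp only [hU, Finset.mem_biUnion]; exact ⟨x, hx, hy⟩
      · intro y _ _; exact sepf_nonneg hJ A y
    rw [Finset.mul_sum]
    refine (Finset.sum_le_sum hx).trans ?_
    rw [Finset.sum_const, nsmul_eq_mul, ← mul_assoc]
    apply mul_le_mul_of_nonneg_right
    · have := hcard B hB; linarith
    · exact Finset.sum_nonneg (fun y _ => sepf_nonneg hJ A y)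
  have htot : (D : ℝ) * ∑ B ∈ S, ∑ x ∈ B, sepf J A x ≤ 4 * c * ∑ y ∈ S.biUnion U, sepf J A y := by
    rw [Finset.sum_biUnion hdisj, Finset.mul_sum, Finset.mul_sum]
    exact Finset.sum_le_sum hBs
  have h1 : (D : ℝ) * ∑ B ∈ S, ∑ x ∈ B, sepf J A x ≤ 4 * c * (2 * ener J A) :=
    htot.trans (mul_le_mul_of_nonneg_left (sum_sepf_le hJ A _) (by linarith))
  have h2 : 0 ≤ ∑ B ∈ S, ∑ x ∈ B, sepf J A x :=
    Finset.sum_nonneg (fun B _ => Finset.sum_nonneg (fun y _ => sepf_nonneg hJ A y))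
  have h3 : d / 8 * ∑ B ∈ S, ∑ x ∈ B, sepf J A x ≤ 8 * c * ener J A :=
    (mul_le_mul_of_nonneg_right hD2 h2).trans (by linarith)
  rw [div_mul_eq_mul_div, le_div_iff₀ (by linarith)]
  linarith

/-- separation of two contours -/
def CSep (J : ℤ → ℝ) (K ρ : ℝ) (A B : Finset ℤ) : Prop :=
  ∀ w ∈ walls A, ∀ w' ∈ walls B,
    K * (min (ener J A) (ener J B)) ^ (1 / ρ) ≤ |((w - w' : ℤ) : ℝ)|

/-- conditions on the separation constant -/
structure KF (α ρ K : ℝ) : Prop where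
  h1 : 1 / 2 < ρ
  h2 : ρ < α
  h3 : 256 ≤ K
  h4 : 256 / (1 - α) ≤ K ^ (1 - α)
  h5 : 16384 ≤ K * (1 - (2 : ℝ) ^ (1 / α - 1 / ρ))

lemma exists_KF (α ρ : ℝ) (h1 : 1 / 2 < ρ) (h2 : ρ < α) (ha1 : α < 1) : ∃ K, KF α ρ K := by
  have hs : (2 : ℝ) ^ (1 / α - 1 / ρ) < 1 := by
    apply Real.rpow_lt_one_of_one_lt_of_neg (by norm_num)
    have : 1 / α < 1 / ρ := one_div_lt_one_div_of_lt (by linarith) h2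
    linarith
  have hs' : 0 < 1 - (2 : ℝ) ^ (1 / α - 1 / ρ) := by linarith
  have e1 : ∀ᶠ K : ℝ in Filter.atTop, 256 / (1 - α) ≤ K ^ (1 - α) :=
    (tendsto_rpow_atTop (by linarith : 0 < 1 - α)).eventually_ge_atTop _
  have e2 : ∀ᶠ K : ℝ in Filter.atTop, 256 ≤ K := Filter.eventually_ge_atTop _
  have e3 : ∀ᶠ K : ℝ in Filter.atTop, 16384 / (1 - (2 : ℝ) ^ (1 / α - 1 / ρ)) ≤ K :=
    Filter.eventually_ge_atTop _
  obtain ⟨K, k1, k2, k3⟩ := (e1.and (e2.and e3)).exists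
  refine ⟨K, h1, h2, k2, k1, ?_⟩
  rwa [div_le_iff₀ hs'] at k3

lemma CSep.symm {J : ℤ → ℝ} {K ρ : ℝ} {A B : Finset ℤ} (h : CSep J K ρ A B) : CSep J K ρ B A := by
  intro w hw w' hw'
  have := h w' hw' w hw
  rw [min_comm]
  refine this.trans (le_of_eq ?_)
  push_cast
  exact abs_sub_comm _ _

lemma ener_ge_one {α J₁ : ℝ} {J : ℤ → ℝ} (hJ : JF α J₁ J) (A : Finset ℤ) (hA : A.Nonempty) :
    1 ≤ ener J A := hJ.hJ1.trans (ener_ge_J1 hJ A hA)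

lemma card_le_ener {α J₁ : ℝ} {J : ℤ → ℝ} (hJ : JF α J₁ J) (A : Finset ℤ) (hA : A.Nonempty) :
    (A.card : ℝ) ≤ 8 * (ener J A) ^ (1 / α) := by
  have h := ener_ge_card hJ A hA
  have ha := hJ.ha
  have hE := ener_ge_one hJ A hA
  have h2 : (A.card : ℝ) ^ α ≤ (2 : ℝ) ^ (2 - α) * ener J A := by
    have e : (2 : ℝ) ^ (2 - α) * (2 : ℝ) ^ (α - 2) = 1 := by
      rw [← Real.rpow_add (by norm_num)]; simp
    calc (A.card : ℝ) ^ α = (2 : ℝ) ^ (2 - α) * ((2 : ℝ) ^ (α - 2) * (A.card : ℝ) ^ α) := by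
          rw [← mul_assoc, e, one_mul]
      _ ≤ _ := mul_le_mul_of_nonneg_left h (by positivity)
  have h3 := Real.rpow_le_rpow (by positivity) h2 (by positivity : 0 ≤ 1 / α)
  rw [← Real.rpow_mul (by positivity), mul_one_div_cancel (by linarith), Real.rpow_one,
    Real.mul_rpow (by positivity) (by linarith), ← Real.rpow_mul (by norm_num)] at h3
  refine h3.trans ?_
  apply mul_le_mul_of_nonneg_right _ (by positivity)
  calc (2 : ℝ) ^ ((2 - α) * (1 / α)) ≤ 2 ^ (3 : ℝ) := by
        apply Real.rpow_le_rpow_of_exponent_le (by norm_num)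
        rw [mul_one_div, div_le_iff₀ (by linarith)]; linarith
    _ = 8 := by norm_num

lemma large_part {α J₁ ρ K : ℝ} {J : ℤ → ℝ} (hJ : JF α J₁ J) (hK : KF α ρ K) (A : Finset ℤ)
    (hA : A.Nonempty) (g : ℤ → ℤ → ℝ) (hg : ∀ i j, g i j = if
      K * (ener J A) ^ (1 / ρ) ≤ |((i - j : ℤ) : ℝ)| then 1 else 0) :
    (1 / 2) * ∑' p : ℤ × ℤ, J (p.1 - p.2) * (sp A p.1 p.2 * g p.1 p.2) ≤ ener J A / 8 := by
  have hE := ener_ge_one hJ A hA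
  have ha := hJ.ha
  have ha1 := hJ.ha1
  have hr := hK.h1
  have hr2 := hK.h2
  have hK3 := hK.h3
  set E := ener J A with hEd
  set D := K * E ^ (1 / ρ) with hD
  have hE1 : 1 ≤ E ^ (1 / ρ) := Real.one_le_rpow hE (by positivity)
  have hDge : 256 ≤ D := by nlinarith
  have g0 : ∀ i j, 0 ≤ g i j := by intro i j; rw [hg]; split_ifs <;> norm_num
  have g1 : ∀ i j, g i j ≤ 1 := by intro i j; rw [hg]; split_ifs <;> norm_num
  have gs : ∀ i j, g i j = g j i := by
    intro i j; rw [hg, hg]; push_cast; rw [abs_sub_comm]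
  rw [half_sum_eq hJ A g g0 g1 gs]
  have hrow : ∀ i ∈ A, ∑' j, J (i - j) * (sp A i j * g i j) ≤ 4 / (1 - α) * D ^ (α - 1) := by
    intro i _
    refine le_trans ?_ (hJ.tail D (by linarith))
    have e : ∑' j : ℤ, (if D ≤ |(j : ℝ)| then J j else 0) =
        ∑' j : ℤ, J (i - j) * g i j := by
      rw [← (Equiv.subLeft i).tsum_eq]
      congr 1; ext j
      simp only [Equiv.subLeft_apply, hg]
      split_ifs <;> simp
    rw [e]
    apply Summable.tsum_le_tsum
    · intro j
      apply mul_le_mul_of_nonneg_left _ (hJ.nonneg _)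
      exact mul_le_of_le_one_left (g0 _ _) (sp_le_one _ _ _)
    · exact summ_row_mul hJ i _ (fun j => mul_nonneg (sp_nonneg _ _ _) (g0 _ _))
        (fun j => mul_le_one₀ (sp_le_one _ _ _) (g0 _ _) (g1 _ _))
    · exact summ_row_mul hJ i _ (g0 i) (g1 i)
  refine (Finset.sum_le_sum hrow).trans ?_
  rw [Finset.sum_const, nsmul_eq_mul]
  have hcard := card_le_ener hJ A hA
  have hDp : D ^ (α - 1) = K ^ (α - 1) * E ^ ((1 / ρ) * (α - 1)) := by
    rw [hD, Real.mul_rpow (by linarith) (by positivity), ← Real.rpow_mul (by linarith)]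
  have h1a : 0 < 1 - α := by linarith
  have hKp : K ^ (α - 1) ≤ (1 - α) / 256 := by
    have : K ^ (α - 1) = (K ^ (1 - α))⁻¹ := by
      rw [← Real.rpow_neg (by linarith)]; congr 1; ring
    rw [this]
    have h4 := inv_anti₀ (by positivity) hK.h4
    rwa [inv_div] at h4
  have hexp : E ^ (1 / α) * E ^ ((1 / ρ) * (α - 1)) ≤ E := by
    rw [← Real.rpow_add (by linarith)]
    calc _ ≤ E ^ (1 : ℝ) := by
          apply Real.rpow_le_rpow_of_exponent_le hE
          have h5 : 1 / α ≤ 1 / ρ := one_div_le_one_div_of_le (by linarith) hr2.le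
          have h6 : 1 / α * α = 1 := by field_simp
          nlinarith
      _ = E := Real.rpow_one E
  calc (A.card : ℝ) * (4 / (1 - α) * D ^ (α - 1))
      ≤ (8 * E ^ (1 / α)) * (4 / (1 - α) * D ^ (α - 1)) := by
        apply mul_le_mul_of_nonneg_right hcard (by positivity)
    _ = 32 / (1 - α) * K ^ (α - 1) * (E ^ (1 / α) * E ^ ((1 / ρ) * (α - 1))) := by
        rw [hDp]; ring
    _ ≤ 32 / (1 - α) * ((1 - α) / 256) * E := by
        apply mul_le_mul _ hexp (by positivity) (by positivity)
        apply mul_le_mul_of_nonneg_left hKp (by positivity)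
    _ = E / 8 := by field_simp; norm_num

lemma small_part {α J₁ ρ K : ℝ} {J : ℤ → ℝ} (hJ : JF α J₁ J) (hK : KF α ρ K) (A : Finset ℤ)
    (S : Finset (Finset ℤ)) (hne : ∀ B ∈ S, B.Nonempty) (hsm : ∀ B ∈ S, ener J B ≤ ener J A)
    (hA : ∀ B ∈ S, CSep J K ρ A B) (hB : ∀ B ∈ S, ∀ B' ∈ S, B ≠ B' → CSep J K ρ B B') :
    ∑ B ∈ S, ∑ x ∈ B, sepf J A x ≤ ener J A / 8 := by
  have ha := hJ.ha
  have ha1 := hJ.ha1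
  have hr := hK.h1
  have hr2 := hK.h2
  have hK3 := hK.h3
  have hρ : 0 < 1 / ρ := by positivity
  have hαi : 0 < 1 / α := by positivity
  set s := (2 : ℝ) ^ (1 / α - 1 / ρ) with hs
  have hs0 : 0 < s := by positivity
  have hs1 : s < 1 := by
    apply Real.rpow_lt_one_of_one_lt_of_neg (by norm_num)
    have : 1 / α < 1 / ρ := one_div_lt_one_div_of_lt (by linarith) hr2
    linarith
  set sc : Finset ℤ → ℕ := fun B => Nat.log 2 ⌊ener J B⌋₊ with hsc
  have hsc1 : ∀ B ∈ S, (2 : ℝ) ^ (sc B : ℝ) ≤ ener J B ∧ ener J B ≤ 2 * (2 : ℝ) ^ (sc B : ℝ) := by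
    intro B hB
    have h1 := ener_ge_one hJ B (hne B hB)
    have hf : ⌊ener J B⌋₊ ≠ 0 := by
      have := (Nat.one_le_floor_iff _).2 h1
      omega
    have h2 := Nat.pow_log_le_self 2 hf
    have h3 := Nat.lt_pow_succ_log_self (b := 2) (by norm_num) ⌊ener J B⌋₊
    have h4 := Nat.floor_le (by linarith : 0 ≤ ener J B)
    have h5 := Nat.lt_floor_add_one (ener J B)
    rw [Real.rpow_natCast]
    constructor
    · have : (((2 : ℕ) ^ (sc B) : ℕ) : ℝ) ≤ (⌊ener J B⌋₊ : ℝ) := by exact_mod_cast h2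
      push_cast at this; linarith
    · have : ((⌊ener J B⌋₊ + 1 : ℕ) : ℝ) ≤ (((2 : ℕ) ^ (sc B + 1) : ℕ) : ℝ) := by exact_mod_cast h3
      push_cast at this; rw [pow_succ] at this; linarith
  obtain ⟨n, hn⟩ : ∃ n : ℕ, ∀ B ∈ S, sc B ∈ Finset.range n :=
    ⟨S.sup sc + 1, fun B hB => by
      rw [Finset.mem_range]; exact Nat.lt_succ_of_le (Finset.le_sup hB)⟩
  rw [← Finset.sum_fiberwise_of_maps_to hn]
  have hE := ener_nonneg hJ A
  have hq : ∀ q ∈ Finset.range n, ∑ B ∈ S with sc B = q, ∑ x ∈ B, sepf J A x ≤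
      2048 / K * ener J A * s ^ q := by
    intro q _
    have hp2 : (1 : ℝ) ≤ 2 ^ (q : ℝ) := Real.one_le_rpow (by norm_num) (by positivity)
    set d := K * ((2 : ℝ) ^ (q : ℝ)) ^ (1 / ρ) with hd
    set c := 32 * ((2 : ℝ) ^ (q : ℝ)) ^ (1 / α) with hc
    have hd1 : (1 : ℝ) ≤ ((2 : ℝ) ^ (q : ℝ)) ^ (1 / ρ) := Real.one_le_rpow hp2 hρ.le
    have hcd : ((2 : ℝ) ^ (q : ℝ)) ^ (1 / α) ≤ ((2 : ℝ) ^ (q : ℝ)) ^ (1 / ρ) :=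
      Real.rpow_le_rpow_of_exponent_le hp2 (one_div_le_one_div_of_le (by linarith) hr2.le)
    have hsep : ∀ B B' : Finset ℤ, 2 ^ (q : ℝ) ≤ ener J B → 2 ^ (q : ℝ) ≤ ener J B' →
        CSep J K ρ B B' → ∀ w ∈ walls B, ∀ w' ∈ walls B', d ≤ |((w - w' : ℤ) : ℝ)| := by
      intro B B' h1 h2 hS w hw w' hw'
      refine le_trans ?_ (hS w hw w' hw')
      apply mul_le_mul_of_nonneg_left _ (by linarith)
      exact Real.rpow_le_rpow (by positivity) (le_min h1 h2) hρ.le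
    have := scale_bound hJ A d c (by nlinarith) (by positivity)
      (by rw [hc, hd]; nlinarith) (S.filter (fun B => sc B = q)) ?_ ?_ ?_
    · refine this.trans (le_of_eq ?_)
      have e : ((2 : ℝ) ^ (q : ℝ)) ^ (1 / α) = s ^ q * ((2 : ℝ) ^ (q : ℝ)) ^ (1 / ρ) := by
        rw [← Real.rpow_natCast s q, hs, ← Real.rpow_mul (by norm_num), ← Real.rpow_mul (by norm_num),
          ← Real.rpow_mul (by norm_num), ← Real.rpow_add (by norm_num)]
        congr 1; ring
      rw [hc, hd, e]
      field_simp
      ring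
    · intro B hB
      rw [Finset.mem_filter] at hB
      have h1 := card_le_ener hJ B (hne B hB.1)
      have h2 := (hsc1 B hB.1).2
      rw [hB.2] at h2
      refine h1.trans ?_
      have h3 := Real.rpow_le_rpow (ener_nonneg hJ B) h2 hαi.le
      rw [Real.mul_rpow (by norm_num) (by positivity)] at h3
      have h4 : (2 : ℝ) ^ (1 / α) ≤ 4 := by
        calc (2 : ℝ) ^ (1 / α) ≤ 2 ^ (2 : ℝ) := by
              apply Real.rpow_le_rpow_of_exponent_le (by norm_num)
              rw [div_le_iff₀ (by linarith)]; linarith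
          _ = 4 := by norm_num
      have h5 : (0 : ℝ) < ((2 : ℝ) ^ (q : ℝ)) ^ (1 / α) := by positivity
      rw [hc]; nlinarith
    · intro B hB
      rw [Finset.mem_filter] at hB
      have h2 := (hsc1 B hB.1).1
      rw [hB.2] at h2
      exact hsep A B (h2.trans (hsm B hB.1)) h2 (hA B hB.1)
    · intro B kB B' kB' hne'
      rw [Finset.mem_filter] at kB kB'
      have h2 := (hsc1 B kB.1).1
      rw [kB.2] at h2
      have h2' := (hsc1 B' kB'.1).1
      rw [kB'.2] at h2'
      exact hsep B B' h2 h2' (hB B kB.1 B' kB'.1 hne')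
  refine (Finset.sum_le_sum hq).trans ?_
  rw [← Finset.mul_sum]
  have hgeo : ∑ q ∈ Finset.range n, s ^ q ≤ (1 - s)⁻¹ := by
    rw [← tsum_geometric_of_lt_one hs0.le hs1]
    exact (summable_geometric_of_lt_one hs0.le hs1).sum_le_tsum _ (fun _ _ => by positivity)
  have h5 := hK.h5
  rw [← hs] at h5
  have hK0 : 0 < K := by linarith
  have h1s : 0 < 1 - s := by linarith
  calc 2048 / K * ener J A * ∑ q ∈ Finset.range n, s ^ q ≤ 2048 / K * ener J A * (1 - s)⁻¹ :=
        mul_le_mul_of_nonneg_left hgeo (by positivity)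
    _ = ener J A * (2048 / (K * (1 - s))) := by field_simp
    _ ≤ ener J A * (1 / 8) := by
        apply mul_le_mul_of_nonneg_left _ hE
        rw [div_le_div_iff₀ (by positivity) (by norm_num)]
        linarith
    _ = _ := by ring

/-- Energy lemma: removing a separated contour gains at least half its energy. -/
lemma energy_drop {α J₁ ρ K : ℝ} {J : ℤ → ℝ} (hJ : JF α J₁ J) (hK : KF α ρ K) (A R : Finset ℤ)
    (hAne : A.Nonempty)
    (S : Finset (Finset ℤ)) (hne : ∀ B ∈ S, B.Nonempty)
    (hA : ∀ B ∈ S, CSep J K ρ A B) (hB : ∀ B ∈ S, ∀ B' ∈ S, B ≠ B' → CSep J K ρ B B')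
    (hR : ∀ i j, (∀ B ∈ S, (i ∈ B ↔ j ∈ B)) → (i ∈ R ↔ j ∈ R)) :
    ener J R + ener J A / 2 ≤ ener J (symmDiff A R) := by
  rw [ener_symmDiff hJ]
  have hr := hK.h1
  have hρ : 0 < 1 / ρ := by positivity
  have hK3 := hK.h3
  set g : ℤ → ℤ → ℝ := fun i j => if
      K * (ener J A) ^ (1 / ρ) ≤ |((i - j : ℤ) : ℝ)| then 1 else 0 with hg
  have hl := large_part hJ hK A hAne g (fun _ _ => rfl)
  set T := S.filter (fun B => ener J B ≤ ener J A) with hT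
  have hs := small_part hJ hK A T (fun B h => hne B (Finset.mem_filter.1 h).1)
    (fun B h => (Finset.mem_filter.1 h).2) (fun B h => hA B (Finset.mem_filter.1 h).1)
    (fun B h B' h' hn => hB B (Finset.mem_filter.1 h).1 B' (Finset.mem_filter.1 h').1 hn)
  have g0 : ∀ i j, 0 ≤ g i j := by intro i j; simp only [hg]; split_ifs <;> norm_num
  have g1 : ∀ i j, g i j ≤ 1 := by intro i j; simp only [hg]; split_ifs <;> norm_num
  have hpt' : ∀ i j : ℤ, i ≤ j → sp A i j * sp R i j ≤
      sp A i j * g i j + ∑ B ∈ T, sp B i j * sp A i j := by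
    intro i j hij
    have hnn : 0 ≤ ∑ B ∈ T, sp B i j * sp A i j :=
      Finset.sum_nonneg (fun B _ => mul_nonneg (sp_nonneg _ _ _) (sp_nonneg _ _ _))
    by_cases h1 : (i ∈ A ↔ j ∈ A)
    · have : sp A i j = 0 := by simp [sp, h1]
      rw [this]; simp
    by_cases h2 : (i ∈ R ↔ j ∈ R)
    · have : sp R i j = 0 := by simp [sp, h2]
      rw [this, mul_zero]
      exact add_nonneg (mul_nonneg (sp_nonneg _ _ _) (g0 _ _)) hnn
    have hA1 : sp A i j = 1 := by simp only [sp, if_neg h1]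
    have hR1 : sp R i j = 1 := by simp only [sp, if_neg h2]
    rw [hA1] at hnn
    rw [hA1, hR1]
    obtain ⟨B, hBS, hBs⟩ : ∃ B ∈ S, ¬ (i ∈ B ↔ j ∈ B) := by
      by_contra hc
      push Not at hc
      exact h2 (hR i j hc)
    by_cases hBT : B ∈ T
    · have h3 : sp B i j * 1 ≤ ∑ B ∈ T, sp B i j * 1 :=
        Finset.single_le_sum (f := fun B => sp B i j * 1)
          (fun B _ => mul_nonneg (sp_nonneg _ _ _) zero_le_one) hBT
      have h4 : sp B i j = 1 := by simp only [sp, if_neg hBs]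
      have := g0 i j
      rw [h4] at h3
      linarith
    · have hbig : ener J A ≤ ener J B := by
        by_contra hc
        push Not at hc
        exact hBT (Finset.mem_filter.2 ⟨hBS, hc.le⟩)
      obtain ⟨w, hw, w1, w2⟩ := exists_wall hij h1
      obtain ⟨w', hw', w1', w2'⟩ := exists_wall hij hBs
      have h5 := hA B hBS w hw w' hw'
      rw [min_eq_left hbig] at h5
      have h6 : g i j = 1 := by
        simp only [hg]
        rw [if_pos]
        refine h5.trans ?_
        have : |w - w'| ≤ |i - j| := by
          rcases abs_cases (w - w') with ⟨e, _⟩ | ⟨e, _⟩ <;>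
          rcases abs_cases (i - j) with ⟨f, _⟩ | ⟨f, _⟩ <;> rw [e, f] <;> omega
        exact_mod_cast this
      rw [h6]; linarith
  have hpt : ∀ i j : ℤ, sp A i j * sp R i j ≤
      sp A i j * g i j + ∑ B ∈ T, sp B i j * sp A i j := by
    intro i j
    rcases le_total i j with h | h
    · exact hpt' i j h
    · have := hpt' j i h
      have e : g i j = g j i := by simp only [hg]; push_cast; rw [abs_sub_comm]
      rw [e]
      simp only [sp_comm _ i j]
      exact this
  have sA := summ_sp_mul hJ A g g0 g1
  have sB : ∀ B ∈ T, Summable (fun p : ℤ × ℤ => J (p.1 - p.2) * (sp B p.1 p.2 * sp A p.1 p.2)) :=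
    fun B _ => summ_sp_mul hJ B (sp A) (sp_nonneg A) (sp_le_one A)
  have sBs := summable_sum sB
  have hX : ∑' p : ℤ × ℤ, J (p.1 - p.2) * (sp A p.1 p.2 * sp R p.1 p.2) ≤
      ∑' p : ℤ × ℤ, J (p.1 - p.2) * (sp A p.1 p.2 * g p.1 p.2) +
      ∑ B ∈ T, ∑' p : ℤ × ℤ, J (p.1 - p.2) * (sp B p.1 p.2 * sp A p.1 p.2) := by
    rw [← Summable.tsum_finsetSum sB, ← sA.tsum_add sBs]
    apply (summ_sp_mul hJ A (sp R) (sp_nonneg R) (sp_le_one R)).tsum_le_tsum _ (sA.add sBs)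
    intro p
    rw [← Finset.mul_sum, ← mul_add]
    exact mul_le_mul_of_nonneg_left (hpt _ _) (hJ.nonneg _)
  have hsm : ∀ B ∈ T, (1 / 2) * ∑' p : ℤ × ℤ, J (p.1 - p.2) * (sp B p.1 p.2 * sp A p.1 p.2) ≤
      ∑ x ∈ B, sepf J A x := by
    intro B _
    rw [half_sum_eq hJ B (sp A) (sp_nonneg A) (sp_le_one A) (sp_comm A)]
    apply Finset.sum_le_sum
    intro x _
    rw [sepf]
    apply Summable.tsum_le_tsum
    · intro j
      apply mul_le_mul_of_nonneg_left _ (hJ.nonneg _)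
      exact mul_le_of_le_one_left (sp_nonneg _ _ _) (sp_le_one _ _ _)
    · exact summ_row_mul hJ x _ (fun j => mul_nonneg (sp_nonneg _ _ _) (sp_nonneg _ _ _))
        (fun j => mul_le_one₀ (sp_le_one _ _ _) (sp_nonneg _ _ _) (sp_le_one _ _ _))
    · exact summ_row_mul hJ x _ (sp_nonneg A x) (sp_le_one A x)
  have hsm2 := Finset.sum_le_sum hsm
  rw [← Finset.mul_sum] at hsm2
  linarith

/-- irreducible contours -/
def Irr (J : ℤ → ℝ) (K ρ : ℝ) (Λ A : Finset ℤ) : Prop :=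
  A ⊆ Λ ∧ A.Nonempty ∧ ∀ A1 A2 : Finset ℤ, A1 ⊆ Λ → A2 ⊆ Λ → A1.Nonempty → A2.Nonempty →
    symmDiff A1 A2 = A → ¬ CSep J K ρ A1 A2

/-- mod 2 indicator -/
def chi (A : Finset ℤ) (x : ℤ) : ZMod 2 := if x ∈ A then 1 else 0

lemma chi_symmDiff (A B : Finset ℤ) (x : ℤ) : chi (symmDiff A B) x = chi A x + chi B x := by
  simp only [chi, Finset.mem_symmDiff]
  by_cases h : x ∈ A <;> by_cases h' : x ∈ B <;> simp [h, h'] <;> decide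

lemma chi_eq_one {A : Finset ℤ} {x : ℤ} : chi A x = 1 ↔ x ∈ A := by
  simp only [chi]; by_cases h : x ∈ A <;> simp [h]

lemma CSep.disj {α J₁ ρ K : ℝ} {J : ℤ → ℝ} (hJ : JF α J₁ J) (hK : KF α ρ K) {A B : Finset ℤ}
    (hA : A.Nonempty) (hB : B.Nonempty) (h : CSep J K ρ A B) : Disjoint (walls A) (walls B) := by
  rw [Finset.disjoint_left]
  intro w hw hw'
  have h1 := h w hw w hw'
  have hr := hK.h1
  have h2 : 1 ≤ (min (ener J A) (ener J B)) ^ (1 / ρ) :=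
    Real.one_le_rpow (le_min (ener_ge_one hJ A hA) (ener_ge_one hJ B hB)) (by positivity)
  have h3 := hK.h3
  simp at h1
  simp at h2
  nlinarith

lemma CSep.ne {α J₁ ρ K : ℝ} {J : ℤ → ℝ} (hJ : JF α J₁ J) (hK : KF α ρ K) {A B : Finset ℤ}
    (hA : A.Nonempty) (hB : B.Nonempty) (h : CSep J K ρ A B) : A ≠ B := by
  rintro rfl
  have h1 := CSep.disj hJ hK hA hB h
  rw [disjoint_self, Finset.bot_eq_empty] at h1
  exact (walls_nonempty hA).ne_empty h1

lemma CSep.ener_le {α J₁ ρ K : ℝ} {J : ℤ → ℝ} (hJ : JF α J₁ J) (hK : KF α ρ K) {A B : Finset ℤ}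
    (hA : A.Nonempty) (hB : B.Nonempty) (h : CSep J K ρ A B) :
    ener J B ≤ ener J (symmDiff A B) := by
  have := energy_drop hJ hK A B hA {B} (by simpa using hB) (by simpa using h)
    (by intro B1 h1 B2 h2 hn
        rw [Finset.mem_singleton] at h1 h2
        exact absurd (h1.trans h2.symm) hn)
    (by intro i j hij; exact hij B (by simp))
  have := ener_nonneg hJ A
  linarith

lemma CSep.mono {α J₁ ρ K : ℝ} {J : ℤ → ℝ} (hJ : JF α J₁ J) (hK : KF α ρ K) {A A' B : Finset ℤ}
    (hE : ener J A' ≤ ener J A) (hw : walls A' ⊆ walls A) (h : CSep J K ρ A B) :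
    CSep J K ρ A' B := by
  intro w w1 w' w1'
  refine le_trans ?_ (h w (hw w1) w' w1')
  have := hK.h3
  have hr := hK.h1
  apply mul_le_mul_of_nonneg_left _ (by linarith)
  exact Real.rpow_le_rpow (le_min (ener_nonneg hJ _) (ener_nonneg hJ _)) (min_le_min_right _ hE)
    (by positivity)

/-- admissible families -/
def Fam (J : ℤ → ℝ) (K ρ : ℝ) (M : Finset ℤ) (C : Finset (Finset ℤ)) : Prop :=
  (∀ A ∈ C, A.Nonempty) ∧ (∀ A ∈ C, ∀ B ∈ C, A ≠ B → CSep J K ρ A B) ∧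
    ∀ x, ∑ A ∈ C, chi A x = chi M x

lemma Fam.split {α J₁ ρ K : ℝ} {J : ℤ → ℝ} (hJ : JF α J₁ J) (hK : KF α ρ K) {M : Finset ℤ}
    {C : Finset (Finset ℤ)} (hC : Fam J K ρ M C) {A1 A2 : Finset ℤ}
    (h1 : A1.Nonempty) (h2 : A2.Nonempty) (hA : symmDiff A1 A2 ∈ C) (hs : CSep J K ρ A1 A2) :
    Fam J K ρ M (insert A1 (insert A2 (C.erase (symmDiff A1 A2)))) ∧
      (insert A1 (insert A2 (C.erase (symmDiff A1 A2)))).card = C.card + 1 := by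
  set A := symmDiff A1 A2 with hAd
  have e2 : ener J A2 ≤ ener J A := CSep.ener_le hJ hK h1 h2 hs
  have e1 : ener J A1 ≤ ener J A := by
    have := CSep.ener_le hJ hK h2 h1 hs.symm
    rwa [symmDiff_comm] at this
  have hd := CSep.disj hJ hK h1 h2 hs
  have w1 : walls A1 ⊆ walls A := walls_sub_of_disj A1 A2 hd
  have w2 : walls A2 ⊆ walls A := by
    have := walls_sub_of_disj A2 A1 hd.symm
    rwa [symmDiff_comm] at this
  have s1 : ∀ B ∈ C.erase A, CSep J K ρ A1 B := by
    intro B hB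
    rw [Finset.mem_erase] at hB
    exact CSep.mono hJ hK e1 w1 (hC.2.1 A hA B hB.2 hB.1.symm)
  have s2 : ∀ B ∈ C.erase A, CSep J K ρ A2 B := by
    intro B hB
    rw [Finset.mem_erase] at hB
    exact CSep.mono hJ hK e2 w2 (hC.2.1 A hA B hB.2 hB.1.symm)
  have hne : ∀ B ∈ C.erase A, B.Nonempty := fun B hB => hC.1 B (Finset.mem_erase.1 hB).2
  have n2 : A2 ∉ C.erase A := fun h => CSep.ne hJ hK h2 h2 (s2 A2 h) rfl
  have n1 : A1 ∉ insert A2 (C.erase A) := by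
    rw [Finset.mem_insert]
    rintro (h | h)
    · exact CSep.ne hJ hK h1 h2 hs h
    · exact CSep.ne hJ hK h1 h1 (s1 A1 h) rfl
  refine ⟨⟨?_, ?_, ?_⟩, ?_⟩
  · intro B hB
    simp only [Finset.mem_insert] at hB
    rcases hB with rfl | rfl | h
    · exact h1
    · exact h2
    · exact hne B h
  · intro B hB B' hB' hnn
    rw [Finset.mem_insert, Finset.mem_insert] at hB hB'
    rcases hB with rfl | rfl | h <;> rcases hB' with rfl | rfl | h'
    · exact absurd rfl hnn
    · exact hs
    · exact s1 _ h'
    · exact hs.symm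
    · exact absurd rfl hnn
    · exact s2 _ h'
    · exact (s1 _ h).symm
    · exact (s2 _ h).symm
    · exact hC.2.1 B (Finset.mem_erase.1 h).2 B' (Finset.mem_erase.1 h').2 hnn
  · intro x
    rw [Finset.sum_insert n1, Finset.sum_insert n2, ← add_assoc, ← chi_symmDiff, ← hAd,
      Finset.add_sum_erase C (fun A => chi A x) hA]
    exact hC.2.2 x
  · rw [Finset.card_insert_of_notMem n1, Finset.card_insert_of_notMem n2,
      Finset.card_erase_of_mem hA]
    have : 0 < C.card := Finset.card_pos.2 ⟨A, hA⟩
    omega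

lemma decomposition {α J₁ ρ K : ℝ} {J : ℤ → ℝ} (hJ : JF α J₁ J) (hK : KF α ρ K) (Λ M : Finset ℤ)
    (hM : M ⊆ Λ) (x : ℤ) (hx : x ∈ M) :
    ∃ A, Irr J K ρ Λ A ∧ x ∈ A ∧ ener J (symmDiff M A) + ener J A / 2 ≤ ener J M := by
  set 𝒮 := Λ.powerset.powerset.filter (fun C => Fam J K ρ M C) with hS
  have hne : 𝒮.Nonempty := by
    refine ⟨{M}, ?_⟩
    rw [hS, Finset.mem_filter]
    refine ⟨by simpa using hM, by simpa using ⟨x, hx⟩, ?_, by simp⟩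
    intro B1 h1 B2 h2 hn
    rw [Finset.mem_singleton] at h1 h2
    exact absurd (h1.trans h2.symm) hn
  obtain ⟨C, hC, hmax⟩ := Finset.exists_max_image 𝒮 Finset.card hne
  rw [hS, Finset.mem_filter, Finset.mem_powerset] at hC
  obtain ⟨hCΛ, hCF⟩ := hC
  have hsub : ∀ A ∈ C, A ⊆ Λ := fun A hA => Finset.mem_powerset.1 (hCΛ hA)
  obtain ⟨A, hAC, hxA⟩ : ∃ A ∈ C, x ∈ A := by
    by_contra hc
    push Not at hc
    have h1 := hCF.2.2 x
    rw [chi_eq_one.2 hx, Finset.sum_eq_zero] at h1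
    · exact absurd h1 (by decide)
    · intro A hA; simp [chi, hc A hA]
  refine ⟨A, ⟨hsub A hAC, hCF.1 A hAC, ?_⟩, hxA, ?_⟩
  · rintro A1 A2 hs1 hs2 h1 h2 rfl hs
    obtain ⟨hF, hcard⟩ := hCF.split hJ hK h1 h2 hAC hs
    have := hmax _ (by
      rw [hS, Finset.mem_filter, Finset.mem_powerset]
      refine ⟨?_, hF⟩
      intro B hB
      rw [Finset.mem_powerset]
      rw [Finset.mem_insert, Finset.mem_insert] at hB
      rcases hB with rfl | rfl | h
      · exact hs1
      · exact hs2
      · exact hsub B (Finset.mem_erase.1 h).2)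
    rw [hcard] at this
    omega
  · have := energy_drop hJ hK A (symmDiff M A) (hCF.1 A hAC) (C.erase A)
      (fun B hB => hCF.1 B (Finset.mem_erase.1 hB).2)
      (fun B hB => hCF.2.1 A hAC B (Finset.mem_erase.1 hB).2 (Finset.mem_erase.1 hB).1.symm)
      (fun B hB B' hB' hn => hCF.2.1 B (Finset.mem_erase.1 hB).2 B' (Finset.mem_erase.1 hB').2 hn)
      (by
        intro i j hij
        have e : ∀ y, chi (symmDiff M A) y = ∑ B ∈ C.erase A, chi B y := by
          intro y
          rw [chi_symmDiff, ← hCF.2.2 y, ← Finset.add_sum_erase C (fun A => chi A y) hAC]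
          have : ∀ a b : ZMod 2, a + b + a = b := by decide
          exact this _ _
        rw [← chi_eq_one, ← chi_eq_one (x := j), e, e]
        have : ∑ B ∈ C.erase A, chi B i = ∑ B ∈ C.erase A, chi B j := by
          apply Finset.sum_congr rfl
          intro B hB
          simp only [chi, hij B hB]
        rw [this])
    rwa [symmDiff_comm M A, symmDiff_symmDiff_cancel_left, symmDiff_comm A M] at this

/-- local energy in an interval -/
def loc (J : ℤ → ℝ) (A I : Finset ℤ) : ℝ := ∑ i ∈ I, ∑ j ∈ I, J (i - j) * sp A i j

lemma loc_ge {α J₁ : ℝ} {J : ℤ → ℝ} (hJ : JF α J₁ J) (A I P Q : Finset ℤ) (L : ℝ) (hP : P ⊆ I)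
    (hQ : Q ⊆ I) (hsep : ∀ i ∈ P, ∀ j ∈ Q, ¬ (i ∈ A ↔ j ∈ A))
    (hL : ∀ i ∈ I, ∀ j ∈ I, |((i - j : ℤ) : ℝ)| ≤ L) :
    (P.card : ℝ) * ((Q.card : ℝ) * L ^ (α - 2)) ≤ loc J A I := by
  have hnn : ∀ i j, 0 ≤ J (i - j) * sp A i j :=
    fun i j => mul_nonneg (hJ.nonneg _) (sp_nonneg _ _ _)
  have ha1 := hJ.ha1
  calc (P.card : ℝ) * ((Q.card : ℝ) * L ^ (α - 2)) = ∑ i ∈ P, ∑ j ∈ Q, L ^ (α - 2) := by simp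
    _ ≤ ∑ i ∈ P, ∑ j ∈ Q, J (i - j) * sp A i j := by
        apply Finset.sum_le_sum; intro i hi
        apply Finset.sum_le_sum; intro j hj
        have h1 := hsep i hi j hj
        rw [sp, if_neg h1, mul_one]
        have hij : i - j ≠ 0 := by
          intro h
          have : i = j := by omega
          rw [this] at h1; exact h1 Iff.rfl
        refine le_trans ?_ (hJ.lower _ hij)
        apply Real.rpow_le_rpow_of_nonpos
        · have : ((i - j : ℤ) : ℝ) ≠ 0 := by exact_mod_cast hij
          positivity
        · exact hL i (hP hi) j (hQ hj)
        · linarith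
    _ ≤ ∑ i ∈ P, ∑ j ∈ I, J (i - j) * sp A i j := by
        apply Finset.sum_le_sum; intro i hi
        exact Finset.sum_le_sum_of_subset_of_nonneg hQ (fun j _ _ => hnn i j)
    _ ≤ loc J A I := Finset.sum_le_sum_of_subset_of_nonneg hP
        (fun i _ _ => Finset.sum_nonneg (fun j _ => hnn i j))

set_option maxHeartbeats 1000000 in
lemma local_energy {α J₁ ρ K : ℝ} {J : ℤ → ℝ} (hJ : JF α J₁ J) (hK : KF α ρ K) (Λ A : Finset ℤ)
    (hΛ : ∀ x ∈ Λ, ∀ y ∈ Λ, ∀ z, x ≤ z → z ≤ y → z ∈ Λ) (hA : Irr J K ρ Λ A)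
    (g a c : ℤ) (m : ℝ) (hg : 2 ≤ g) (hac : a + g ≤ c)
    (hm : ((c + g - a : ℤ) : ℝ) ≤ m * g)
    (hwa : ∀ w ∈ walls A, ¬ (a ≤ w ∧ w < a + g)) (hwc : ∀ w ∈ walls A, ¬ (c ≤ w ∧ w < c + g))
    (w0 : ℤ) (hw0 : w0 ∈ walls A) (hw1 : a + g ≤ w0) (hw2 : w0 < c)
    (hex : ¬ ∀ w ∈ walls A, a + g ≤ w ∧ w ≤ c) :
    (g : ℝ) ^ ρ ≤ K ^ ρ * (1 + 4 / (1 - α) * m ^ (2 - α)) *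
      loc J A (Finset.Ico a (c + g)) := by
  have ha := hJ.ha
  have ha1 := hJ.ha1
  have hr := hK.h1
  have hr2 := hK.h2
  have hK3 := hK.h3
  have hgr : (2 : ℝ) ≤ g := by exact_mod_cast hg
  have hm0 : 1 ≤ m := by
    have : ((2 * g : ℤ) : ℝ) ≤ ((c + g - a : ℤ) : ℝ) := by
      have : 2 * g ≤ c + g - a := by omega
      exact_mod_cast this
    push_cast at this hm
    by_contra hc
    push Not at hc
    nlinarith
  set I := Finset.Ico a (c + g) with hI
  set Ua := Finset.Ico a (a + g) with hUa
  set Uc := Finset.Ico c (c + g) with hUc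
  have hUaI : Ua ⊆ I := by intro x; simp only [hUa, hI, Finset.mem_Ico]; omega
  have hUcI : Uc ⊆ I := by intro x; simp only [hUc, hI, Finset.mem_Ico]; omega
  have hcA : (Ua.card : ℝ) = g := by
    rw [hUa, Int.card_Ico]
    have : ((a + g - a).toNat : ℤ) = g := by omega
    exact_mod_cast this
  have hcC : (Uc.card : ℝ) = g := by
    rw [hUc, Int.card_Ico]
    have : ((c + g - c).toNat : ℤ) = g := by omega
    exact_mod_cast this
  have hL : ∀ i ∈ I, ∀ j ∈ I, |((i - j : ℤ) : ℝ)| ≤ m * g := by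
    intro i hi j hj
    rw [hI, Finset.mem_Ico] at hi hj
    refine le_trans ?_ hm
    have : |i - j| ≤ c + g - a := by rw [abs_le]; constructor <;> omega
    exact_mod_cast this
  have stA : ∀ i ∈ Ua, (i ∈ A ↔ a ∈ A) := by
    intro i hi
    rw [hUa, Finset.mem_Ico] at hi
    by_contra hc
    obtain ⟨w, h1, h2, h3⟩ := exists_wall hi.1 (fun h => hc h.symm)
    exact hwa w h1 ⟨by omega, by omega⟩
  have stC : ∀ i ∈ Uc, (i ∈ A ↔ c ∈ A) := by
    intro i hi
    rw [hUc, Finset.mem_Ico] at hi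
    by_contra hc
    obtain ⟨w, h1, h2, h3⟩ := exists_wall hi.1 (fun h => hc h.symm)
    exact hwc w h1 ⟨by omega, by omega⟩
  set e := loc J A I with he
  have he0 : 0 ≤ e := Finset.sum_nonneg (fun i _ => Finset.sum_nonneg
    (fun j _ => mul_nonneg (hJ.nonneg _) (sp_nonneg _ _ _)))
  have hKρ : 1 ≤ K ^ ρ := Real.one_le_rpow (by linarith) (by linarith)
  have hmp : 0 < m ^ (2 - α) := by positivity
  have h4 : 4 ≤ 4 / (1 - α) := by rw [le_div_iff₀ (by linarith)]; linarith
  have hmi : m ^ (α - 2) * m ^ (2 - α) = 1 := by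
    rw [← Real.rpow_add (by linarith)]; simp
  have hg2 : (g : ℝ) * (g : ℝ) ^ (α - 2) = (g : ℝ) ^ (α - 1) := by
    rw [show α - 1 = 1 + (α - 2) by ring, Real.rpow_add (by linarith), Real.rpow_one]
  have hg1 : (g : ℝ) * (g : ℝ) ^ (α - 1) = (g : ℝ) ^ α := by
    rw [show α = 1 + (α - 1) by ring, Real.rpow_add (by linarith), Real.rpow_one]
    congr 2; ring
  have hmg : (m * g) ^ (α - 2) = m ^ (α - 2) * (g : ℝ) ^ (α - 2) :=
    Real.mul_rpow (by linarith) (by linarith)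
  by_cases hst : (a ∈ A ↔ c ∈ A)
  swap
  · have h1 := loc_ge hJ A I Ua Uc (m * g) hUaI hUcI
      (by intro i hi j hj; rw [stA i hi, stC j hj]; exact hst) hL
    rw [hcA, hcC, hmg] at h1
    have h2 : (g : ℝ) ^ α * m ^ (α - 2) ≤ e := by
      rw [← hg1, ← hg2]; linarith
    have h3 : (g : ℝ) ^ α ≤ m ^ (2 - α) * e := by
      have := mul_le_mul_of_nonneg_left h2 hmp.le
      have e2 : m ^ (2 - α) * ((g : ℝ) ^ α * m ^ (α - 2)) = (g : ℝ) ^ α := by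
        rw [mul_comm, mul_assoc, hmi, mul_one]
      linarith
    have h5 : (g : ℝ) ^ ρ ≤ (g : ℝ) ^ α :=
      Real.rpow_le_rpow_of_exponent_le (by linarith) hr2.le
    have h6 : m ^ (2 - α) * e ≤ (1 + 4 / (1 - α) * m ^ (2 - α)) * e := by
      apply mul_le_mul_of_nonneg_right _ he0
      nlinarith
    have h7 : (1 + 4 / (1 - α) * m ^ (2 - α)) * e ≤
        K ^ ρ * (1 + 4 / (1 - α) * m ^ (2 - α)) * e := by
      apply mul_le_mul_of_nonneg_right _ he0
      apply le_mul_of_one_le_left _ hKρ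
      positivity
    linarith
  · set A1 := I.filter (fun i => ¬ (i ∈ A ↔ a ∈ A)) with hA1
    have hA1m : ∀ i, i ∈ A1 ↔ (a ≤ i ∧ i < c + g) ∧ ¬ (i ∈ A ↔ a ∈ A) := by
      intro i; rw [hA1, Finset.mem_filter, hI, Finset.mem_Ico]
    have hA1r : ∀ i ∈ A1, a + g ≤ i ∧ i < c := by
      intro i hi
      rw [hA1m] at hi
      constructor
      · by_contra h
        exact hi.2 (stA i (by rw [hUa, Finset.mem_Ico]; omega))
      · by_contra h
        apply hi.2
        rw [stC i (by rw [hUc, Finset.mem_Ico]; omega), hst]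
    have hA1ne : A1.Nonempty := by
      rw [mem_walls] at hw0
      by_cases h : (w0 ∈ A ↔ a ∈ A)
      · refine ⟨w0 - 1, ?_⟩
        rw [hA1m]; exact ⟨by omega, by tauto⟩
      · refine ⟨w0, ?_⟩
        rw [hA1m]; exact ⟨by omega, h⟩
    set A2 := symmDiff A A1 with hA2
    have hA2m : ∀ i, a ≤ i → i < c + g → (i ∈ A2 ↔ a ∈ A) := by
      intro i h1 h2
      rw [hA2, Finset.mem_symmDiff, hA1m]
      tauto
    have hwA1 : ∀ w ∈ walls A1, a + g ≤ w ∧ w ≤ c := by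
      intro w hw
      rw [mem_walls] at hw
      by_cases h : w ∈ A1
      · have := hA1r w h; omega
      · have := hA1r (w - 1) (by tauto); omega
    have hwA2 : ∀ w ∈ walls A2, w ≤ a ∨ c + g ≤ w := by
      intro w hw
      rw [mem_walls] at hw
      by_contra h
      push Not at h
      apply hw
      rw [hA2m w (by omega) (by omega), hA2m (w - 1) (by omega) (by omega)]
    have hA2ne : A2.Nonempty := by
      rw [Finset.nonempty_iff_ne_empty]
      intro h
      apply hex
      have : A = A1 := by
        have h2 : symmDiff A A1 = ∅ := h
        rwa [← Finset.bot_eq_empty, symmDiff_eq_bot] at h2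
      rw [this]; exact hwA1
    have hA1Λ : A1 ⊆ Λ := by
      intro i hi
      have hi1 := hA1r i hi
      by_cases haA : a ∈ A
      · exact hΛ a (hA.1 haA) c (hA.1 (hst.1 haA)) i (by omega) (by omega)
      · rw [hA1m] at hi
        exact hA.1 (by tauto)
    have hA2Λ : A2 ⊆ Λ := by
      intro i hi
      rw [hA2, Finset.mem_symmDiff] at hi
      rcases hi with h | h
      · exact hA.1 h.1
      · exact hA1Λ h.1
    have hns := hA.2.2 A1 A2 hA1Λ hA2Λ hA1ne hA2ne
      (by rw [hA2, symmDiff_comm A A1, symmDiff_symmDiff_cancel_left])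
    have hE1 := ener_ge_one hJ A1 hA1ne
    have hgK : (g : ℝ) ≤ K * (ener J A1) ^ (1 / ρ) := by
      by_contra hc
      push Not at hc
      apply hns
      intro w hw w' hw'
      have h1 := hwA1 w hw
      have h2 := hwA2 w' hw'
      have h3 : g ≤ |w - w'| := by
        rcases h2 with h2 | h2
        · rw [abs_of_nonneg (by omega)]; omega
        · rw [abs_of_nonpos (by omega)]; omega
      have h4 : (g : ℝ) ≤ |((w - w' : ℤ) : ℝ)| := by exact_mod_cast h3
      refine le_trans ?_ (hc.le.trans h4)
      apply mul_le_mul_of_nonneg_left _ (by linarith)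
      apply Real.rpow_le_rpow (le_min (by linarith) (ener_nonneg hJ _)) (min_le_left _ _)
      positivity
    have hgρ : (g : ℝ) ^ ρ ≤ K ^ ρ * ener J A1 := by
      have := Real.rpow_le_rpow (by linarith) hgK (by linarith : 0 ≤ ρ)
      rwa [Real.mul_rpow (by linarith) (by positivity), ← Real.rpow_mul (by linarith),
        one_div_mul_cancel (by linarith), Real.rpow_one] at this
    have hrow : ∀ i ∈ A1, sepf J A1 i ≤ ∑ j ∈ I, J (i - j) * sp A i j +
        4 / (1 - α) * (g : ℝ) ^ (α - 1) := by
      intro i hi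
      have hi1 := hA1r i hi
      have hi2 := (hA1m i).1 hi
      set gg : ℤ → ℝ := fun j => if (g : ℝ) ≤ |((i - j : ℤ) : ℝ)| then 1 else 0 with hgg
      have gg0 : ∀ j, 0 ≤ gg j := by intro j; simp only [hgg]; split_ifs <;> norm_num
      have gg1 : ∀ j, gg j ≤ 1 := by intro j; simp only [hgg]; split_ifs <;> norm_num
      have sgg := summ_row_mul hJ i gg gg0 gg1
      have etail : ∑' j : ℤ, (if (g : ℝ) ≤ |(j : ℝ)| then J j else 0) = ∑' j : ℤ, J (i - j) * gg j := by
        rw [← (Equiv.subLeft i).tsum_eq]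
        congr 1; ext j
        simp only [Equiv.subLeft_apply, hgg]
        split_ifs <;> simp
      have htl := hJ.tail g hgr
      rw [etail] at htl
      set ff : ℤ → ℝ := fun j => if j ∈ I then sp A i j else 0 with hff
      have ff0 : ∀ j, 0 ≤ ff j := by
        intro j; simp only [hff]; split_ifs
        · exact sp_nonneg _ _ _
        · norm_num
      have ff1 : ∀ j, ff j ≤ 1 := by
        intro j; simp only [hff]; split_ifs
        · exact sp_le_one _ _ _
        · norm_num
      have sff := summ_row_mul hJ i ff ff0 ff1
      have eff : ∑ j ∈ I, J (i - j) * sp A i j = ∑' j : ℤ, J (i - j) * ff j := by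
        rw [tsum_eq_sum (s := I)]
        · apply Finset.sum_congr rfl
          intro j hj; simp only [hff, if_pos hj]
        · intro j hj; simp only [hff, if_neg hj, mul_zero]
      rw [eff]
      have : sepf J A1 i ≤ ∑' j : ℤ, J (i - j) * ff j + ∑' j : ℤ, J (i - j) * gg j := by
        rw [sepf, ← sff.tsum_add sgg]
        apply (summ_row_mul hJ i _ (sp_nonneg A1 i) (sp_le_one A1 i)).tsum_le_tsum _ (sff.add sgg)
        intro j
        rw [← mul_add]
        apply mul_le_mul_of_nonneg_left _ (hJ.nonneg _)
        by_cases hjI : j ∈ I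
        · have hjI' := hjI
          rw [hI, Finset.mem_Ico] at hjI'
          have h1 := gg0 j
          have h2 : sp A1 i j ≤ ff j := by
            simp only [hff, if_pos hjI, sp]
            by_cases hj1 : j ∈ A1
            · simp only [hi, hj1, if_true]
              split_ifs <;> norm_num
            · have : ¬ (i ∈ A ↔ j ∈ A) := by
                rw [hA1m] at hj1; tauto
              rw [if_neg this]
              split_ifs <;> norm_num
          linarith
        · have h1 := ff0 j
          rw [hI, Finset.mem_Ico] at hjI
          have h2 : gg j = 1 := by
            simp only [hgg]
            rw [if_pos]
            have : g ≤ |i - j| := by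
              by_cases hj : j < a
              · rw [abs_of_nonneg (by omega)]; omega
              · rw [abs_of_nonpos (by omega)]; omega
            exact_mod_cast this
          have := sp_le_one A1 i j
          linarith
      linarith
    have hsum := Finset.sum_le_sum hrow
    rw [← ener_eq hJ, Finset.sum_add_distrib, Finset.sum_const, nsmul_eq_mul] at hsum
    have hA1I : A1 ⊆ I := Finset.filter_subset _ _
    have h8 : ∑ i ∈ A1, ∑ j ∈ I, J (i - j) * sp A i j ≤ e :=
      Finset.sum_le_sum_of_subset_of_nonneg hA1I (fun i _ _ => Finset.sum_nonneg
        (fun j _ => mul_nonneg (hJ.nonneg _) (sp_nonneg _ _ _)))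
    have h9 := loc_ge hJ A I A1 Ua (m * g) hA1I hUaI
      (by intro i hi j hj; rw [stA j hj]; exact ((hA1m i).1 hi).2) hL
    rw [hcA, hmg] at h9
    have h10 : (A1.card : ℝ) * (g : ℝ) ^ (α - 1) ≤ m ^ (2 - α) * e := by
      have := mul_le_mul_of_nonneg_left h9 hmp.le
      refine le_trans (le_of_eq ?_) this
      rw [← hg2]
      calc (A1.card : ℝ) * (g * (g : ℝ) ^ (α - 2)) =
          (m ^ (α - 2) * m ^ (2 - α)) * ((A1.card : ℝ) * (g * (g : ℝ) ^ (α - 2))) := by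
            rw [hmi, one_mul]
        _ = _ := by ring
    have h11 : ener J A1 ≤ (1 + 4 / (1 - α) * m ^ (2 - α)) * e := by
      have : 4 / (1 - α) * ((A1.card : ℝ) * (g : ℝ) ^ (α - 1)) ≤
          4 / (1 - α) * (m ^ (2 - α) * e) := mul_le_mul_of_nonneg_left h10 (by linarith)
      linarith
    calc (g : ℝ) ^ ρ ≤ K ^ ρ * ener J A1 := hgρ
      _ ≤ K ^ ρ * ((1 + 4 / (1 - α) * m ^ (2 - α)) * e) :=
          mul_le_mul_of_nonneg_left h11 (by linarith)
      _ = _ := by ring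

/-- occupied blocks at scale t -/
def Sb (A : Finset ℤ) (t : ℕ) : Finset ℤ := (walls A).image (fun w => w / 2 ^ t)

/-- all walls lie in three adjacent blocks at scale t -/
def Exc (A : Finset ℤ) (t : ℕ) : Prop :=
  ∃ k : ℤ, ∀ w ∈ walls A, k - 1 ≤ w / 2 ^ t ∧ w / 2 ^ t ≤ k + 1

lemma ediv_pow_add (w : ℤ) (s b : ℕ) : w / 2 ^ (s + b) = w / 2 ^ s / 2 ^ b := by
  have hs : ¬ ((2 : ℤ) ^ s < 0) := by
    have : (0 : ℤ) < 2 ^ s := by positivity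
    omega
  rw [Int.ediv_ediv, pow_add, if_neg (fun h => hs h.1), sub_zero]

lemma Sb_add (A : Finset ℤ) (s b : ℕ) : Sb A (s + b) = (Sb A s).image (fun v => v / 2 ^ b) := by
  rw [Sb, Sb, Finset.image_image]
  apply Finset.image_congr
  intro w _
  simp only [Function.comp]
  exact ediv_pow_add w s b

lemma Exc_mono (A : Finset ℤ) (s b : ℕ) (h : Exc A s) : Exc A (s + b) := by
  obtain ⟨k, hk⟩ := h
  have hB : (0 : ℤ) < 2 ^ b := by positivity
  refine ⟨k / 2 ^ b, fun w hw => ?_⟩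
  obtain ⟨h1, h2⟩ := hk w hw
  rw [ediv_pow_add]
  generalize w / 2 ^ s = v at *
  generalize (2 : ℤ) ^ b = B at *
  constructor
  · rw [Int.le_ediv_iff_mul_le hB]
    have := Int.ediv_mul_le k hB.ne'
    nlinarith
  · have : v / B < k / B + 2 := by
      rw [Int.ediv_lt_iff_lt_mul hB]
      have := Int.lt_ediv_add_one_mul_self k hB
      nlinarith
    omega

lemma sum_overlap (S : Finset ℤ) (R : ℤ → Finset (ℤ × ℤ)) (f : ℤ × ℤ → ℝ) (hf : ∀ p, 0 ≤ f p)
    (h3 : ∀ p, (S.filter (fun k => p ∈ R k)).card ≤ 3) :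
    ∑ k ∈ S, ∑ p ∈ R k, f p ≤ 3 * ∑ p ∈ S.biUnion R, f p := by
  have e : ∀ k ∈ S, ∑ p ∈ R k, f p = ∑ p ∈ S.biUnion R, if p ∈ R k then f p else 0 := by
    intro k hk
    rw [← Finset.sum_filter]
    apply Finset.sum_congr _ (fun _ _ => rfl)
    ext p
    simp only [Finset.mem_filter, Finset.mem_biUnion]
    exact ⟨fun h => ⟨⟨k, hk, h⟩, h⟩, fun h => h.2⟩
  rw [Finset.sum_congr rfl e, Finset.sum_comm, Finset.mul_sum]
  apply Finset.sum_le_sum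
  intro p _
  rw [← Finset.sum_filter, Finset.sum_const, nsmul_eq_mul]
  apply mul_le_mul_of_nonneg_right _ (hf p)
  exact_mod_cast h3 p

lemma loc_overlap {α J₁ : ℝ} {J : ℤ → ℝ} (hJ : JF α J₁ J) (A S : Finset ℤ) (t : ℕ) :
    ∑ k ∈ S, loc J A (Finset.Ico ((k - 1) * 2 ^ t) ((k + 2) * 2 ^ t)) ≤ 6 * ener J A := by
  have hB : (0 : ℤ) < 2 ^ t := by positivity
  set R : ℤ → Finset (ℤ × ℤ) := fun k =>
    (Finset.Ico ((k - 1) * 2 ^ t) ((k + 2) * 2 ^ t)) ×ˢ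
      (Finset.Ico ((k - 1) * 2 ^ t) ((k + 2) * 2 ^ t)) with hR
  have h := sum_overlap S R (fun p => J (p.1 - p.2) * sp A p.1 p.2)
    (fun p => mul_nonneg (hJ.nonneg _) (sp_nonneg _ _ _)) (by
      intro p
      have : S.filter (fun k => p ∈ R k) ⊆ Finset.Icc (p.1 / 2 ^ t - 1) (p.1 / 2 ^ t + 1) := by
        intro k hk
        simp only [hR, Finset.mem_filter, Finset.mem_product, Finset.mem_Ico] at hk
        obtain ⟨_, ⟨h1, h2⟩, _⟩ := hk
        rw [Finset.mem_Icc]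
        have g1 : k - 1 ≤ p.1 / 2 ^ t := by rwa [Int.le_ediv_iff_mul_le hB]
        have g2 : p.1 / 2 ^ t < k + 2 := by rwa [Int.ediv_lt_iff_lt_mul hB]
        omega
      refine (Finset.card_le_card this).trans ?_
      rw [Int.card_Icc]; omega)
  have h2 := ener_ge_finset hJ A (S.biUnion R)
  have e : ∑ k ∈ S, loc J A (Finset.Ico ((k - 1) * 2 ^ t) ((k + 2) * 2 ^ t)) =
      ∑ k ∈ S, ∑ p ∈ R k, J (p.1 - p.2) * sp A p.1 p.2 := by
    apply Finset.sum_congr rfl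
    intro k _
    rw [loc, hR, Finset.sum_product]
  rw [e]; linarith

lemma loc_mono {α J₁ : ℝ} {J : ℤ → ℝ} (hJ : JF α J₁ J) (A I I' : Finset ℤ) (h : I ⊆ I') :
    loc J A I ≤ loc J A I' := by
  have hnn : ∀ i j, 0 ≤ J (i - j) * sp A i j :=
    fun i j => mul_nonneg (hJ.nonneg _) (sp_nonneg _ _ _)
  refine (Finset.sum_le_sum (fun i _ =>
    Finset.sum_le_sum_of_subset_of_nonneg h (fun j _ _ => hnn i j))).trans ?_
  exact Finset.sum_le_sum_of_subset_of_nonneg h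
    (fun i _ _ => Finset.sum_nonneg (fun j _ => hnn i j))

lemma dense_count (S D : Finset ℤ) (B : ℕ) (f : ℤ → ℤ)
    (hD : ∀ k ∈ D, B ≤ (S.filter (fun v => k - 1 ≤ f v ∧ f v ≤ k + 1)).card) :
    D.card * B ≤ 3 * S.card := by
  have h := Finset.sum_card_bipartiteAbove_eq_sum_card_bipartiteBelow (s := D) (t := S)
    (fun k v => k - 1 ≤ f v ∧ f v ≤ k + 1)
  have h1 : D.card * B ≤ ∑ k ∈ D, (Finset.bipartiteAbove (fun k v => k - 1 ≤ f v ∧ f v ≤ k + 1) S k).card := by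
    rw [← smul_eq_mul]
    exact Finset.card_nsmul_le_sum _ _ _ hD
  rw [h] at h1
  refine h1.trans ?_
  rw [mul_comm, ← smul_eq_mul]
  apply Finset.sum_le_card_nsmul
  intro v _
  have : Finset.bipartiteBelow (fun k v => k - 1 ≤ f v ∧ f v ≤ k + 1) D v ⊆
      Finset.Icc (f v - 1) (f v + 1) := by
    intro k hk
    rw [Finset.mem_bipartiteBelow] at hk
    rw [Finset.mem_Icc]; omega
  refine (Finset.card_le_card this).trans ?_
  rw [Int.card_Icc]; omega

lemma exists_empty (S : Finset ℤ) (b : ℕ) (k j : ℤ) (hj : k - 1 ≤ j ∧ j ≤ k + 1)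
    (h : (S.filter (fun v => k - 1 ≤ v / 2 ^ b ∧ v / 2 ^ b ≤ k + 1)).card < 2 ^ b) :
    ∃ u : ℤ, j * 2 ^ b ≤ u ∧ u < (j + 1) * 2 ^ b ∧ u ∉ S := by
  have hB : (0 : ℤ) < 2 ^ b := by positivity
  by_contra hc
  push Not at hc
  have : Finset.Ico (j * 2 ^ b) ((j + 1) * 2 ^ b) ⊆
      S.filter (fun v => k - 1 ≤ v / 2 ^ b ∧ v / 2 ^ b ≤ k + 1) := by
    intro u hu
    rw [Finset.mem_Ico] at hu
    rw [Finset.mem_filter]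
    refine ⟨hc u hu.1 hu.2, ?_⟩
    have g1 : j ≤ u / 2 ^ b := by rw [Int.le_ediv_iff_mul_le hB]; exact hu.1
    have g2 : u / 2 ^ b < j + 1 := by rw [Int.ediv_lt_iff_lt_mul hB]; exact hu.2
    omega
  have := Finset.card_le_card this
  rw [Int.card_Ico, show (j + 1) * 2 ^ b - j * 2 ^ b = ((2 ^ b : ℕ) : ℤ) by push_cast; ring,
    Int.toNat_natCast] at this
  omega

set_option maxHeartbeats 1000000 in
lemma sparse_energy {α J₁ ρ K : ℝ} {J : ℤ → ℝ} (hJ : JF α J₁ J) (hK : KF α ρ K) (Λ A : Finset ℤ)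
    (hΛ : ∀ x ∈ Λ, ∀ y ∈ Λ, ∀ z, x ≤ z → z ≤ y → z ∈ Λ) (hA : Irr J K ρ Λ A)
    (s b : ℕ) (hs : 1 ≤ s) (hex : ¬ Exc A (s + b)) (k : ℤ) (hk : k ∈ Sb A (s + b))
    (h : ((Sb A s).filter (fun v => k - 1 ≤ v / 2 ^ b ∧ v / 2 ^ b ≤ k + 1)).card < 2 ^ b) :
    ((2 : ℝ) ^ s) ^ ρ ≤ K ^ ρ * (1 + 4 / (1 - α) * (3 * 2 ^ b) ^ (2 - α)) *
      loc J A (Finset.Ico ((k - 1) * 2 ^ (s + b)) ((k + 2) * 2 ^ (s + b))) := by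
  have hG : (0 : ℤ) < 2 ^ s := by positivity
  have hB : (0 : ℤ) < 2 ^ b := by positivity
  have hGB : (0 : ℤ) < 2 ^ (s + b) := by positivity
  have hg2 : (2 : ℤ) ≤ 2 ^ s := by
    calc (2 : ℤ) = 2 ^ 1 := by norm_num
      _ ≤ 2 ^ s := pow_le_pow_right₀ (by norm_num) hs
  obtain ⟨u, hu1, hu2, hu3⟩ := exists_empty (Sb A s) b k (k - 1) (by omega) h
  obtain ⟨u', hv1, hv2, hv3⟩ := exists_empty (Sb A s) b k (k + 1) (by omega) h
  obtain ⟨w0, hw0, hw0k⟩ := Finset.mem_image.1 hk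
  have emp : ∀ u : ℤ, u ∉ Sb A s → ∀ w ∈ walls A, ¬ (u * 2 ^ s ≤ w ∧ w < u * 2 ^ s + 2 ^ s) := by
    intro u hu w hw hc
    apply hu
    rw [Sb, Finset.mem_image]
    refine ⟨w, hw, ?_⟩
    have g1 : u ≤ w / 2 ^ s := by rw [Int.le_ediv_iff_mul_le hG]; exact hc.1
    have g2 : w / 2 ^ s < u + 1 := by rw [Int.ediv_lt_iff_lt_mul hG]; linarith [hc.2]
    omega
  have hw0a : k * 2 ^ (s + b) ≤ w0 := by rw [← Int.le_ediv_iff_mul_le hGB]; exact hw0k.ge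
  have hw0b : w0 < (k + 1) * 2 ^ (s + b) := by
    rw [← Int.ediv_lt_iff_lt_mul hGB]
    have : w0 / 2 ^ (s + b) = k := hw0k
    omega
  have hpow : (2 : ℤ) ^ (s + b) = 2 ^ b * 2 ^ s := by rw [pow_add, mul_comm]
  have key := local_energy hJ hK Λ A hΛ hA (2 ^ s) (u * 2 ^ s) (u' * 2 ^ s) (3 * 2 ^ b) hg2
    (by nlinarith) (by
      have : u' * 2 ^ s + 2 ^ s - u * 2 ^ s ≤ 3 * 2 ^ b * 2 ^ s := by
        have : u' + 1 - u ≤ 3 * 2 ^ b := by linarith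
        nlinarith
      exact_mod_cast this)
    (emp u hu3) (emp u' hv3) w0 hw0 (by rw [hpow] at hw0a; nlinarith)
    (by rw [hpow] at hw0b; nlinarith) (by
      intro hall
      apply hex
      refine ⟨k, fun w hw => ?_⟩
      obtain ⟨h1, h2⟩ := hall w hw
      constructor
      · rw [Int.le_ediv_iff_mul_le hGB, hpow]; nlinarith
      · have : w / 2 ^ (s + b) < k + 2 := by
          rw [Int.ediv_lt_iff_lt_mul hGB, hpow]; nlinarith
        omega)
  have hK3 := hK.h3
  have ha1 := hJ.ha1
  have hc : 0 ≤ K ^ ρ * (1 + 4 / (1 - α) * (3 * 2 ^ b) ^ (2 - α)) := by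
    have : 0 < 1 - α := by linarith
    positivity
  push_cast at key
  refine key.trans (mul_le_mul_of_nonneg_left (loc_mono hJ _ _ _ ?_) hc)
  apply Finset.Ico_subset_Ico
  · rw [hpow]; nlinarith
  · rw [hpow]; nlinarith

lemma n_step {α J₁ ρ K : ℝ} {J : ℤ → ℝ} (hJ : JF α J₁ J) (hK : KF α ρ K) (Λ A : Finset ℤ)
    (hΛ : ∀ x ∈ Λ, ∀ y ∈ Λ, ∀ z, x ≤ z → z ≤ y → z ∈ Λ) (hA : Irr J K ρ Λ A)
    (s b : ℕ) (hs : 1 ≤ s) (hex : ¬ Exc A (s + b)) :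
    ((Sb A (s + b)).card : ℝ) ≤ 3 * (Sb A s).card / 2 ^ b +
      6 * ener J A * (K ^ ρ * (1 + 4 / (1 - α) * (3 * 2 ^ b) ^ (2 - α))) / ((2 : ℝ) ^ s) ^ ρ := by
  set C := K ^ ρ * (1 + 4 / (1 - α) * (3 * 2 ^ b) ^ (2 - α)) with hC
  have hK3 := hK.h3
  have ha1 := hJ.ha1
  have hc : 0 ≤ C := by
    have : 0 < 1 - α := by linarith
    rw [hC]
    positivity
  set D := (Sb A (s + b)).filter (fun k =>
    2 ^ b ≤ ((Sb A s).filter (fun v => k - 1 ≤ v / 2 ^ b ∧ v / 2 ^ b ≤ k + 1)).card) with hD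
  set D' := (Sb A (s + b)).filter (fun k => ¬
    2 ^ b ≤ ((Sb A s).filter (fun v => k - 1 ≤ v / 2 ^ b ∧ v / 2 ^ b ≤ k + 1)).card) with hD'
  have hcard : D.card + D'.card = (Sb A (s + b)).card := Finset.card_filter_add_card_filter_not _
  have h1 : D.card * 2 ^ b ≤ 3 * (Sb A s).card :=
    dense_count (Sb A s) D (2 ^ b) (fun v => v / 2 ^ b) (fun k hk => (Finset.mem_filter.1 hk).2)
  have h1' : (D.card : ℝ) ≤ 3 * (Sb A s).card / 2 ^ b := by
    rw [le_div_iff₀ (by positivity)]; exact_mod_cast h1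
  have h2 : (D'.card : ℝ) * ((2 : ℝ) ^ s) ^ ρ ≤ 6 * ener J A * C := by
    calc (D'.card : ℝ) * ((2 : ℝ) ^ s) ^ ρ = ∑ k ∈ D', ((2 : ℝ) ^ s) ^ ρ := by simp
      _ ≤ ∑ k ∈ D', C * loc J A (Finset.Ico ((k - 1) * 2 ^ (s + b)) ((k + 2) * 2 ^ (s + b))) := by
        apply Finset.sum_le_sum
        intro k hk
        rw [hD', Finset.mem_filter, not_le] at hk
        exact sparse_energy hJ hK Λ A hΛ hA s b hs hex k hk.1 hk.2
      _ ≤ C * (6 * ener J A) := by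
        rw [← Finset.mul_sum]
        exact mul_le_mul_of_nonneg_left (loc_overlap hJ A D' (s + b)) hc
      _ = _ := by ring
  rw [← le_div_iff₀ (by positivity)] at h2
  rw [← hcard]; push_cast; linarith

/-- Lemma B: multiscale bound on the number of occupied blocks -/
lemma n_bound {α ρ K : ℝ} (hK : KF α ρ K) (ha1 : α < 1) : ∃ C1 : ℝ, 1 ≤ C1 ∧
    ∀ (J₁ : ℝ) (J : ℤ → ℝ), JF α J₁ J → ∀ Λ A : Finset ℤ,
    (∀ x ∈ Λ, ∀ y ∈ Λ, ∀ z, x ≤ z → z ≤ y → z ∈ Λ) → Irr J K ρ Λ A →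
    ∀ t, ¬ Exc A t → ((2 : ℝ) ^ ρ) ^ t * (Sb A t).card ≤ C1 * ener J A := by
  have hr1 := hK.h1
  have hr2 := hK.h2
  have hK3 := hK.h3
  set r := (2 : ℝ) ^ ρ with hr
  have hr0 : 1 ≤ r := Real.one_le_rpow (by norm_num) (by linarith)
  have hrlt : r / 2 < 1 := by
    rw [div_lt_one (by norm_num)]
    calc r < (2 : ℝ) ^ (1 : ℝ) := Real.rpow_lt_rpow_of_exponent_lt (by norm_num) (by linarith)
      _ = 2 := by norm_num
  obtain ⟨b, hb⟩ := exists_pow_lt_of_lt_one (by norm_num : (0 : ℝ) < 1 / 6) hrlt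
  set C := K ^ ρ * (1 + 4 / (1 - α) * (3 * 2 ^ b) ^ (2 - α)) with hC
  have hc : 0 ≤ C := by
    have : 0 < 1 - α := by linarith
    rw [hC]
    positivity
  refine ⟨r ^ b * (1 + 12 * C), ?_, ?_⟩
  · have : 1 ≤ r ^ b := one_le_pow₀ hr0
    nlinarith
  intro J₁ J hJ Λ A hΛ hA t
  have hE0 := ener_nonneg hJ A
  induction t using Nat.strong_induction_on with
  | _ t ih =>
    intro hex
    by_cases htb : t ≤ b
    · have h1 : ((Sb A t).card : ℝ) ≤ (walls A).card := by exact_mod_cast Finset.card_image_le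
      have h2 := ener_ge_walls hJ A
      have h3 : ((walls A).card : ℝ) ≤ ener J A := by nlinarith [hJ.hJ1, (Nat.cast_nonneg (walls A).card : (0:ℝ) ≤ _)]
      have h4 : r ^ t ≤ r ^ b := pow_le_pow_right₀ hr0 htb
      have h5 : 0 < r ^ b := by positivity
      calc r ^ t * ((Sb A t).card : ℝ) ≤ r ^ b * ener J A :=
            mul_le_mul h4 (h1.trans h3) (by positivity) h5.le
        _ ≤ r ^ b * (1 + 12 * C) * ener J A := by
            apply mul_le_mul_of_nonneg_right _ hE0
            nlinarith
    · push Not at htb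
      obtain ⟨s, rfl⟩ : ∃ s, t = s + b := ⟨t - b, by omega⟩
      have hs : 1 ≤ s := by omega
      by_cases hb0 : b = 0
      · rw [hb0] at hb; norm_num at hb
      have ih' := ih s (by omega) (fun h => hex (Exc_mono A s b h))
      have st := n_step hJ hK Λ A hΛ hA s b hs hex
      rw [← hC] at st
      have e1 : ((2 : ℝ) ^ s) ^ ρ = r ^ s := by
        rw [hr, ← Real.rpow_natCast, ← Real.rpow_natCast, ← Real.rpow_mul (by norm_num),
          ← Real.rpow_mul (by norm_num), mul_comm]
      rw [e1] at st
      have hrs : 0 < r ^ s := by positivity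
      have hrb : 0 < r ^ b := by positivity
      rw [div_pow] at hb
      rw [pow_add]
      calc r ^ s * r ^ b * ((Sb A (s + b)).card : ℝ)
          ≤ r ^ s * r ^ b * (3 * (Sb A s).card / 2 ^ b + 6 * ener J A * C / r ^ s) :=
            mul_le_mul_of_nonneg_left st (by positivity)
        _ = 3 * (r ^ b / 2 ^ b) * (r ^ s * (Sb A s).card) + r ^ b * (6 * ener J A * C) := by
            field_simp
        _ ≤ 3 * (1 / 6) * (r ^ s * (Sb A s).card) + r ^ b * (6 * ener J A * C) := by
            have : 0 ≤ r ^ s * ((Sb A s).card : ℝ) := by positivity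
            nlinarith
        _ ≤ 3 * (1 / 6) * (r ^ b * (1 + 12 * C) * ener J A) + r ^ b * (6 * ener J A * C) := by
            linarith
        _ ≤ _ := by
            have : 0 ≤ r ^ b * ener J A := by positivity
            nlinarith

lemma walls_around {A : Finset ℤ} {x : ℤ} (hx : x ∈ A) :
    (∃ w ∈ walls A, w ≤ x) ∧ (∃ w ∈ walls A, x < w) := by
  constructor
  · obtain ⟨w, hw, h, _⟩ := exists_wall_left hx
    exact ⟨w, hw, h⟩
  · set y := A.max' ⟨x, hx⟩ + 1 with hy
    have hxy : x < y := by have := A.le_max' x hx; omega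
    have hyA : y ∉ A := fun h => by have := A.le_max' y h; omega
    obtain ⟨w, hw, h1, _⟩ := exists_wall (A := A) hxy.le (fun h => hyA (h.1 hx))
    exact ⟨w, hw, h1⟩

/-- coarse graining at scale l -/
def coarse (Λ A : Finset ℤ) (l : ℕ) : Finset ℤ := Λ.filter (fun i => (i / 2 ^ l) * 2 ^ l ∈ A)

lemma coarse_zero (Λ A : Finset ℤ) (h : A ⊆ Λ) : coarse Λ A 0 = A := by
  ext i
  simp only [coarse, Finset.mem_filter, pow_zero, Int.ediv_one, mul_one]
  exact ⟨fun h => h.2, fun hi => ⟨h hi, hi⟩⟩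

lemma coarse_sub (Λ A : Finset ℤ) (l : ℕ) : coarse Λ A l ⊆ Λ := Finset.filter_subset _ _

lemma half_cases (i : ℤ) (l : ℕ) :
    (i / 2 ^ l) * 2 ^ l = (i / 2 ^ (l + 1)) * 2 ^ (l + 1) ∨
    (i / 2 ^ l = 2 * (i / 2 ^ (l + 1)) + 1) := by
  rw [ediv_pow_add, pow_one, pow_succ]
  generalize i / 2 ^ l = v
  rcases Int.emod_two_eq_zero_or_one v with h | h
  · left
    have : v = 2 * (v / 2) := by omega
    rw [mul_comm ((2 : ℤ) ^ l) 2, ← mul_assoc, mul_comm (v / 2) 2, ← this]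
  · right; omega

lemma coarse_coarse (Λ A : Finset ℤ) (hA : A ⊆ Λ) (l : ℕ) :
    coarse Λ (coarse Λ A l) (l + 1) = coarse Λ A (l + 1) := by
  ext i
  simp only [coarse, Finset.mem_filter]
  have e : (i / 2 ^ (l + 1) * 2 ^ (l + 1)) / 2 ^ l * 2 ^ l = i / 2 ^ (l + 1) * 2 ^ (l + 1) := by
    apply Int.ediv_mul_cancel
    exact Dvd.dvd.mul_left (pow_dvd_pow 2 (by omega)) _
  rw [e]
  constructor
  · rintro ⟨h1, h2, h3⟩; exact ⟨h1, h3⟩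
  · rintro ⟨h1, h2⟩; exact ⟨h1, hA h2, h2⟩

lemma odd_ne_mem {A : Finset ℤ} {l : ℕ} {k : ℤ}
    (h : ¬ ((2 * k + 1) * 2 ^ l ∈ A ↔ k * 2 ^ (l + 1) ∈ A)) : k ∈ Sb A (l + 1) := by
  have hp : (0 : ℤ) < 2 ^ l := by positivity
  obtain ⟨w, hw, h1, h2⟩ := exists_wall (A := A) (x := k * 2 ^ (l + 1)) (y := (2 * k + 1) * 2 ^ l)
    (by rw [pow_succ]; nlinarith) (fun hh => h hh.symm)
  rw [Sb, Finset.mem_image]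
  refine ⟨w, hw, ?_⟩
  have hp1 : (0 : ℤ) < 2 ^ (l + 1) := by positivity
  have g1 : k ≤ w / 2 ^ (l + 1) := by rw [Int.le_ediv_iff_mul_le hp1]; exact h1.le
  have g2 : w / 2 ^ (l + 1) < k + 1 := by
    rw [Int.ediv_lt_iff_lt_mul hp1, pow_succ]; nlinarith
  omega

lemma card_block (S Λ : Finset ℤ) (t : ℕ) :
    (Λ.filter (fun i => i / 2 ^ t ∈ S)).card ≤ 2 ^ t * S.card := by
  have hp : (0 : ℤ) < 2 ^ t := by positivity
  have : Λ.filter (fun i => i / 2 ^ t ∈ S) ⊆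
      S.biUnion (fun k => Finset.Ico (k * 2 ^ t) ((k + 1) * 2 ^ t)) := by
    intro i hi
    rw [Finset.mem_filter] at hi
    rw [Finset.mem_biUnion]
    refine ⟨_, hi.2, ?_⟩
    rw [Finset.mem_Ico]
    exact ⟨Int.ediv_mul_le i hp.ne', Int.lt_ediv_add_one_mul_self i hp⟩
  refine (Finset.card_le_card this).trans ?_
  rw [mul_comm]
  apply Finset.card_biUnion_le_card_mul
  intro k _
  rw [Int.card_Ico, show (k + 1) * 2 ^ t - k * 2 ^ t = ((2 ^ t : ℕ) : ℤ) by push_cast; ring,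
    Int.toNat_natCast]

lemma coarse_diff_card (Λ A : Finset ℤ) (l : ℕ) :
    (symmDiff (coarse Λ A l) (coarse Λ A (l + 1))).card ≤ 2 ^ (l + 1) * (Sb A (l + 1)).card := by
  refine le_trans (Finset.card_le_card ?_) (card_block (Sb A (l + 1)) Λ (l + 1))
  intro i hi
  rw [Finset.mem_symmDiff] at hi
  simp only [coarse, Finset.mem_filter] at hi
  rw [Finset.mem_filter]
  refine ⟨by tauto, ?_⟩
  rcases half_cases i l with h | h
  · rw [h] at hi; tauto
  · apply odd_ne_mem (l := l)
    rw [h] at hi; tauto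

/-- reconstruct a finer approximation -/
def refn (Λ X D : Finset ℤ) (l : ℕ) : Finset ℤ :=
  Λ.filter (fun i => ¬ (i ∈ X ↔ (i / 2 ^ l = 2 * (i / 2 ^ (l + 1)) + 1 ∧ i / 2 ^ (l + 1) ∈ D)))

lemma refn_coarse (Λ A : Finset ℤ) (l : ℕ) :
    coarse Λ A l = refn Λ (coarse Λ A (l + 1))
      ((Sb A (l + 1)).filter (fun k => ¬ ((2 * k + 1) * 2 ^ l ∈ A ↔ k * 2 ^ (l + 1) ∈ A))) l := by
  ext i
  simp only [refn, coarse, Finset.mem_filter]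
  by_cases hi : i ∈ Λ
  swap
  · simp [hi]
  rcases half_cases i l with h | h
  · have : ¬ (i / 2 ^ l = 2 * (i / 2 ^ (l + 1)) + 1) := by
      intro h2
      rw [h2, pow_succ] at h
      have hp : (0 : ℤ) < 2 ^ l := by positivity
      nlinarith
    rw [h]; tauto
  · have := @odd_ne_mem A l (i / 2 ^ (l + 1))
    rw [← h] at this
    rw [← h]; tauto

lemma Sb_succ_sub (A : Finset ℤ) (l : ℕ) :
    Sb A l ⊆ (Sb A (l + 1)).biUnion (fun k => {2 * k, 2 * k + 1}) := by
  intro v hv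
  rw [Finset.mem_biUnion]
  refine ⟨v / 2, ?_, ?_⟩
  · rw [Sb_add, Finset.mem_image]; exact ⟨v, hv, by rw [pow_one]⟩
  · simp only [Finset.mem_insert, Finset.mem_singleton]; omega

/-- set of approximations -/
def PP (Λ : Finset ℤ) (G : Finset (Finset ℤ)) (l : ℕ) : Finset (Finset ℤ × Finset ℤ) :=
  G.image (fun A => (coarse Λ A l, Sb A l))

lemma PP_step (Λ : Finset ℤ) (G : Finset (Finset ℤ)) (l : ℕ) (x : ℝ)
    (hx : ∀ A ∈ G, ((Sb A (l + 1)).card : ℝ) ≤ x) :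
    ((PP Λ G l).card : ℝ) ≤ (PP Λ G (l + 1)).card * Real.exp (3 * x) := by
  have hsub : PP Λ G l ⊆ (PP Λ G (l + 1)).biUnion (fun q =>
      (q.2.powerset ×ˢ (q.2.biUnion (fun k => {2 * k, 2 * k + 1})).powerset).image
        (fun d => (refn Λ q.1 d.1 l, d.2))) := by
    intro q hq
    rw [PP, Finset.mem_image] at hq
    obtain ⟨A, hA, rfl⟩ := hq
    rw [Finset.mem_biUnion]
    refine ⟨(coarse Λ A (l + 1), Sb A (l + 1)), Finset.mem_image_of_mem _ hA, ?_⟩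
    rw [Finset.mem_image]
    refine ⟨((Sb A (l + 1)).filter (fun k => ¬ ((2 * k + 1) * 2 ^ l ∈ A ↔ k * 2 ^ (l + 1) ∈ A)),
      Sb A l), ?_, ?_⟩
    · rw [Finset.mem_product]
      exact ⟨Finset.mem_powerset.2 (Finset.filter_subset _ _),
        Finset.mem_powerset.2 (Sb_succ_sub A l)⟩
    · rw [Prod.mk.injEq]; exact ⟨(refn_coarse Λ A l).symm, rfl⟩
  have h1 := (Finset.card_le_card hsub).trans Finset.card_biUnion_le
  calc ((PP Λ G l).card : ℝ) ≤ ∑ q ∈ PP Λ G (l + 1), Real.exp (3 * x) := by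
        have h1r := (Nat.cast_le (α := ℝ)).2 h1
        refine h1r.trans ?_
        push_cast
        apply Finset.sum_le_sum
        intro q hq
        rw [PP, Finset.mem_image] at hq
        obtain ⟨A, hA, rfl⟩ := hq
        have hx' := hx A hA
        dsimp only
        generalize Sb A (l + 1) = S at *
        have c1 : (S.biUnion (fun k : ℤ => ({2 * k, 2 * k + 1} : Finset ℤ))).card ≤ S.card * 2 :=
          Finset.card_biUnion_le_card_mul _ _ _ (fun k _ => Finset.card_le_two)
        have c2 : ((S.powerset ×ˢ (S.biUnion (fun k : ℤ => ({2 * k, 2 * k + 1} : Finset ℤ))).powerset).image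
            (fun d => (refn Λ (coarse Λ A (l + 1)) d.1 l, d.2))).card ≤ 2 ^ (3 * S.card) := by
          refine Finset.card_image_le.trans ?_
          rw [Finset.card_product, Finset.card_powerset, Finset.card_powerset, ← pow_add]
          exact Nat.pow_le_pow_right (by norm_num) (by omega)
        calc _ ≤ (((2 ^ (3 * S.card) : ℕ)) : ℝ) := by exact_mod_cast c2
          _ = (2 : ℝ) ^ (3 * S.card) := by push_cast; rfl
          _ ≤ Real.exp 1 ^ (3 * S.card) := by
              apply pow_le_pow_left₀ (by norm_num)
              have := Real.add_one_le_exp 1; linarith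
          _ = Real.exp (3 * S.card) := by
              rw [← Real.exp_nat_mul]; push_cast; ring_nf
          _ ≤ _ := Real.exp_le_exp.2 (by linarith)
    _ = _ := by rw [Finset.sum_const, nsmul_eq_mul]

lemma Exc_loc {A : Finset ℤ} {T : ℕ} (h0 : (0 : ℤ) ∈ A) (h : Exc A T) :
    Sb A T ⊆ Finset.Icc (-2) 2 ∧ ∀ x ∈ A, x / 2 ^ T ∈ Finset.Icc (-2 : ℤ) 2 := by
  have hp : (0 : ℤ) < 2 ^ T := by positivity
  obtain ⟨k, hk⟩ := h
  obtain ⟨⟨w, hw, hw0⟩, ⟨w', hw', hw0'⟩⟩ := walls_around h0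
  have a1 := (hk w hw).1
  have a2 := (hk w' hw').2
  have b1 : w / 2 ^ T ≤ 0 := by
    have := Int.ediv_le_ediv hp hw0
    simpa using this
  have b2 : 0 ≤ w' / 2 ^ T := Int.ediv_nonneg hw0'.le hp.le
  constructor
  · intro v hv
    obtain ⟨u, hu, rfl⟩ := Finset.mem_image.1 hv
    have := hk u hu
    rw [Finset.mem_Icc]; omega
  · intro x hx
    obtain ⟨⟨y, hy, hyx⟩, ⟨z, hz, hzx⟩⟩ := walls_around hx
    have c1 := (hk y hy).1
    have c2 := (hk z hz).2
    have d1 := Int.ediv_le_ediv hp hyx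
    have d2 := Int.ediv_le_ediv hp hzx.le
    rw [Finset.mem_Icc]; omega

lemma PP_top (Λ : Finset ℤ) (G : Finset (Finset ℤ)) (T : ℕ)
    (hG : ∀ A ∈ G, (0 : ℤ) ∈ A ∧ Exc A T) : (PP Λ G T).card ≤ 2 ^ 10 := by
  have : PP Λ G T ⊆ ((Finset.Icc (-2 : ℤ) 2).powerset ×ˢ (Finset.Icc (-2 : ℤ) 2).powerset).image
      (fun d => (Λ.filter (fun i => i / 2 ^ T ∈ d.1), d.2)) := by
    intro q hq
    rw [PP, Finset.mem_image] at hq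
    obtain ⟨A, hA, rfl⟩ := hq
    obtain ⟨h1, h2⟩ := Exc_loc (hG A hA).1 (hG A hA).2
    rw [Finset.mem_image]
    refine ⟨((Finset.Icc (-2 : ℤ) 2).filter (fun q => q * 2 ^ T ∈ A), Sb A T), ?_, ?_⟩
    · rw [Finset.mem_product]
      exact ⟨Finset.mem_powerset.2 (Finset.filter_subset _ _), Finset.mem_powerset.2 h1⟩
    · rw [Prod.mk.injEq]
      refine ⟨?_, rfl⟩
      ext i
      simp only [coarse, Finset.mem_filter]
      constructor
      · rintro ⟨a, _, b⟩; exact ⟨a, b⟩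
      · rintro ⟨a, b⟩
        refine ⟨a, ?_, b⟩
        have := h2 _ b
        rwa [Int.mul_ediv_cancel _ (by positivity)] at this
  refine (Finset.card_le_card this).trans (Finset.card_image_le.trans ?_)
  rw [Finset.card_product, Finset.card_powerset, Int.card_Icc]
  norm_num [show Int.toNat 5 = 5 from rfl]

lemma coarse_top_card (Λ A : Finset ℤ) (T : ℕ) (h0 : (0 : ℤ) ∈ A) (h : Exc A T) :
    (coarse Λ A T).card ≤ 5 * 2 ^ T := by
  obtain ⟨h1, h2⟩ := Exc_loc h0 h
  have : coarse Λ A T ⊆ Λ.filter (fun i => i / 2 ^ T ∈ Finset.Icc (-2 : ℤ) 2) := by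
    intro i hi
    rw [coarse, Finset.mem_filter] at hi
    rw [Finset.mem_filter]
    refine ⟨hi.1, ?_⟩
    have := h2 _ hi.2
    rwa [Int.mul_ediv_cancel _ (by positivity)] at this
  refine (Finset.card_le_card this).trans ((card_block _ _ _).trans ?_)
  rw [Int.card_Icc]
  norm_num [show Int.toNat 5 = 5 from rfl]
  omega

/-- the contours around the origin of energy about m -/
def GG (J : ℤ → ℝ) (K ρ : ℝ) (Λ : Finset ℤ) (m : ℕ) : Finset (Finset ℤ) :=
  Λ.powerset.filter (fun A => Irr J K ρ Λ A ∧ (0 : ℤ) ∈ A ∧ ⌊ener J A⌋₊ = m)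

set_option maxHeartbeats 1000000 in
lemma counting {α ρ K : ℝ} (hK : KF α ρ K) (ha1 : α < 1) : ∃ C : ℝ, 1 ≤ C ∧
    ∀ (J₁ : ℝ) (J : ℤ → ℝ), JF α J₁ J → ∀ Λ : Finset ℤ,
    (∀ x ∈ Λ, ∀ y ∈ Λ, ∀ z, x ≤ z → z ≤ y → z ∈ Λ) → ∀ m : ℕ, 1 ≤ m →
    ∃ (T : ℕ) (c : ℕ → Finset ℤ → Finset ℤ), ((2 : ℝ) ^ ρ) ^ T ≤ C * m ∧
      (∀ l A, c l A ⊆ Λ) ∧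
      (∀ A ∈ GG J K ρ Λ m, c 0 A = A ∧ c (T + 1) A = ∅) ∧
      (∀ A ∈ GG J K ρ Λ m, ∀ l ≤ T, ((symmDiff (c l A) (c (l + 1) A)).card : ℝ) ≤
        C * m * (2 / (2 : ℝ) ^ ρ) ^ l) ∧
      (∀ l ≤ T, (((GG J K ρ Λ m).image (fun A => (c l A, c (l + 1) A))).card : ℝ) ≤
        Real.exp (C * m / ((2 : ℝ) ^ ρ) ^ l)) := by
  have hr1 := hK.h1
  have hr2 := hK.h2
  obtain ⟨C1, hC1, hn⟩ := n_bound hK ha1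
  set r := (2 : ℝ) ^ ρ with hr
  have hr0 : 1 < r := Real.one_lt_rpow (by norm_num) (by linarith)
  have hrlt : r < 2 := by
    calc r < (2 : ℝ) ^ (1 : ℝ) := Real.rpow_lt_rpow_of_exponent_lt (by norm_num) (by linarith)
      _ = 2 := by norm_num
  have hrr : 0 < r - 1 := by linarith
  set C := 40 * C1 + 36 * C1 / (r - 1) with hC
  have hCp : 0 ≤ 36 * C1 / (r - 1) := by positivity
  have hC40 : 40 * C1 ≤ C := by linarith
  have hCr : C + 36 * C1 ≤ C * r := by
    have : 36 * C1 = 36 * C1 / (r - 1) * (r - 1) := by field_simp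
    nlinarith
  refine ⟨C, by linarith, ?_⟩
  intro J₁ J hJ Λ hΛ m hm
  have hmr : (1 : ℝ) ≤ m := by exact_mod_cast hm
  have hC1m : 1 ≤ C1 * (m + 1) := by nlinarith
  obtain ⟨T, hT1, hT2⟩ : ∃ T : ℕ, C1 * (m + 1) < r ^ T ∧ r ^ T ≤ 2 * C1 * (m + 1) := by
    have hex : ∃ T : ℕ, C1 * (m + 1) < r ^ T := pow_unbounded_of_one_lt _ hr0
    refine ⟨Nat.find hex, Nat.find_spec hex, ?_⟩
    rcases Nat.eq_zero_or_pos (Nat.find hex) with h | h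
    · rw [h, pow_zero]; linarith
    · have := Nat.find_min hex (m := Nat.find hex - 1) (by omega)
      push Not at this
      obtain ⟨k, hk⟩ : ∃ k, Nat.find hex = k + 1 := ⟨Nat.find hex - 1, by omega⟩
      rw [hk, pow_succ]
      rw [hk, Nat.add_sub_cancel] at this
      have : 0 < r ^ k := by positivity
      nlinarith
  set G := GG J K ρ Λ m with hG
  have hGm : ∀ A ∈ G, A ⊆ Λ ∧ Irr J K ρ Λ A ∧ (0 : ℤ) ∈ A ∧ ener J A < m + 1 := by
    intro A hA
    rw [hG, GG, Finset.mem_filter, Finset.mem_powerset] at hA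
    refine ⟨hA.1, hA.2.1, hA.2.2.1, ?_⟩
    have := Nat.lt_floor_add_one (ener J A)
    rwa [hA.2.2.2] at this
  have hSpos : ∀ A ∈ G, ∀ t, 1 ≤ (Sb A t).card := by
    intro A hA t
    obtain ⟨⟨w, hw, _⟩, _⟩ := walls_around (hGm A hA).2.2.1
    exact Finset.card_pos.2 ⟨_, Finset.mem_image_of_mem _ hw⟩
  have hExc : ∀ A ∈ G, Exc A T := by
    intro A hA
    by_contra hc
    have h1 := hn J₁ J hJ Λ A hΛ (hGm A hA).2.1 T hc
    have h2 := (hGm A hA).2.2.2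
    have h3 : (1 : ℝ) ≤ (Sb A T).card := by exact_mod_cast hSpos A hA T
    have h4 : 0 < r ^ T := by positivity
    nlinarith
  have hnb : ∀ A ∈ G, ∀ t ≤ T, r ^ t * ((Sb A t).card : ℝ) ≤ 12 * C1 * m := by
    intro A hA t ht
    by_cases hc : Exc A t
    · have h3 : (Sb A t).card ≤ 3 := by
        obtain ⟨k, hk⟩ := hc
        have : Sb A t ⊆ Finset.Icc (k - 1) (k + 1) := by
          intro v hv
          obtain ⟨u, hu, rfl⟩ := Finset.mem_image.1 hv
          rw [Finset.mem_Icc]; exact hk u hu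
        refine (Finset.card_le_card this).trans ?_
        rw [Int.card_Icc]; omega
      have h3' : ((Sb A t).card : ℝ) ≤ 3 := by exact_mod_cast h3
      have h4 : r ^ t ≤ r ^ T := pow_le_pow_right₀ hr0.le ht
      have h5 : 0 < r ^ t := by positivity
      calc r ^ t * ((Sb A t).card : ℝ) ≤ (2 * C1 * (m + 1)) * 3 :=
            mul_le_mul (h4.trans hT2) h3' (by positivity) (by positivity)
        _ ≤ _ := by nlinarith
    · have h1 := hn J₁ J hJ Λ A hΛ (hGm A hA).2.1 t hc
      have h2 := (hGm A hA).2.2.2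
      nlinarith
  have hTC : r ^ T ≤ 4 * C1 * m := by nlinarith
  have hcount : ∀ l ≤ T, ((PP Λ G l).card : ℝ) ≤ Real.exp (C * m / r ^ l) := by
    intro l hl
    obtain ⟨d, rfl⟩ : ∃ d, T = l + d := ⟨T - l, by omega⟩
    clear hl
    have main : ∀ d' ≤ l + d, ((PP Λ G (l + d - d')).card : ℝ) ≤ Real.exp (C * m / r ^ (l + d - d')) := by
      intro d'
      induction d' with
      | zero =>
        intro _
        rw [Nat.sub_zero]
        have h1 := PP_top Λ G (l + d) (fun A hA => ⟨(hGm A hA).2.2.1, hExc A hA⟩)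
        calc ((PP Λ G (l + d)).card : ℝ) ≤ ((2 ^ 10 : ℕ) : ℝ) := by exact_mod_cast h1
          _ = (2 : ℝ) ^ 10 := by norm_num
          _ ≤ Real.exp 1 ^ 10 := by
              apply pow_le_pow_left₀ (by norm_num)
              have := Real.add_one_le_exp 1; linarith
          _ = Real.exp 10 := by rw [← Real.exp_nat_mul]; norm_num
          _ ≤ _ := by
              apply Real.exp_le_exp.2
              rw [le_div_iff₀ (by positivity)]
              nlinarith
      | succ e ih =>
        intro he
        have ih' := ih (by omega)
        obtain ⟨j, hj⟩ : ∃ j, l + d - e = j + 1 := ⟨l + d - e - 1, by omega⟩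
        rw [show l + d - (e + 1) = j by omega]
        rw [hj] at ih'
        have hp : 0 < r ^ j := by positivity
        have st := PP_step Λ G j (12 * C1 * m / r ^ (j + 1)) (by
          intro A hA
          rw [le_div_iff₀ (by positivity), mul_comm]
          exact hnb A hA (j + 1) (by omega))
        refine st.trans ((mul_le_mul_of_nonneg_right ih' (Real.exp_pos _).le).trans ?_)
        rw [← Real.exp_add]
        apply Real.exp_le_exp.2
        rw [pow_succ, show C * m / (r ^ j * r) + 3 * (12 * C1 * m / (r ^ j * r)) =
          ((C + 36 * C1) * m) / (r ^ j * r) by field_simp; ring, div_le_div_iff₀ (by positivity) hp]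
        have : (C + 36 * C1) * (m * r ^ j) ≤ (C * r) * (m * r ^ j) :=
          mul_le_mul_of_nonneg_right hCr (by positivity)
        nlinarith
    have := main d (by omega)
    rwa [Nat.add_sub_cancel] at this
  refine ⟨T, fun l A => if l ≤ T then coarse Λ A l else ∅, by nlinarith, ?_, ?_, ?_, ?_⟩
  · intro l A
    dsimp only
    split_ifs
    · exact coarse_sub _ _ _
    · exact Finset.empty_subset _
  · intro A hA
    dsimp only
    constructor
    · rw [if_pos (Nat.zero_le _)]; exact coarse_zero _ _ (hGm A hA).1
    · rw [if_neg (by omega)]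
  · intro A hA l hl
    dsimp only
    rw [if_pos hl]
    have hpow : (2 / r) ^ l = 2 ^ l / r ^ l := div_pow _ _ _
    have hp : 0 < r ^ l := by positivity
    rw [hpow]
    by_cases hl2 : l + 1 ≤ T
    · rw [if_pos hl2]
      have h1 := coarse_diff_card Λ A l
      have h2 := hnb A hA (l + 1) hl2
      have h1' : ((symmDiff (coarse Λ A l) (coarse Λ A (l + 1))).card : ℝ) ≤
        2 ^ (l + 1) * (Sb A (l + 1)).card := by exact_mod_cast h1
      refine h1'.trans ?_
      rw [← mul_div_assoc, le_div_iff₀ hp]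
      rw [pow_succ] at h2
      have h3 : r ^ l * ((Sb A (l + 1)).card : ℝ) ≤ 12 * C1 * m := by
        have : 0 ≤ r ^ l * ((Sb A (l + 1)).card : ℝ) := by positivity
        nlinarith
      calc (2 : ℝ) ^ (l + 1) * (Sb A (l + 1)).card * r ^ l
          = 2 * 2 ^ l * (r ^ l * ((Sb A (l + 1)).card : ℝ)) := by rw [pow_succ]; ring
        _ ≤ 2 * 2 ^ l * (12 * C1 * m) := mul_le_mul_of_nonneg_left h3 (by positivity)
        _ = 24 * C1 * m * 2 ^ l := by ring
        _ ≤ C * m * 2 ^ l := by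
            apply mul_le_mul_of_nonneg_right _ (by positivity)
            apply mul_le_mul_of_nonneg_right _ (by positivity)
            linarith
    · rw [if_neg hl2]
      have hlT : l = T := by omega
      subst hlT
      have h1 := coarse_top_card Λ A l (hGm A hA).2.2.1 (hExc A hA)
      rw [← Finset.bot_eq_empty, symmDiff_bot]
      have h1' : ((coarse Λ A l).card : ℝ) ≤ 5 * 2 ^ l := by exact_mod_cast h1
      refine h1'.trans ?_
      rw [← mul_div_assoc, le_div_iff₀ hp]
      have h2 : (0 : ℝ) < 2 ^ l := by positivity
      calc (5 : ℝ) * 2 ^ l * r ^ l ≤ 5 * 2 ^ l * (4 * C1 * m) :=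
            mul_le_mul_of_nonneg_left hTC (by positivity)
        _ = 20 * C1 * m * 2 ^ l := by ring
        _ ≤ C * m * 2 ^ l := by
            apply mul_le_mul_of_nonneg_right _ (by positivity)
            apply mul_le_mul_of_nonneg_right _ (by positivity)
            linarith
  · intro l hl
    refine le_trans ?_ (hcount l hl)
    have : G.image (fun A => (if l ≤ T then coarse Λ A l else ∅,
        if l + 1 ≤ T then coarse Λ A (l + 1) else ∅)) =
      (PP Λ G l).image (fun q => (q.1, if l + 1 ≤ T then coarse Λ q.1 (l + 1) else ∅)) := by
      rw [PP, Finset.image_image]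
      apply Finset.image_congr
      intro A hA
      simp only [Function.comp, if_pos hl]
      rw [coarse_coarse Λ A (hGm A hA).1]
    rw [this]
    exact_mod_cast Finset.card_image_le

lemma symm_cancel (P B : Finset ℤ) : symmDiff (symmDiff P B) B = P := by
  rw [symmDiff_assoc, symmDiff_self, symmDiff_bot]

lemma symm_sub {Λ P B : Finset ℤ} (hP : P ⊆ Λ) (hB : B ⊆ Λ) : symmDiff P B ⊆ Λ := by
  intro x hx
  rw [Finset.mem_symmDiff] at hx
  rcases hx with h | h
  · exact hP h.1
  · exact hB h.1

lemma sum_flip (Λ B : Finset ℤ) (hB : B ⊆ Λ) (f : Finset ℤ → ℝ) :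
    ∑ P ∈ Λ.powerset, f (symmDiff P B) = ∑ P ∈ Λ.powerset, f P := by
  apply Finset.sum_nbij' (fun P => symmDiff P B) (fun P => symmDiff P B)
  · intro P hP
    rw [Finset.mem_powerset] at *
    exact symm_sub hP hB
  · intro P hP
    rw [Finset.mem_powerset] at *
    exact symm_sub hP hB
  · intro P _; exact symm_cancel P B
  · intro P _; exact symm_cancel P B
  · intro P _; rfl

lemma flip_mgf (Λ : Finset ℤ) (c : ℝ) (D : Finset ℤ) : D ⊆ Λ → ∀ F : Finset ℤ → ℝ,
    (∀ i ∈ D, ∀ P, |F (symmDiff P {i}) - F P| ≤ 2 * c) →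
    ∑ P ∈ Λ.powerset, Real.exp (F (symmDiff P D) - F P) ≤
      2 ^ Λ.card * Real.exp (2 * c ^ 2 * D.card) := by
  induction D using Finset.induction_on with
  | empty =>
    intro _ F _
    have : ∀ P : Finset ℤ, symmDiff P ∅ = P := fun P => symmDiff_bot P
    simp [this]
  | insert i D hi ih =>
    intro hD F hF
    have hiΛ : i ∈ Λ := hD (Finset.mem_insert_self _ _)
    have hsing : ({i} : Finset ℤ) ⊆ Λ := by simpa using hiΛ
    have hDΛ : D ⊆ Λ := fun x hx => hD (Finset.mem_insert_of_mem hx)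
    have hins : ∀ P : Finset ℤ, symmDiff P (insert i D) = symmDiff (symmDiff P D) {i} := by
      intro P
      have : insert i D = symmDiff D {i} := by
        ext x
        simp only [Finset.mem_insert, Finset.mem_symmDiff, Finset.mem_singleton]
        by_cases hx : x = i
        · subst hx; simp [hi]
        · simp [hx]
      rw [this, symmDiff_assoc]
    have hcomm : ∀ P B : Finset ℤ, symmDiff (symmDiff P B) {i} = symmDiff (symmDiff P {i}) B :=
      fun P B => symmDiff_right_comm _ _ _
    set F1 : Finset ℤ → ℝ := fun P => (F P + F (symmDiff P {i})) / 2 with hF1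
    set d : Finset ℤ → ℝ := fun P => (F P - F (symmDiff P {i})) / 2 with hd
    have hF1i : ∀ P, F1 (symmDiff P {i}) = F1 P := by
      intro P; simp only [hF1, symm_cancel]; ring
    have hdi : ∀ P, d (symmDiff P {i}) = - d P := by
      intro P; simp only [hd, symm_cancel]; ring
    have hdb : ∀ P, |d P| ≤ c := by
      intro P
      have := hF i (Finset.mem_insert_self _ _) P
      rw [abs_le] at this ⊢
      simp only [hd]
      constructor <;> linarith [this.1, this.2]
    have hFd : ∀ P, F P = F1 P + d P := by intro P; simp only [hF1, hd]; ring
    have ih' := ih hDΛ F1 (by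
      intro j hj P
      have h1 := hF j (Finset.mem_insert_of_mem hj) P
      have h2 := hF j (Finset.mem_insert_of_mem hj) (symmDiff P {i})
      rw [← hcomm] at h2
      rw [abs_le] at h1 h2 ⊢
      simp only [hF1]
      constructor <;> linarith [h1.1, h1.2, h2.1, h2.2])
    set G1 : Finset ℤ → ℝ := fun P => F1 (symmDiff P D) - F1 P with hG1
    set e : Finset ℤ → ℝ := fun P => d (symmDiff P D) + d P with he
    have hG1i : ∀ P, G1 (symmDiff P {i}) = G1 P := by
      intro P; simp only [hG1]; rw [← hcomm, hF1i, hF1i]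
    have hei : ∀ P, e (symmDiff P {i}) = - e P := by
      intro P; simp only [he]; rw [← hcomm, hdi, hdi]; ring
    have heb : ∀ P, |e P| ≤ 2 * c := by
      intro P
      have := abs_add_le (d (symmDiff P D)) (d P)
      simp only [he]; linarith [hdb P, hdb (symmDiff P D)]
    have hmain : ∀ P, F (symmDiff P (insert i D)) - F P = G1 P - e P := by
      intro P
      rw [hins, hFd (symmDiff (symmDiff P D) {i}), hFd P, hF1i, hdi]
      simp only [hG1, he]; ring
    have e1 : ∑ P ∈ Λ.powerset, Real.exp (F (symmDiff P (insert i D)) - F P) =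
        ∑ P ∈ Λ.powerset, Real.exp (G1 P - e P) :=
      Finset.sum_congr rfl (fun P _ => by rw [hmain])
    have e2 : ∑ P ∈ Λ.powerset, Real.exp (G1 P - e P) = ∑ P ∈ Λ.powerset, Real.exp (G1 P + e P) := by
      rw [← sum_flip Λ {i} hsing (fun P => Real.exp (G1 P - e P))]
      apply Finset.sum_congr rfl
      intro P _
      rw [hG1i, hei, sub_neg_eq_add]
    have e3 : ∑ P ∈ Λ.powerset, Real.exp (G1 P - e P) =
        ∑ P ∈ Λ.powerset, Real.exp (G1 P) * Real.cosh (e P) := by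
      have : 2 * ∑ P ∈ Λ.powerset, Real.exp (G1 P - e P) =
          2 * ∑ P ∈ Λ.powerset, Real.exp (G1 P) * Real.cosh (e P) := by
        rw [two_mul]
        nth_rewrite 2 [e2]
        rw [← Finset.sum_add_distrib, Finset.mul_sum]
        apply Finset.sum_congr rfl
        intro P _
        rw [Real.cosh_eq, sub_eq_add_neg, Real.exp_add, Real.exp_add]; ring
      linarith
    have hcosh : ∀ P, Real.cosh (e P) ≤ Real.exp (2 * c ^ 2) := by
      intro P
      refine (Real.cosh_le_exp_half_sq _).trans (Real.exp_le_exp.2 ?_)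
      have h1 := heb P
      have h2 : (e P) ^ 2 ≤ (2 * c) ^ 2 := by
        rw [← sq_abs]
        exact pow_le_pow_left₀ (abs_nonneg _) h1 2
      nlinarith
    rw [e1, e3]
    calc ∑ P ∈ Λ.powerset, Real.exp (G1 P) * Real.cosh (e P)
        ≤ ∑ P ∈ Λ.powerset, Real.exp (G1 P) * Real.exp (2 * c ^ 2) :=
          Finset.sum_le_sum (fun P _ => mul_le_mul_of_nonneg_left (hcosh P) (Real.exp_pos _).le)
      _ = (∑ P ∈ Λ.powerset, Real.exp (G1 P)) * Real.exp (2 * c ^ 2) := by rw [Finset.sum_mul]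
      _ ≤ (2 ^ Λ.card * Real.exp (2 * c ^ 2 * D.card)) * Real.exp (2 * c ^ 2) :=
          mul_le_mul_of_nonneg_right ih' (Real.exp_pos _).le
      _ = _ := by
          rw [mul_assoc, ← Real.exp_add, Finset.card_insert_of_notMem hi]
          push_cast; ring_nf

lemma flip_tail (Λ : Finset ℤ) (c : ℝ) (hc : 0 < c) (F : Finset ℤ → ℝ)
    (hF : ∀ i P, |F (symmDiff P {i}) - F P| ≤ 2 * c) (B B' : Finset ℤ) (hB : B ⊆ Λ) (hB' : B' ⊆ Λ)
    (V u : ℝ) (hV : 0 < V) (hu : 0 < u) (hBV : ((symmDiff B B').card : ℝ) ≤ V) :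
    ((Λ.powerset.filter (fun P => u ≤ F (symmDiff P B) - F (symmDiff P B'))).card : ℝ) ≤
      2 ^ Λ.card * Real.exp (-(u ^ 2 / (8 * c ^ 2 * V))) := by
  set t := u / (4 * c ^ 2 * V) with ht
  have ht0 : 0 < t := by positivity
  have h1 := flip_mgf Λ (t * c) (symmDiff B B') (symm_sub hB hB') (fun P => t * F P) (by
    intro i _ P
    rw [← mul_sub, abs_mul, abs_of_pos ht0]
    have := mul_le_mul_of_nonneg_left (hF i P) ht0.le
    linarith)
  have h2 : ∑ P ∈ Λ.powerset, Real.exp (t * F (symmDiff P (symmDiff B B')) - t * F P) =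
      ∑ P ∈ Λ.powerset, Real.exp (t * (F (symmDiff P B) - F (symmDiff P B'))) := by
    rw [← sum_flip Λ B' hB' (fun P => Real.exp (t * F (symmDiff P (symmDiff B B')) - t * F P))]
    apply Finset.sum_congr rfl
    intro P _
    have : symmDiff (symmDiff P B') (symmDiff B B') = symmDiff P B := by
      rw [symmDiff_comm B B', ← symmDiff_assoc, symm_cancel]
    rw [this, mul_sub]
  rw [h2] at h1
  set N := Λ.powerset.filter (fun P => u ≤ F (symmDiff P B) - F (symmDiff P B')) with hN
  have h3 : (N.card : ℝ) * Real.exp (t * u) ≤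
      ∑ P ∈ Λ.powerset, Real.exp (t * (F (symmDiff P B) - F (symmDiff P B'))) := by
    calc (N.card : ℝ) * Real.exp (t * u) = ∑ P ∈ N, Real.exp (t * u) := by simp
      _ ≤ ∑ P ∈ N, Real.exp (t * (F (symmDiff P B) - F (symmDiff P B'))) := by
          apply Finset.sum_le_sum
          intro P hP
          rw [hN, Finset.mem_filter] at hP
          exact Real.exp_le_exp.2 (mul_le_mul_of_nonneg_left hP.2 ht0.le)
      _ ≤ _ := Finset.sum_le_sum_of_subset_of_nonneg (Finset.filter_subset _ _)
          (fun _ _ _ => (Real.exp_pos _).le)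
  have h4 : Real.exp (2 * (t * c) ^ 2 * ((symmDiff B B').card : ℝ)) ≤
      Real.exp (2 * (t * c) ^ 2 * V) :=
    Real.exp_le_exp.2 (mul_le_mul_of_nonneg_left hBV (by positivity))
  have h5 : (N.card : ℝ) * Real.exp (t * u) ≤ 2 ^ Λ.card * Real.exp (2 * (t * c) ^ 2 * V) :=
    h3.trans (h1.trans (mul_le_mul_of_nonneg_left h4 (by positivity)))
  have e : Real.exp (2 * (t * c) ^ 2 * V) =
      Real.exp (-(u ^ 2 / (8 * c ^ 2 * V))) * Real.exp (t * u) := by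
    rw [← Real.exp_add]
    congr 1
    rw [ht]; field_simp; ring
  rw [e, ← mul_assoc] at h5
  exact le_of_mul_le_mul_right h5 (Real.exp_pos _)

/-- Boltzmann weight: M minus set, P set of minus fields -/
def wt (J : ℤ → ℝ) (β θ : ℝ) (M P : Finset ℤ) : ℝ :=
  Real.exp (-(2 * β * (ener J M + θ * ((symmDiff M P).card : ℝ))))

/-- partition function -/
def ZZ (J : ℤ → ℝ) (β θ : ℝ) (Λ P : Finset ℤ) : ℝ := ∑ M ∈ Λ.powerset, wt J β θ M P

lemma wt_pos (J : ℤ → ℝ) (β θ : ℝ) (M P : Finset ℤ) : 0 < wt J β θ M P := Real.exp_pos _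

lemma ZZ_pos (J : ℤ → ℝ) (β θ : ℝ) (Λ P : Finset ℤ) : 0 < ZZ J β θ Λ P :=
  Finset.sum_pos (fun M _ => wt_pos J β θ M P) ⟨∅, Finset.empty_mem_powerset _⟩

lemma ZZ_flip_le (J : ℤ → ℝ) (β θ : ℝ) (hβ : 0 < β) (hθ : 0 < θ) (Λ P : Finset ℤ) (i : ℤ) :
    ZZ J β θ Λ P ≤ Real.exp (2 * (β * θ)) * ZZ J β θ Λ (symmDiff P {i}) := by
  rw [ZZ, ZZ, Finset.mul_sum]
  apply Finset.sum_le_sum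
  intro M _
  rw [wt, wt, ← Real.exp_add]
  apply Real.exp_le_exp.2
  have hsub : symmDiff M (symmDiff P {i}) ⊆ insert i (symmDiff M P) := by
    intro x
    simp only [Finset.mem_symmDiff, Finset.mem_insert, Finset.mem_singleton]
    tauto
  have h := (Finset.card_le_card hsub).trans (Finset.card_insert_le _ _)
  have h' : ((symmDiff M (symmDiff P {i})).card : ℝ) ≤ (symmDiff M P).card + 1 := by exact_mod_cast h
  have : 0 < β * θ := by positivity
  nlinarith

lemma logZ_flip (J : ℤ → ℝ) (β θ : ℝ) (hβ : 0 < β) (hθ : 0 < θ) (Λ : Finset ℤ) (i : ℤ)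
    (P : Finset ℤ) :
    |Real.log (ZZ J β θ Λ (symmDiff P {i})) - Real.log (ZZ J β θ Λ P)| ≤ 2 * (β * θ) := by
  have key : ∀ P, Real.log (ZZ J β θ Λ P) ≤ 2 * (β * θ) + Real.log (ZZ J β θ Λ (symmDiff P {i})) := by
    intro P
    rw [← Real.log_exp (2 * (β * θ)), ← Real.log_mul (Real.exp_pos _).ne' (ZZ_pos _ _ _ _ _).ne']
    exact Real.log_le_log (ZZ_pos _ _ _ _ _) (ZZ_flip_le J β θ hβ hθ Λ P i)
  have h1 := key P
  have h2 := key (symmDiff P {i})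
  rw [symm_cancel] at h2
  rw [abs_le]; constructor <;> linarith

lemma logZ_tail (J : ℤ → ℝ) (β θ : ℝ) (hβ : 0 < β) (hθ : 0 < θ) (Λ : Finset ℤ)
    (B B' : Finset ℤ) (hB : B ⊆ Λ) (hB' : B' ⊆ Λ)
    (V u : ℝ) (hV : 0 < V) (hu : 0 < u) (hBV : ((symmDiff B B').card : ℝ) ≤ V) :
    ((Λ.powerset.filter (fun P => u ≤ Real.log (ZZ J β θ Λ (symmDiff P B)) -
        Real.log (ZZ J β θ Λ (symmDiff P B')))).card : ℝ) ≤
      2 ^ Λ.card * Real.exp (-(u ^ 2 / (8 * (β * θ) ^ 2 * V))) :=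
  flip_tail Λ (β * θ) (by positivity) (fun P => Real.log (ZZ J β θ Λ P))
    (fun i P => logZ_flip J β θ hβ hθ Λ i P) B B' hB hB' V u hV hu hBV

/-- probability that the origin is minus -/
def qq (J : ℤ → ℝ) (β θ : ℝ) (Λ P : Finset ℤ) : ℝ :=
  (∑ M ∈ Λ.powerset.filter (fun M => (0 : ℤ) ∈ M), wt J β θ M P) / ZZ J β θ Λ P

lemma qq_nonneg (J : ℤ → ℝ) (β θ : ℝ) (Λ P : Finset ℤ) : 0 ≤ qq J β θ Λ P :=
  div_nonneg (Finset.sum_nonneg (fun M _ => (wt_pos J β θ M P).le)) (ZZ_pos _ _ _ _ _).le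

lemma qq_le_one (J : ℤ → ℝ) (β θ : ℝ) (Λ P : Finset ℤ) : qq J β θ Λ P ≤ 1 := by
  rw [qq, div_le_one (ZZ_pos _ _ _ _ _)]
  exact Finset.sum_le_sum_of_subset_of_nonneg (Finset.filter_subset _ _)
    (fun M _ _ => (wt_pos J β θ M P).le)

/-- contours containing the origin -/
def G0 (J : ℤ → ℝ) (K ρ : ℝ) (Λ : Finset ℤ) : Finset (Finset ℤ) :=
  Λ.powerset.filter (fun A => Irr J K ρ Λ A ∧ (0 : ℤ) ∈ A)

lemma peierls {α J₁ ρ K : ℝ} {J : ℤ → ℝ} (hJ : JF α J₁ J) (hK : KF α ρ K) (Λ P : Finset ℤ)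
    (β θ : ℝ) (hβ : 0 < β) :
    qq J β θ Λ P ≤ ∑ A ∈ G0 J K ρ Λ,
      Real.exp (-(β * ener J A)) * (ZZ J β θ Λ (symmDiff P A) / ZZ J β θ Λ P) := by
  have hZ := ZZ_pos J β θ Λ P
  have : ∀ A ∈ G0 J K ρ Λ, Real.exp (-(β * ener J A)) * (ZZ J β θ Λ (symmDiff P A) / ZZ J β θ Λ P) =
      (Real.exp (-(β * ener J A)) * ZZ J β θ Λ (symmDiff P A)) / ZZ J β θ Λ P :=
    fun A _ => by rw [mul_div_assoc]
  rw [qq, Finset.sum_congr rfl this, ← Finset.sum_div]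
  apply div_le_div_of_nonneg_right _ hZ.le
  have hex : ∀ M ∈ Λ.powerset.filter (fun M => (0 : ℤ) ∈ M), wt J β θ M P ≤
      ∑ A ∈ G0 J K ρ Λ, Real.exp (-(β * ener J A)) * wt J β θ (symmDiff M A) (symmDiff P A) := by
    intro M hM
    rw [Finset.mem_filter, Finset.mem_powerset] at hM
    obtain ⟨A, hA, h0, hE⟩ := decomposition hJ hK Λ M hM.1 0 hM.2
    have hmem : A ∈ G0 J K ρ Λ := by
      rw [G0, Finset.mem_filter, Finset.mem_powerset]; exact ⟨hA.1, hA, h0⟩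
    refine le_trans ?_ (Finset.single_le_sum (f := fun A => Real.exp (-(β * ener J A)) *
      wt J β θ (symmDiff M A) (symmDiff P A))
      (fun A _ => mul_nonneg (Real.exp_pos _).le (wt_pos _ _ _ _ _).le) hmem)
    have e : symmDiff (symmDiff M A) (symmDiff P A) = symmDiff M P := by
      rw [symmDiff_comm P A, ← symmDiff_assoc, symm_cancel]
    rw [wt, wt, e, ← Real.exp_add]
    apply Real.exp_le_exp.2
    nlinarith
  refine (Finset.sum_le_sum hex).trans ?_
  rw [Finset.sum_comm]
  apply Finset.sum_le_sum
  intro A hA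
  rw [← Finset.mul_sum]
  apply mul_le_mul_of_nonneg_left _ (Real.exp_pos _).le
  rw [G0, Finset.mem_filter, Finset.mem_powerset] at hA
  rw [ZZ, ← sum_flip Λ A hA.1]
  exact Finset.sum_le_sum_of_subset_of_nonneg (Finset.filter_subset _ _)
    (fun M _ _ => (wt_pos _ _ _ _ _).le)

set_option maxHeartbeats 1000000 in
lemma bad_card (J : ℤ → ℝ) (β θ : ℝ) (hβ : 0 < β) (hθ : 0 < θ) (Λ : Finset ℤ)
    (G : Finset (Finset ℤ)) (T : ℕ) (c : ℕ → Finset ℤ → Finset ℤ) (C r η ξ : ℝ) (m : ℕ) (hm : 1 ≤ m)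
    (hC : 1 ≤ C) (hr : 0 < r) (hη : 0 < η) (hη1 : η < 1) (hξ : ξ = η ^ 2 * (r / 2))
    (hξr : 1 / r ≤ ξ) (hξ1 : ξ ≤ 1) (hθ2 : 2 * C * θ ^ 2 ≤ ((1 - η) / 2) ^ 2 / (8 * C))
    (hsub : ∀ l A, c l A ⊆ Λ) (hends : ∀ A ∈ G, c 0 A = A ∧ c (T + 1) A = ∅)
    (hdiff : ∀ A ∈ G, ∀ l ≤ T, ((symmDiff (c l A) (c (l + 1) A)).card : ℝ) ≤ C * m * (2 / r) ^ l)
    (hcnt : ∀ l ≤ T, ((G.image (fun A => (c l A, c (l + 1) A))).card : ℝ) ≤ Real.exp (C * m / r ^ l)) :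
    ((Λ.powerset.filter (fun P => ¬ ∀ A ∈ G, Real.log (ZZ J β θ Λ (symmDiff P A)) -
      Real.log (ZZ J β θ Λ P) ≤ β * m / 2)).card : ℝ) ≤
      2 ^ Λ.card * ((T + 1) * Real.exp (-(((1 - η) / 2) ^ 2 / (16 * C) * (m * ξ ^ T) / θ ^ 2))) := by
  have hmr : (1 : ℝ) ≤ m := by exact_mod_cast hm
  have hξ0 : 0 < ξ := by rw [hξ]; positivity
  set ε := (1 - η) / 2 with hε
  have hε0 : 0 < ε := by rw [hε]; linarith
  set u : ℕ → ℝ := fun l => β * ε * η ^ l * m with hu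
  have hu0 : ∀ l, 0 < u l := by intro l; simp only [hu]; positivity
  set F : Finset ℤ → ℝ := fun P => Real.log (ZZ J β θ Λ P) with hF
  set I : ℕ → Finset (Finset ℤ × Finset ℤ) := fun l => G.image (fun A => (c l A, c (l + 1) A)) with hI
  set E : ℕ → Finset ℤ × Finset ℤ → Finset (Finset ℤ) := fun l q =>
    Λ.powerset.filter (fun P => u l ≤ F (symmDiff P q.1) - F (symmDiff P q.2)) with hE
  have hsubset : Λ.powerset.filter (fun P => ¬ ∀ A ∈ G, F (symmDiff P A) - F P ≤ β * m / 2) ⊆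
      (Finset.range (T + 1)).biUnion (fun l => (I l).biUnion (E l)) := by
    intro P hP
    rw [Finset.mem_filter] at hP
    by_contra hc
    apply hP.2
    intro A hA
    have hlt : ∀ l ∈ Finset.range (T + 1), F (symmDiff P (c l A)) - F (symmDiff P (c (l + 1) A)) ≤ u l := by
      intro l hl
      by_contra hcc
      push Not at hcc
      apply hc
      rw [Finset.mem_biUnion]
      refine ⟨l, hl, ?_⟩
      rw [Finset.mem_biUnion]
      refine ⟨(c l A, c (l + 1) A), Finset.mem_image_of_mem _ hA, ?_⟩
      rw [hE, Finset.mem_filter]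
      exact ⟨hP.1, hcc.le⟩
    have h1 := Finset.sum_le_sum hlt
    rw [Finset.sum_range_sub' (fun l => F (symmDiff P (c l A))), (hends A hA).1, (hends A hA).2] at h1
    have e0 : symmDiff P ∅ = P := symmDiff_bot P
    rw [e0] at h1
    refine h1.trans ?_
    have h2 : (∑ l ∈ Finset.range (T + 1), η ^ l) * (1 - η) = 1 - η ^ (T + 1) := geom_sum_mul_neg η (T + 1)
    have h3 : 0 < η ^ (T + 1) := by positivity
    have h4 : ∑ l ∈ Finset.range (T + 1), u l = β * m / 2 * ((∑ l ∈ Finset.range (T + 1), η ^ l) * (1 - η)) := by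
      simp only [hu, hε, Finset.sum_mul, Finset.mul_sum]
      apply Finset.sum_congr rfl
      intro l _; ring
    rw [h4, h2]
    have : 0 < β * m / 2 := by positivity
    nlinarith
  have hEb : ∀ l ∈ Finset.range (T + 1), (((I l).biUnion (E l)).card : ℝ) ≤
      2 ^ Λ.card * Real.exp (-(ε ^ 2 / (16 * C) * (m * ξ ^ T) / θ ^ 2)) := by
    intro l hl
    have hlT : l ≤ T := by rw [Finset.mem_range] at hl; omega
    have hEq : ∀ q ∈ I l, ((E l q).card : ℝ) ≤ 2 ^ Λ.card * Real.exp (-(ε ^ 2 / (8 * C) * (m * ξ ^ l) / θ ^ 2)) := by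
      intro q hq
      rw [hI, Finset.mem_image] at hq
      obtain ⟨A, hA, rfl⟩ := hq
      have := logZ_tail J β θ hβ hθ Λ (c l A) (c (l + 1) A) (hsub _ _) (hsub _ _)
        (C * m * (2 / r) ^ l) (u l) (by positivity) (hu0 l) (hdiff A hA l hlT)
      refine this.trans (le_of_eq ?_)
      congr 3
      simp only [hu, hξ, mul_pow, div_pow]
      have : (0 : ℝ) < 2 ^ l := by positivity
      have : (0 : ℝ) < r ^ l := by positivity
      have : (0 : ℝ) < η ^ l := by positivity
      have e : (η ^ l) ^ 2 = (η ^ 2) ^ l := by rw [← pow_mul, ← pow_mul, mul_comm]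
      rw [e]
      field_simp
    have h1 : (((I l).biUnion (E l)).card : ℝ) ≤ ∑ q ∈ I l, ((E l q).card : ℝ) := by
      exact_mod_cast Finset.card_biUnion_le
    refine h1.trans ((Finset.sum_le_sum hEq).trans ?_)
    rw [Finset.sum_const, nsmul_eq_mul]
    calc ((I l).card : ℝ) * (2 ^ Λ.card * Real.exp (-(ε ^ 2 / (8 * C) * (m * ξ ^ l) / θ ^ 2)))
        ≤ Real.exp (C * m / r ^ l) * (2 ^ Λ.card * Real.exp (-(ε ^ 2 / (8 * C) * (m * ξ ^ l) / θ ^ 2))) :=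
          mul_le_mul_of_nonneg_right (hcnt l hlT) (by positivity)
      _ = 2 ^ Λ.card * Real.exp (C * m / r ^ l - ε ^ 2 / (8 * C) * (m * ξ ^ l) / θ ^ 2) := by
          rw [sub_eq_add_neg, Real.exp_add]; ring
      _ ≤ _ := by
          apply mul_le_mul_of_nonneg_left _ (by positivity)
          apply Real.exp_le_exp.2
          have a1 : (1 / r) ^ l ≤ ξ ^ l := pow_le_pow_left₀ (by positivity) hξr l
          have a2 : ξ ^ T ≤ ξ ^ l := pow_le_pow_of_le_one hξ0.le hξ1 hlT
          have a3 : C ≤ ε ^ 2 / (16 * C) / θ ^ 2 := by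
            rw [le_div_iff₀ (by positivity)]
            have : ε ^ 2 / (16 * C) = ε ^ 2 / (8 * C) / 2 := by field_simp; norm_num
            rw [this]; linarith
          have a4 : C * m / r ^ l ≤ (ε ^ 2 / (16 * C) / θ ^ 2) * (m * ξ ^ l) := by
            calc C * m / r ^ l = C * (m * (1 / r) ^ l) := by
                  rw [div_pow, one_pow]; field_simp
              _ ≤ C * (m * ξ ^ l) := by gcongr
              _ ≤ _ := mul_le_mul_of_nonneg_right a3 (by positivity)
          have a5 : ε ^ 2 / (8 * C) * (m * ξ ^ l) / θ ^ 2 = 2 * ((ε ^ 2 / (16 * C) / θ ^ 2) * (m * ξ ^ l)) := by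
            field_simp; norm_num
          have a6 : ε ^ 2 / (16 * C) * (m * ξ ^ T) / θ ^ 2 ≤ (ε ^ 2 / (16 * C) / θ ^ 2) * (m * ξ ^ l) := by
            rw [show ε ^ 2 / (16 * C) * (m * ξ ^ T) / θ ^ 2 = (ε ^ 2 / (16 * C) / θ ^ 2) * (m * ξ ^ T) by
              field_simp]
            gcongr
          rw [a5]; linarith
  have h1 := (Nat.cast_le (α := ℝ)).2 ((Finset.card_le_card hsubset).trans Finset.card_biUnion_le)
  refine h1.trans ?_
  push_cast
  refine (Finset.sum_le_sum hEb).trans (le_of_eq ?_)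
  rw [Finset.sum_const, Finset.card_range, nsmul_eq_mul]
  push_cast; ring

lemma summ_aux (c δ C : ℝ) (hc : 0 < c) (hδ : 0 < δ) :
    Summable (fun m : ℕ => C * m * Real.exp (-(c * (m : ℝ) ^ δ))) := by
  have h1 := isLittleO_exp_neg_mul_rpow_atTop hc (-(3 / δ))
  have h2 : Filter.Tendsto (fun m : ℕ => (m : ℝ) ^ δ) Filter.atTop Filter.atTop :=
    (tendsto_rpow_atTop hδ).comp tendsto_natCast_atTop_atTop
  have h3 := (h1.comp_tendsto h2).isBigO
  have h4 : (fun m : ℕ => C * m * Real.exp (-(c * (m : ℝ) ^ δ))) =O[Filter.atTop]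
      (fun m : ℕ => (m : ℝ) * ((m : ℝ) ^ δ) ^ (-(3 / δ))) := by
    have : (fun m : ℕ => C * m * Real.exp (-(c * (m : ℝ) ^ δ))) =
        fun m : ℕ => (C * m) * (Real.exp (-c * (m : ℝ) ^ δ)) := by
      funext m; rw [neg_mul]
    rw [this]
    apply Asymptotics.IsBigO.mul _ h3
    exact Asymptotics.isBigO_const_mul_self C _ _
  refine summable_of_isBigO_nat ?_ h4
  have h5 : Summable (fun m : ℕ => (m : ℝ) ^ (-2 : ℝ)) := Real.summable_nat_rpow.2 (by norm_num)
  refine h5.congr ?_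
  intro m
  rw [← Real.rpow_mul (Nat.cast_nonneg m)]
  have : δ * -(3 / δ) = -3 := by field_simp
  rw [this]
  rcases Nat.eq_zero_or_pos m with h | h
  · subst h; norm_num
  · have hm : (0 : ℝ) < m := by exact_mod_cast h
    nth_rewrite 2 [← Real.rpow_one (m : ℝ)]
    rw [← Real.rpow_add hm]; norm_num

lemma tail_small (f : ℕ → ℝ) (hf : Summable f) : ∃ m0 : ℕ, ∀ t : Finset ℕ, (∀ m ∈ t, m0 ≤ m) →
    ∑ m ∈ t, f m ≤ 1 / 2 := by
  obtain ⟨s, hs⟩ := summable_iff_vanishing_norm.1 hf (1 / 2) (by norm_num)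
  refine ⟨s.sup id + 1, fun t ht => ?_⟩
  have := hs t (by
    rw [Finset.disjoint_left]
    intro m hm hms
    have h1 := ht m hm
    have h2 : m ≤ s.sup id := Finset.le_sup (f := id) hms
    omega)
  exact (le_abs_self _).trans this.le

set_option maxHeartbeats 1000000 in
lemma interval_bound (α : ℝ) (ha : 1 / 2 < α) (ha1 : α < 1) :
    ∃ θ₀ > (0 : ℝ), ∃ β₀ > (0 : ℝ), ∃ J₁min : ℝ, 1 ≤ J₁min ∧ ∀ J₁ : ℝ, J₁min ≤ J₁ →
      ∀ θ : ℝ, 0 < θ → θ ≤ θ₀ → ∀ β : ℝ, β₀ ≤ β →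
      ∀ Λ : Finset ℤ, (∀ x ∈ Λ, ∀ y ∈ Λ, ∀ z, x ≤ z → z ≤ y → z ∈ Λ) →
      ∑ P ∈ Λ.powerset, qq (JJ J₁ α) β θ Λ P ≤
        2 ^ Λ.card * (1 / 2 * Real.exp (-(1 / θ ^ 2)) + 1 / 2 * Real.exp (-β)) := by
  set ρ := (α + 1 / 2) / 2 with hρ
  have hρ1 : 1 / 2 < ρ := by rw [hρ]; linarith
  have hρ2 : ρ < α := by rw [hρ]; linarith
  obtain ⟨K, hK⟩ := exists_KF α ρ hρ1 hρ2 ha1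
  obtain ⟨C, hC, hcount⟩ := counting hK ha1
  set r := (2 : ℝ) ^ ρ with hr
  have hrs : Real.sqrt 2 < r := by
    rw [Real.sqrt_eq_rpow, hr]
    exact Real.rpow_lt_rpow_of_exponent_lt (by norm_num) hρ1
  have hs2 : Real.sqrt 2 * Real.sqrt 2 = 2 := Real.mul_self_sqrt (by norm_num)
  have hs0 : 0 < Real.sqrt 2 := by positivity
  have hs1 : 1 < Real.sqrt 2 := by
    rw [Real.lt_sqrt (by norm_num)]; norm_num
  have hr1 : 1 < r := hs1.trans hrs
  have hr0 : 0 < r := by linarith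
  set η := Real.sqrt (Real.sqrt 2 / r) with hη
  have hη0 : 0 < η := by rw [hη]; positivity
  have hηlt : Real.sqrt 2 / r < 1 := by rw [div_lt_one hr0]; exact hrs
  have hη1 : η < 1 := by
    rw [hη, Real.sqrt_lt' (by norm_num)]; simpa using hηlt
  have hη2 : η ^ 2 = Real.sqrt 2 / r := Real.sq_sqrt (by positivity)
  set ξ := 1 / Real.sqrt 2 with hξ
  have hξ0 : 0 < ξ := by positivity
  have hξ1 : ξ ≤ 1 := by rw [hξ, div_le_one hs0]; exact hs1.le
  have hξη : ξ = η ^ 2 * (r / 2) := by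
    rw [hη2, hξ]; field_simp; nlinarith
  have hξr : 1 / r ≤ ξ := one_div_le_one_div_of_le hs0 hrs.le
  set ε := (1 - η) / 2 with hε
  have hε0 : 0 < ε := by rw [hε]; linarith
  set δ := 1 - 1 / (2 * ρ) with hδ
  have hδ0 : 0 < δ := by
    rw [hδ]
    have : 1 / (2 * ρ) < 1 := by rw [div_lt_one (by linarith)]; linarith
    linarith
  set c8 := ε ^ 2 / (16 * C) * C ^ (-(1 / (2 * ρ))) with hc8
  have hC0 : 0 < C := by linarith
  have hc80 : 0 < c8 := by rw [hc8]; positivity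
  set C7 := C / (r - 1) + 1 with hC7
  have hrm : 0 < r - 1 := by linarith
  have hC70 : 0 < C7 := by rw [hC7]; positivity
  obtain ⟨m1, hm1⟩ := tail_small _ (summ_aux (c8 / 2) δ C7 (by positivity) hδ0)
  obtain ⟨m2, hm2⟩ := tail_small (fun m : ℕ => Real.exp (-(m : ℝ)))
    (Real.summable_exp_neg_nat)
  obtain ⟨m3, hm3⟩ : ∃ m3 : ℕ, ∀ m : ℕ, m3 ≤ m → 2 ≤ c8 * (m : ℝ) ^ δ := by
    have h2 : Filter.Tendsto (fun m : ℕ => c8 * (m : ℝ) ^ δ) Filter.atTop Filter.atTop :=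
      ((tendsto_rpow_atTop hδ0).comp tendsto_natCast_atTop_atTop).const_mul_atTop hc80
    exact Filter.eventually_atTop.1 (h2.eventually_ge_atTop 2)
  set m0 := m1 + m2 + m3 + 8 with hm0
  set θ₀ := min 1 (Real.sqrt (ε ^ 2 / (8 * C) / (2 * C))) with hθ₀
  refine ⟨θ₀, by rw [hθ₀]; positivity, 4 * C + 8, by positivity, m0, ?_, ?_⟩
  · rw [hm0]; push_cast
    have : (0 : ℝ) ≤ m1 := Nat.cast_nonneg _
    have : (0 : ℝ) ≤ m2 := Nat.cast_nonneg _
    have : (0 : ℝ) ≤ m3 := Nat.cast_nonneg _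
    linarith
  intro J₁ hJ₁ θ hθ hθle β hβ Λ hΛ
  have hβ0 : 0 < β := by linarith
  have hm0r : (8 : ℝ) ≤ m0 := by
    rw [hm0]; exact_mod_cast (by omega : 8 ≤ m1 + m2 + m3 + 8)
  have hJ := JF_JJ α J₁ ha ha1 (by linarith)
  set J := JJ J₁ α with hJdef
  have hθ1 : θ ≤ 1 := hθle.trans (min_le_left _ _)
  have hθ2 : 2 * C * θ ^ 2 ≤ ε ^ 2 / (8 * C) := by
    have h1 : θ ≤ Real.sqrt (ε ^ 2 / (8 * C) / (2 * C)) := hθle.trans (min_le_right _ _)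
    have h2 : θ ^ 2 ≤ ε ^ 2 / (8 * C) / (2 * C) := by
      rw [← Real.sq_sqrt (show 0 ≤ ε ^ 2 / (8 * C) / (2 * C) by positivity)]
      exact pow_le_pow_left₀ hθ.le h1 2
    rw [le_div_iff₀ (by positivity)] at h2
    linarith
  set x := 1 / θ ^ 2 with hx
  have hx1 : 1 ≤ x := by
    rw [hx, le_div_iff₀ (by positivity), one_mul]
    exact pow_le_one₀ hθ.le hθ1
  set F : Finset ℤ → ℝ := fun P => Real.log (ZZ J β θ Λ P) with hF
  set Bad : ℕ → Finset (Finset ℤ) := fun m => Λ.powerset.filter (fun P =>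
    ¬ ∀ A ∈ GG J K ρ Λ m, F (symmDiff P A) - F P ≤ β * m / 2) with hBad
  have hbad : ∀ m : ℕ, m0 ≤ m → ((Bad m).card : ℝ) ≤
      2 ^ Λ.card * (Real.exp (-x) * (C7 * m * Real.exp (-(c8 / 2 * (m : ℝ) ^ δ)))) := by
    intro m hm
    have hm1' : 1 ≤ m := by omega
    have hmr : (1 : ℝ) ≤ m := by exact_mod_cast hm1'
    have hmr0 : (0 : ℝ) < m := by linarith
    obtain ⟨T, c, hT, hsub, hends, hdiff, hcnt⟩ := hcount J₁ J hJ Λ hΛ m hm1'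
    have h1 := bad_card J β θ hβ0 hθ Λ (GG J K ρ Λ m) T c C r η ξ m hm1' hC hr0 hη0 hη1 hξη hξr hξ1
      hθ2 hsub hends hdiff hcnt
    refine h1.trans (mul_le_mul_of_nonneg_left ?_ (by positivity))
    have hT7 : (T : ℝ) + 1 ≤ C7 * m := by
      have hb := one_add_mul_le_pow (show (-2 : ℝ) ≤ r - 1 by linarith) T
      rw [show 1 + (r - 1) = r by ring] at hb
      have h2 : (T : ℝ) ≤ C * m / (r - 1) := by
        rw [le_div_iff₀ hrm]; linarith
      have h3 : C7 * m = C * m / (r - 1) + m := by rw [hC7]; ring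
      linarith
    have hξT : C ^ (-(1 / (2 * ρ))) * (m : ℝ) ^ δ ≤ m * ξ ^ T := by
      have e1 : ξ ^ T = (r ^ T) ^ (-(1 / (2 * ρ))) := by
        rw [hξ, Real.sqrt_eq_rpow, one_div, ← Real.rpow_neg (by norm_num), hr, ← Real.rpow_natCast,
          ← Real.rpow_natCast, ← Real.rpow_mul (by positivity), ← Real.rpow_mul (by positivity),
          ← Real.rpow_mul (by positivity)]
        congr 1
        have : ρ ≠ 0 := by linarith
        field_simp
      have e2 : (C * m) ^ (-(1 / (2 * ρ))) ≤ (r ^ T) ^ (-(1 / (2 * ρ))) := by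
        apply Real.rpow_le_rpow_of_nonpos (by positivity) hT
        have : 0 < 1 / (2 * ρ) := by positivity
        linarith
      have e3 : (m : ℝ) ^ δ = m * (m : ℝ) ^ (-(1 / (2 * ρ))) := by
        rw [hδ, sub_eq_add_neg, Real.rpow_add hmr0, Real.rpow_one]
      rw [Real.mul_rpow hC0.le hmr0.le] at e2
      rw [e1, e3]
      calc C ^ (-(1 / (2 * ρ))) * (m * (m : ℝ) ^ (-(1 / (2 * ρ))))
          = m * (C ^ (-(1 / (2 * ρ))) * (m : ℝ) ^ (-(1 / (2 * ρ)))) := by ring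
        _ ≤ _ := mul_le_mul_of_nonneg_left e2 hmr0.le
    have hexp : Real.exp (-(ε ^ 2 / (16 * C) * (m * ξ ^ T) / θ ^ 2)) ≤
        Real.exp (-x) * Real.exp (-(c8 / 2 * (m : ℝ) ^ δ)) := by
      rw [← Real.exp_add]
      apply Real.exp_le_exp.2
      have h3 := hm3 m (by omega)
      have h4 : c8 * (m : ℝ) ^ δ ≤ ε ^ 2 / (16 * C) * (m * ξ ^ T) := by
        rw [hc8, mul_assoc]
        exact mul_le_mul_of_nonneg_left hξT (by positivity)
      rw [div_eq_mul_one_div _ (θ ^ 2), ← hx]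
      have h5 : c8 * (m : ℝ) ^ δ * x ≤ ε ^ 2 / (16 * C) * (m * ξ ^ T) * x :=
        mul_le_mul_of_nonneg_right h4 (by linarith)
      nlinarith
    calc ((T : ℝ) + 1) * Real.exp (-(ε ^ 2 / (16 * C) * (m * ξ ^ T) / θ ^ 2))
        ≤ (C7 * m) * (Real.exp (-x) * Real.exp (-(c8 / 2 * (m : ℝ) ^ δ))) :=
          mul_le_mul hT7 hexp (Real.exp_pos _).le (by positivity)
      _ = _ := by ring
  set t := (G0 J K ρ Λ).image (fun A => ⌊ener J A⌋₊) with ht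
  have ht0 : ∀ m ∈ t, m0 ≤ m := by
    intro m hm
    rw [ht, Finset.mem_image] at hm
    obtain ⟨A, hA, rfl⟩ := hm
    apply Nat.le_floor
    rw [G0, Finset.mem_filter] at hA
    exact hJ₁.trans (ener_ge_J1 hJ A ⟨0, hA.2.2⟩)
  have hfib : ∀ m, (G0 J K ρ Λ).filter (fun A => ⌊ener J A⌋₊ = m) = GG J K ρ Λ m := by
    intro m
    rw [G0, GG, Finset.filter_filter]
    apply Finset.filter_congr
    intro A _
    tauto
  set BB := t.biUnion Bad with hBB
  have hBBc : (BB.card : ℝ) ≤ 2 ^ Λ.card * (1 / 2 * Real.exp (-x)) := by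
    have h1 : (BB.card : ℝ) ≤ ∑ m ∈ t, ((Bad m).card : ℝ) := by exact_mod_cast Finset.card_biUnion_le
    refine h1.trans ((Finset.sum_le_sum (fun m hm => hbad m (ht0 m hm))).trans ?_)
    rw [← Finset.mul_sum, ← Finset.mul_sum]
    apply mul_le_mul_of_nonneg_left _ (by positivity)
    rw [mul_comm (1 / 2 : ℝ)]
    apply mul_le_mul_of_nonneg_left _ (Real.exp_pos _).le
    exact hm1 t (fun m hm => by have := ht0 m hm; omega)
  have hgood : ∀ P ∈ Λ.powerset, P ∉ BB → qq J β θ Λ P ≤ 1 / 2 * Real.exp (-β) := by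
    intro P hP hPB
    refine (peierls hJ hK Λ P β θ hβ0).trans ?_
    have hmaps : ∀ A ∈ G0 J K ρ Λ, ⌊ener J A⌋₊ ∈ t := fun A hA => Finset.mem_image_of_mem _ hA
    rw [← Finset.sum_fiberwise_of_maps_to hmaps]
    have hterm : ∀ m ∈ t, ∑ A ∈ (G0 J K ρ Λ).filter (fun A => ⌊ener J A⌋₊ = m),
        Real.exp (-(β * ener J A)) * (ZZ J β θ Λ (symmDiff P A) / ZZ J β θ Λ P) ≤
        Real.exp (-β) * Real.exp (-(m : ℝ)) := by
      intro m hm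
      rw [hfib]
      have hmm := ht0 m hm
      have hm1' : 1 ≤ m := by omega
      have hm8 : (8 : ℝ) ≤ m := by exact_mod_cast (by omega : 8 ≤ m)
      have hg : ∀ A ∈ GG J K ρ Λ m, F (symmDiff P A) - F P ≤ β * m / 2 := by
        by_contra hc
        apply hPB
        rw [hBB, Finset.mem_biUnion]
        refine ⟨m, hm, ?_⟩
        rw [hBad, Finset.mem_filter]
        exact ⟨hP, hc⟩
      obtain ⟨T, c, hT, hsub, hends, hdiff, hcnt⟩ := hcount J₁ J hJ Λ hΛ m hm1'
      have hcard : ((GG J K ρ Λ m).card : ℝ) ≤ Real.exp (C * m) := by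
        have h0 := hcnt 0 (Nat.zero_le _)
        rw [pow_zero, div_one, Finset.card_image_of_injOn] at h0
        · exact h0
        · intro A hA A' hA' hAA
          have := congrArg Prod.fst hAA
          simp only at this
          rwa [(hends A hA).1, (hends A' hA').1] at this
      have hA : ∀ A ∈ GG J K ρ Λ m, Real.exp (-(β * ener J A)) *
          (ZZ J β θ Λ (symmDiff P A) / ZZ J β θ Λ P) ≤ Real.exp (-(β * m / 2)) := by
        intro A hA
        have h1 := hg A hA
        have h2 : ZZ J β θ Λ (symmDiff P A) / ZZ J β θ Λ P = Real.exp (F (symmDiff P A) - F P) := by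
          simp only [hF]
          rw [Real.exp_sub, Real.exp_log (ZZ_pos _ _ _ _ _), Real.exp_log (ZZ_pos _ _ _ _ _)]
        rw [h2, ← Real.exp_add]
        apply Real.exp_le_exp.2
        have h3 : (m : ℝ) ≤ ener J A := by
          rw [GG, Finset.mem_filter] at hA
          rw [← hA.2.2.2]
          exact Nat.floor_le (ener_nonneg hJ A)
        nlinarith
      refine (Finset.sum_le_sum hA).trans ?_
      rw [Finset.sum_const, nsmul_eq_mul]
      refine (mul_le_mul_of_nonneg_right hcard (Real.exp_pos _).le).trans ?_
      rw [← Real.exp_add, ← Real.exp_add]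
      apply Real.exp_le_exp.2
      have k1 : (4 * C + 8) * m ≤ β * m := mul_le_mul_of_nonneg_right hβ (by linarith)
      have k2 : β * 8 ≤ β * m := mul_le_mul_of_nonneg_left hm8 hβ0.le
      nlinarith
    refine (Finset.sum_le_sum hterm).trans ?_
    rw [← Finset.mul_sum, mul_comm]
    apply mul_le_mul_of_nonneg_right _ (Real.exp_pos _).le
    exact hm2 t (fun m hm => by have := ht0 m hm; omega)
  calc ∑ P ∈ Λ.powerset, qq J β θ Λ P
      ≤ ∑ P ∈ Λ.powerset, ((if P ∈ BB then 1 else 0) + 1 / 2 * Real.exp (-β)) := by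
        apply Finset.sum_le_sum
        intro P hP
        have hp : 0 < 1 / 2 * Real.exp (-β) := by positivity
        by_cases hPB : P ∈ BB
        · rw [if_pos hPB]
          linarith [qq_le_one J β θ Λ P]
        · rw [if_neg hPB, zero_add]
          exact hgood P hP hPB
    _ = ((Λ.powerset.filter (fun P => P ∈ BB)).card : ℝ) + 2 ^ Λ.card * (1 / 2 * Real.exp (-β)) := by
        rw [Finset.sum_add_distrib, Finset.sum_boole, Finset.sum_const, Finset.card_powerset,
          nsmul_eq_mul]
        push_cast; rfl
    _ ≤ _ := by
        have : ((Λ.powerset.filter (fun P => P ∈ BB)).card : ℝ) ≤ BB.card := by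
          have : (Λ.powerset.filter (fun P => P ∈ BB)) ⊆ BB := fun P hP => (Finset.mem_filter.1 hP).2
          exact_mod_cast Finset.card_le_card this
        rw [mul_add]
        linarith

/-- the set of minus sites of a Boolean configuration -/
def mset (Λ : Finset ℤ) (σ : Λ → Bool) : Finset ℤ :=
  Λ.filter (fun i => ∃ hi : i ∈ Λ, σ ⟨i, hi⟩ = false)

lemma mset_sub (Λ : Finset ℤ) (σ : Λ → Bool) : mset Λ σ ⊆ Λ := Finset.filter_subset _ _

lemma mem_mset (Λ : Finset ℤ) (σ : Λ → Bool) (i : Λ) : (i : ℤ) ∈ mset Λ σ ↔ σ i = false := by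
  rw [mset, Finset.mem_filter]
  constructor
  · rintro ⟨_, _, h⟩; exact h
  · intro h; exact ⟨i.2, i.2, h⟩

lemma spin_mset (Λ : Finset ℤ) (σ : Λ → Bool) (i : Λ) :
    spin (σ i) = 1 - 2 * ind (mset Λ σ) i := by
  simp only [ind, mem_mset, spin]
  cases σ i <;> norm_num

lemma sum_mset (Λ : Finset ℤ) (F : Finset ℤ → ℝ) :
    ∑ σ : Λ → Bool, F (mset Λ σ) = ∑ M ∈ Λ.powerset, F M := by
  apply Finset.sum_nbij' (fun σ => mset Λ σ) (fun M i => decide ((i : ℤ) ∉ M))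
  · intro σ _
    rw [Finset.mem_powerset]; exact mset_sub Λ σ
  · intro M _; exact Finset.mem_univ _
  · intro σ _
    funext i
    simp only [mem_mset]
    cases σ i <;> simp
  · intro M hM
    rw [Finset.mem_powerset] at hM
    ext x
    constructor
    · intro hx
      have := (mem_mset Λ _ ⟨x, mset_sub _ _ hx⟩).1 hx
      simpa using this
    · intro hx
      apply (mem_mset Λ _ ⟨x, hM hx⟩).2
      simpa using hx
  · intro σ _; rfl

lemma card_symm (Λ M P : Finset ℤ) (hM : M ⊆ Λ) (hP : P ⊆ Λ) :
    ((symmDiff M P).card : ℝ) = ∑ i ∈ Λ, (ind M i + ind P i - 2 * (ind M i * ind P i)) := by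
  have h1 : symmDiff M P = Λ.filter (fun i => i ∈ symmDiff M P) := by
    ext x
    simp only [Finset.mem_filter]
    exact ⟨fun h => ⟨symm_sub hM hP h, h⟩, fun h => h.2⟩
  rw [h1, Finset.card_filter]
  push_cast
  apply Finset.sum_congr rfl
  intro i _
  simp only [ind, Finset.mem_symmDiff]
  by_cases h : i ∈ M <;> by_cases h' : i ∈ P <;> simp [h, h'] <;> norm_num

lemma ener_enc {α J₁ : ℝ} {J : ℤ → ℝ} (hJ : JF α J₁ J) (Λ M : Finset ℤ) (hM : M ⊆ Λ) :
    ener J M = ∑ i ∈ Λ, ind M i * (∑ j ∈ Λ, J (i - j) * (1 - ind M j)) +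
      ∑ i ∈ Λ, ind M i * (∑' j : ℤ, if j ∈ Λ then 0 else J (i - j)) := by
  rw [ener_eq hJ, ← Finset.sum_add_distrib]
  have h1 : ∑ i ∈ M, sepf J M i = ∑ i ∈ Λ, ind M i * sepf J M i := by
    rw [← Finset.sum_subset hM]
    · apply Finset.sum_congr rfl
      intro i hi; simp [ind, hi]
    · intro i _ hi; simp [ind, hi]
  rw [h1]
  apply Finset.sum_congr rfl
  intro i _
  rw [← mul_add]
  by_cases hi : i ∈ M
  · congr 1
    have hs : Summable (fun j => J (i - j) * (if j ∈ Λ then 0 else 1)) := by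
      apply summ_row_mul hJ
      · intro j; split_ifs <;> norm_num
      · intro j; split_ifs <;> norm_num
    have e : ∀ j, J (i - j) * sp M i j =
        (if j ∈ Λ then J (i - j) * (1 - ind M j) else 0) +
          J (i - j) * (if j ∈ Λ then 0 else 1) := by
      intro j
      rw [sp_eq_ind]
      by_cases hj : j ∈ Λ
      · simp [hj, ind, hi]
      · have : j ∉ M := fun h => hj (hM h)
        simp [hj, ind, hi, this]
    rw [sepf, tsum_congr e, Summable.tsum_add _ hs]
    · congr 1
      · rw [tsum_eq_sum (s := Λ)]
        · apply Finset.sum_congr rfl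
          intro j hj; simp [hj]
        · intro j hj; simp [hj]
      · apply tsum_congr
        intro j; split_ifs <;> simp
    · apply summable_of_ne_finset_zero (s := Λ)
      intro j hj; simp [hj]
  · simp [ind, hi]

lemma Ham_enc {α J₁ : ℝ} (hJ : JF α J₁ (JJ J₁ α)) (θ : ℝ) (Λ : Finset ℤ) (σ η : Λ → Bool) :
    Ham J₁ α θ 1 Λ (fun i => if hi : i ∈ Λ then spin (η ⟨i, hi⟩) else 1) σ =
      2 * ener (JJ J₁ α) (mset Λ σ) -
        θ * (Λ.card - 2 * ((symmDiff (mset Λ σ) (mset Λ η)).card : ℝ)) := by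
  rw [card_symm Λ _ _ (mset_sub _ _) (mset_sub _ _), ener_enc hJ Λ _ (mset_sub Λ σ)]
  set M := mset Λ σ with hMd
  set P := mset Λ η with hPd
  rw [Ham]
  have hA : ∑ i : Λ, ∑ j : Λ, (if i = j then 0 else
      Jcoup J₁ α ((i : ℤ) - (j : ℤ)).natAbs * (1 - spin (σ i) * spin (σ j))) =
      4 * ∑ i ∈ Λ, ind M i * (∑ j ∈ Λ, JJ J₁ α (i - j) * (1 - ind M j)) := by
    have e1 : ∀ i j : Λ, (if i = j then 0 else
      Jcoup J₁ α ((i : ℤ) - (j : ℤ)).natAbs * (1 - spin (σ i) * spin (σ j))) =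
      2 * (ind M i * (JJ J₁ α (i - j) * (1 - ind M j))) +
      2 * (ind M j * (JJ J₁ α (j - i) * (1 - ind M i))) := by
      intro i j
      rw [spin_mset, spin_mset, ← hMd, J_comm hJ j i]
      split_ifs with h
      · rw [h, sub_self, hJ.zero]; ring
      · have : Jcoup J₁ α ((i : ℤ) - (j : ℤ)).natAbs = JJ J₁ α (i - j) := rfl
        rw [this]
        ring
    simp only [e1, Finset.sum_add_distrib]
    rw [Finset.sum_comm (f := fun i j : Λ => 2 * (ind M j * (JJ J₁ α (j - i) * (1 - ind M i))))]
    simp only [← Finset.mul_sum]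
    have e2 : ∀ i : ℤ, ∑ j : Λ, JJ J₁ α (i - j) * (1 - ind M j) =
        ∑ j ∈ Λ, JJ J₁ α (i - j) * (1 - ind M j) := fun i =>
      Finset.sum_coe_sort Λ (fun j => JJ J₁ α (i - j) * (1 - ind M j))
    simp only [e2]
    rw [Finset.sum_coe_sort Λ (fun i => ind M i * ∑ j ∈ Λ, JJ J₁ α (i - j) * (1 - ind M j))]
    ring
  have hB : ∑ i : Λ, (∑' j : ℤ, if j ∈ Λ then 0 else Jcoup J₁ α ((i : ℤ) - j).natAbs)
      * (1 - 1 * spin (σ i)) =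
      2 * ∑ i ∈ Λ, ind M i * (∑' j : ℤ, if j ∈ Λ then 0 else JJ J₁ α (i - j)) := by
    rw [Finset.mul_sum, ← Finset.sum_coe_sort Λ]
    apply Finset.sum_congr rfl
    intro i _
    rw [spin_mset, ← hMd]
    simp only [JJ]
    ring
  have hC : ∑ i : Λ, (if hi : (i : ℤ) ∈ Λ then spin (η ⟨i, hi⟩) else 1) * spin (σ i) =
      Λ.card - 2 * ∑ i ∈ Λ, (ind M i + ind P i - 2 * (ind M i * ind P i)) := by
    have : (Λ.card : ℝ) = ∑ i ∈ Λ, 1 := by simp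
    rw [this, Finset.mul_sum, ← Finset.sum_sub_distrib, ← Finset.sum_coe_sort Λ]
    apply Finset.sum_congr rfl
    intro i _
    rw [dif_pos i.2, spin_mset, spin_mset, ← hMd, ← hPd]
    ring
  rw [hA, hB, hC]
  ring

lemma avg_enc {α J₁ : ℝ} (hJ : JF α J₁ (JJ J₁ α)) (θ β : ℝ) (Λ : Finset ℤ) (h0 : (0 : ℤ) ∈ Λ)
    (η : Λ → Bool) :
    gibbsAvg J₁ α θ 1 β Λ (fun i => if hi : i ∈ Λ then spin (η ⟨i, hi⟩) else 1)
      (fun σ => spin (σ ⟨0, h0⟩)) = 1 - 2 * qq (JJ J₁ α) β θ Λ (mset Λ η) := by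
  rw [gibbsAvg]
  set P := mset Λ η with hP
  have e1 : ∀ σ : Λ → Bool, Real.exp (-β * Ham J₁ α θ 1 Λ
      (fun i => if hi : i ∈ Λ then spin (η ⟨i, hi⟩) else 1) σ) =
      Real.exp (β * θ * Λ.card) * wt (JJ J₁ α) β θ (mset Λ σ) P := by
    intro σ
    rw [Ham_enc hJ, wt, ← Real.exp_add, ← hP]
    congr 1
    ring
  simp only [e1]
  have e2 : ∀ σ : Λ → Bool, spin (σ ⟨0, h0⟩) = 1 - 2 * ind (mset Λ σ) 0 :=
    fun σ => spin_mset Λ σ ⟨0, h0⟩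
  simp only [e2]
  rw [sum_mset Λ (fun M => (1 - 2 * ind M 0) * (Real.exp (β * θ * Λ.card) * wt (JJ J₁ α) β θ M P)),
    sum_mset Λ (fun M => Real.exp (β * θ * Λ.card) * wt (JJ J₁ α) β θ M P), ← Finset.mul_sum]
  have hZ := ZZ_pos (JJ J₁ α) β θ Λ P
  have hE := Real.exp_pos (β * θ * Λ.card)
  have e3 : ∑ M ∈ Λ.powerset, (1 - 2 * ind M 0) *
      (Real.exp (β * θ * Λ.card) * wt (JJ J₁ α) β θ M P) =
      Real.exp (β * θ * Λ.card) * (ZZ (JJ J₁ α) β θ Λ P - 2 *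
        ∑ M ∈ Λ.powerset.filter (fun M => (0 : ℤ) ∈ M), wt (JJ J₁ α) β θ M P) := by
    rw [ZZ, Finset.sum_filter, Finset.mul_sum, ← Finset.sum_sub_distrib, Finset.mul_sum]
    apply Finset.sum_congr rfl
    intro M _
    rw [ind]
    split_ifs <;> ring
  rw [e3, qq]
  change _ / (_ * ZZ (JJ J₁ α) β θ Λ P) = _
  field_simp

lemma field_enc {α J₁ : ℝ} (hJ : JF α J₁ (JJ J₁ α)) (θ β : ℝ) (Λ : Finset ℤ) (h0 : (0 : ℤ) ∈ Λ) :
    fieldE Λ (fun h => gibbsAvg J₁ α θ 1 β Λ h (fun σ => spin (σ ⟨0, h0⟩))) =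
      1 - 2 * ((∑ P ∈ Λ.powerset, qq (JJ J₁ α) β θ Λ P) / 2 ^ Λ.card) := by
  rw [fieldE]
  simp only [avg_enc hJ]
  rw [sum_mset Λ (fun P => 1 - 2 * qq (JJ J₁ α) β θ Λ P), Finset.sum_sub_distrib, ← Finset.mul_sum]
  simp only [Finset.sum_const, Finset.card_powerset, nsmul_eq_mul]
  push_cast
  field_simp

lemma card_modular (A B P : Finset ℤ) :
    ((symmDiff (A ∩ B) P).card : ℝ) + ((symmDiff (A ∪ B) P).card : ℝ) =
      ((symmDiff A P).card : ℝ) + ((symmDiff B P).card : ℝ) := by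
  set Λ := A ∪ B ∪ P with hΛ
  have hA : A ⊆ Λ := fun x hx => by simp [hΛ, hx]
  have hB : B ⊆ Λ := fun x hx => by simp [hΛ, hx]
  have hP : P ⊆ Λ := fun x hx => by simp [hΛ, hx]
  rw [card_symm Λ _ _ (Finset.inter_subset_left.trans hA) hP,
    card_symm Λ _ _ (Finset.union_subset hA hB) hP, card_symm Λ _ _ hA hP, card_symm Λ _ _ hB hP,
    ← Finset.sum_add_distrib, ← Finset.sum_add_distrib]
  apply Finset.sum_congr rfl
  intro i _
  simp only [ind, Finset.mem_inter, Finset.mem_union]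
  by_cases h : i ∈ A <;> by_cases h' : i ∈ B <;> by_cases k : i ∈ P <;>
    simp [h, h', k] <;> ring

lemma wt_submod {α J₁ : ℝ} {J : ℤ → ℝ} (hJ : JF α J₁ J) {β : ℝ} (hβ : 0 < β) (θ : ℝ)
    (A B P : Finset ℤ) :
    wt J β θ A P * wt J β θ B P ≤ wt J β θ (A ∩ B) P * wt J β θ (A ∪ B) P := by
  simp only [wt, ← Real.exp_add]
  apply Real.exp_le_exp.2
  have h1 := ener_submod hJ A B
  have h2 := card_modular A B P
  have h3 : ((symmDiff (A ∪ B) P).card : ℝ) =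
      ((symmDiff A P).card : ℝ) + ((symmDiff B P).card : ℝ) -
        ((symmDiff (A ∩ B) P).card : ℝ) := by linarith
  rw [h3]
  have h4 := mul_le_mul_of_nonneg_left h1 (by linarith : (0 : ℝ) ≤ 2 * β)
  nlinarith

lemma qq_mono {α J₁ : ℝ} {J : ℤ → ℝ} (hJ : JF α J₁ J) {β : ℝ} (hβ : 0 < β) (θ : ℝ)
    (Λ Λ' P : Finset ℤ) (hΛ : Λ ⊆ Λ') : qq J β θ Λ P ≤ qq J β θ Λ' P := by
  rw [qq, qq, div_le_div_iff₀ (ZZ_pos _ _ _ _ _) (ZZ_pos _ _ _ _ _)]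
  have hw : (0 : Finset ℤ → ℝ) ≤ fun M => wt J β θ M P := fun M => (wt_pos J β θ M P).le
  have key := Finset.four_functions_theorem Λ' hw hw hw hw
    (fun s _ t _ => wt_submod hJ hβ θ s t P)
    (𝒜 := Λ.powerset.filter (fun M => (0 : ℤ) ∈ M)) (ℬ := Λ'.powerset)
    (fun M hM => by
      rw [Finset.mem_filter, Finset.mem_powerset] at hM
      exact Finset.mem_powerset.2 (hM.1.trans hΛ)) (Finset.Subset.refl _)
  refine key.trans ?_
  rw [mul_comm]
  apply mul_le_mul
  · apply Finset.sum_le_sum_of_subset_of_nonneg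
    · intro M hM
      rw [Finset.mem_sups] at hM
      obtain ⟨a, ha, b, hb, rfl⟩ := hM
      rw [Finset.mem_filter, Finset.mem_powerset] at ha
      rw [Finset.mem_powerset] at hb
      rw [Finset.mem_filter, Finset.mem_powerset]
      exact ⟨Finset.union_subset (ha.1.trans hΛ) hb, Finset.mem_union_left _ ha.2⟩
    · intro M _ _; exact (wt_pos J β θ M P).le
  · rw [ZZ]
    apply Finset.sum_le_sum_of_subset_of_nonneg
    · intro M hM
      rw [Finset.mem_infs] at hM
      obtain ⟨a, ha, b, hb, rfl⟩ := hM
      rw [Finset.mem_filter, Finset.mem_powerset] at ha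
      rw [Finset.mem_powerset]
      exact Finset.inter_subset_left.trans ha.1
    · intro M _ _; exact (wt_pos J β θ M P).le
  · exact Finset.sum_nonneg (fun M _ => (wt_pos J β θ M P).le)
  · exact Finset.sum_nonneg (fun M _ => (wt_pos J β θ M P).le)

lemma wt_restrict (J : ℤ → ℝ) (β θ : ℝ) (Λ M P : Finset ℤ) (hM : M ⊆ Λ) :
    wt J β θ M P = Real.exp (-(2 * β * θ * ((P \ Λ).card : ℝ))) * wt J β θ M (P ∩ Λ) := by
  have hc : (symmDiff M P).card = (symmDiff M (P ∩ Λ)).card + (P \ Λ).card := by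
    rw [← Finset.card_union_of_disjoint]
    · congr 1
      ext x
      have := @hM x
      simp only [Finset.mem_symmDiff, Finset.mem_union, Finset.mem_inter, Finset.mem_sdiff]
      tauto
    · rw [Finset.disjoint_left]
      intro x hx
      have := @hM x
      simp only [Finset.mem_symmDiff, Finset.mem_inter, Finset.mem_sdiff] at *
      tauto
  rw [wt, wt, ← Real.exp_add, hc]
  congr 1
  push_cast
  ring

lemma qq_restrict (J : ℤ → ℝ) (β θ : ℝ) (Λ P : Finset ℤ) :
    qq J β θ Λ P = qq J β θ Λ (P ∩ Λ) := by
  rw [qq, qq, ZZ, ZZ]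
  have h1 : ∑ M ∈ Λ.powerset, wt J β θ M P =
      Real.exp (-(2 * β * θ * ((P \ Λ).card : ℝ))) * ∑ M ∈ Λ.powerset, wt J β θ M (P ∩ Λ) := by
    rw [Finset.mul_sum]
    apply Finset.sum_congr rfl
    intro M hM
    exact wt_restrict J β θ Λ M P (Finset.mem_powerset.1 hM)
  have h2 : ∑ M ∈ Λ.powerset.filter (fun M => (0 : ℤ) ∈ M), wt J β θ M P =
      Real.exp (-(2 * β * θ * ((P \ Λ).card : ℝ))) *
        ∑ M ∈ Λ.powerset.filter (fun M => (0 : ℤ) ∈ M), wt J β θ M (P ∩ Λ) := by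
    rw [Finset.mul_sum]
    apply Finset.sum_congr rfl
    intro M hM
    exact wt_restrict J β θ Λ M P (Finset.mem_powerset.1 (Finset.mem_filter.1 hM).1)
  rw [h1, h2, mul_div_mul_left _ _ (Real.exp_pos _).ne']

lemma sum_restrict (Λ Λ' : Finset ℤ) (hΛ : Λ ⊆ Λ') (f : Finset ℤ → ℝ) :
    ∑ P ∈ Λ'.powerset, f (P ∩ Λ) = 2 ^ (Λ' \ Λ).card * ∑ P ∈ Λ.powerset, f P := by
  have h1 : ∑ P ∈ Λ'.powerset, f (P ∩ Λ) =
      ∑ q ∈ (Λ' \ Λ).powerset ×ˢ Λ.powerset, f q.2 := by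
    apply Finset.sum_nbij' (fun P => (P \ Λ, P ∩ Λ)) (fun q => q.1 ∪ q.2)
    · intro P hP
      rw [Finset.mem_powerset] at hP
      simp only [Finset.mem_product, Finset.mem_powerset]
      exact ⟨Finset.sdiff_subset_sdiff hP (Finset.Subset.refl _), Finset.inter_subset_right⟩
    · intro q hq
      simp only [Finset.mem_product, Finset.mem_powerset] at hq ⊢
      exact Finset.union_subset (hq.1.trans Finset.sdiff_subset) (hq.2.trans hΛ)
    · intro P _
      exact Finset.sdiff_union_inter P Λ
    · intro q hq
      simp only [Finset.mem_product, Finset.mem_powerset] at hq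
      have a1 := hq.1
      have a2 := hq.2
      apply Prod.ext
      · ext x
        have b1 := @a1 x
        have b2 := @a2 x
        simp only [Finset.mem_sdiff, Finset.mem_union] at *
        tauto
      · ext x
        have b1 := @a1 x
        have b2 := @a2 x
        simp only [Finset.mem_sdiff, Finset.mem_union, Finset.mem_inter] at *
        tauto
    · intro P _; rfl
  rw [h1, Finset.sum_product]
  simp

lemma exists_box (Λ : Finset ℤ) : ∃ N : ℤ, Λ ⊆ Finset.Icc (-N) N := by
  induction Λ using Finset.induction_on with
  | empty => exact ⟨0, by simp⟩
  | insert a s _ ih =>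
    obtain ⟨N, hN⟩ := ih
    refine ⟨max N (max a (-a)), ?_⟩
    intro x hx
    rw [Finset.mem_insert] at hx
    rw [Finset.mem_Icc]
    rcases hx with rfl | hx
    · omega
    · have := Finset.mem_Icc.1 (hN hx)
      omega

lemma final_aux (α : ℝ) (hα₁ : 1 / 2 < α) (hα₂ : α < Real.log 3 / Real.log 2 - 1)
    (ζ : ℝ) (hζdef : ζ = 1 - 2 * ((2 : ℝ) ^ α - 1)) : α < 1 ∧ 0 < ζ ∧ ζ < 1 := by
  have hl2 : 0 < Real.log 2 := Real.log_pos (by norm_num)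
  have h1 : (α + 1) * Real.log 2 < Real.log 3 := by
    have : α + 1 < Real.log 3 / Real.log 2 := by linarith
    rwa [lt_div_iff₀ hl2] at this
  have h2 : (2 : ℝ) ^ (α + 1) < 3 := by
    rw [Real.rpow_def_of_pos (by norm_num), ← Real.lt_log_iff_exp_lt (by norm_num)]
    linarith
  have h3 : (2 : ℝ) ^ (α + 1) = 2 ^ α * 2 := by
    rw [Real.rpow_add (by norm_num), Real.rpow_one]
  have h4 : (1 : ℝ) < 2 ^ α := Real.one_lt_rpow (by norm_num) (by linarith)
  refine ⟨?_, by linarith, by linarith⟩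
  have h5 : Real.log 3 < 2 * Real.log 2 := by
    have : Real.log 4 = 2 * Real.log 2 := by
      rw [show (4 : ℝ) = 2 ^ 2 by norm_num, Real.log_pow]; norm_num
    rw [← this]
    exact Real.log_lt_log (by norm_num) (by norm_num)
  nlinarith

lemma final_thm
    (α : ℝ) (hα₁ : 1 / 2 < α) (hα₂ : α < Real.log 3 / Real.log 2 - 1)
    (ζ : ℝ) (hζdef : ζ = 1 - 2 * ((2 : ℝ) ^ α - 1)) :
    0 < ζ ∧
    ∃ θ₀ > (0 : ℝ), ∃ β₀ > (0 : ℝ), ∃ J₁min : ℝ, ∀ J₁ : ℝ, J₁min ≤ J₁ →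
      ∀ θ : ℝ, 0 < θ → θ ≤ θ₀ → ∀ β : ℝ, β₀ ≤ β →
      ∀ Λ : Finset ℤ, ∀ h0 : (0 : ℤ) ∈ Λ,
        1 - 2 * Real.exp (-(min (β * ζ / 4) (ζ ^ 2 / (2 ^ 10 * θ ^ 2))) / 100)
          ≤ fieldE Λ (fun h =>
              gibbsAvg J₁ α θ 1 β Λ h (fun σ => spin (σ ⟨0, h0⟩))) := by
  obtain ⟨ha1, hz0, hz1⟩ := final_aux α hα₁ hα₂ ζ hζdef
  refine ⟨hz0, ?_⟩
  obtain ⟨θ₀, hθ₀, β₀, hβ₀, Jm, hJm, H⟩ := interval_bound α hα₁ ha1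
  refine ⟨θ₀, hθ₀, β₀, hβ₀, Jm, ?_⟩
  intro J₁ hJ₁ θ hθ hθ' β hβ Λ h0
  have hJ := JF_JJ α J₁ hα₁ ha1 (hJm.trans hJ₁)
  have hβ0 : 0 < β := lt_of_lt_of_le hβ₀ hβ
  rw [field_enc hJ]
  obtain ⟨N, hN⟩ := exists_box Λ
  have hb := H J₁ hJ₁ θ hθ hθ' β hβ (Finset.Icc (-N) N) (by
    intro x hx y hy z h1 h2
    rw [Finset.mem_Icc] at *
    exact ⟨hx.1.trans h1, h2.trans hy.2⟩)
  set Λ' := Finset.Icc (-N) N with hΛ'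
  have h1 : 2 ^ (Λ' \ Λ).card * ∑ P ∈ Λ.powerset, qq (JJ J₁ α) β θ Λ P ≤
      ∑ P ∈ Λ'.powerset, qq (JJ J₁ α) β θ Λ' P := by
    rw [← sum_restrict Λ Λ' hN]
    apply Finset.sum_le_sum
    intro P _
    rw [← qq_restrict]
    exact qq_mono hJ hβ0 θ Λ Λ' P hN
  have hcard : (2 : ℝ) ^ Λ'.card = 2 ^ (Λ' \ Λ).card * 2 ^ Λ.card := by
    rw [← pow_add, Finset.card_sdiff_add_card_eq_card hN]
  have h2 : (∑ P ∈ Λ.powerset, qq (JJ J₁ α) β θ Λ P) / 2 ^ Λ.card ≤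
      1 / 2 * Real.exp (-(1 / θ ^ 2)) + 1 / 2 * Real.exp (-β) := by
    rw [div_le_iff₀ (by positivity)]
    have h3 := h1.trans hb
    rw [hcard, mul_assoc] at h3
    have h4 := le_of_mul_le_mul_left h3 (by positivity)
    linarith
  set m := min (β * ζ / 4) (ζ ^ 2 / (2 ^ 10 * θ ^ 2)) with hm
  have hm1 : m / 100 ≤ β := by
    have : m ≤ β * ζ / 4 := min_le_left _ _
    nlinarith
  have hm2 : m / 100 ≤ 1 / θ ^ 2 := by
    have a1 : m ≤ ζ ^ 2 / (2 ^ 10 * θ ^ 2) := min_le_right _ _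
    have a2 : ζ ^ 2 / (2 ^ 10 * θ ^ 2) = (ζ ^ 2 / 2 ^ 10) * (1 / θ ^ 2) := by
      field_simp
    have a3 : 0 < 1 / θ ^ 2 := by positivity
    have a4 : ζ ^ 2 / 2 ^ 10 ≤ 1 := by
      rw [div_le_one (by norm_num)]; nlinarith
    rw [a2] at a1
    nlinarith
  have e1 : Real.exp (-(1 / θ ^ 2)) ≤ Real.exp (-m / 100) :=
    Real.exp_le_exp.2 (by linarith)
  have e2 : Real.exp (-β) ≤ Real.exp (-m / 100) :=
    Real.exp_le_exp.2 (by linarith)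
  linarith
/-- **Annealed magnetization bound.**  For `α ∈ (1/2, ln 3/ln 2 - 1)` and
`ζ = 1 - 2(2^α - 1) > 0`, there exist `θ₀(α) > 0`, `β₀(α) > 0` and a large enough value of
`J(1)` such that for all `0 < θ ≤ θ₀`, `β ≥ β₀` and every finite `Λ ∋ 0`, the annealed
magnetization at the origin under the plus boundary condition Gibbs measure satisfies
`E_h[ Σ_σ σ₀ μ⁺_Λ(σ) ] ≥ 1 - 2 e^{-b̄/100}`, with `b̄ = min(βζ/4, ζ²/(2¹⁰θ²))`. -/
theorem annealed_magnetization_at_origin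
    (α : ℝ) (hα₁ : 1 / 2 < α) (hα₂ : α < Real.log 3 / Real.log 2 - 1)
    (ζ : ℝ) (hζdef : ζ = 1 - 2 * ((2 : ℝ) ^ α - 1)) :
    0 < ζ ∧
    ∃ θ₀ > (0 : ℝ), ∃ β₀ > (0 : ℝ), ∃ J₁min : ℝ, ∀ J₁ : ℝ, J₁min ≤ J₁ →
      ∀ θ : ℝ, 0 < θ → θ ≤ θ₀ → ∀ β : ℝ, β₀ ≤ β →
      ∀ Λ : Finset ℤ, ∀ h0 : (0 : ℤ) ∈ Λ,
        1 - 2 * Real.exp (-(min (β * ζ / 4) (ζ ^ 2 / (2 ^ 10 * θ ^ 2))) / 100)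
          ≤ fieldE Λ (fun h =>
              gibbsAvg J₁ α θ 1 β Λ h (fun σ => spin (σ ⟨0, h0⟩))) := by
  exact final_thm α hα₁ hα₂ ζ hζdef
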